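/- There exists a homeomorphism H of the Sierpiński carpet S onto itself which is topologically mixing and whose set of periodic points is dense in S. -/

import Mathlib

/-- The Sierpiński carpet: points of `[0,1]²` admitting ternary expansions with no index at
which both digits equal `1`. -/
def sierpinskiCarpet : Set (ℝ × ℝ) :=
  {p | ∃ a b : ℕ → Fin 3, (∀ i, ¬(a i = 1 ∧ b i = 1)) ∧
    p.1 = ∑' i : ℕ, (a i : ℝ) / 3 ^ (i + 1) ∧ p.2 = ∑' i : ℕ, (b i : ℝ) / 3 ^ (i + 1)}

/-- A map is topologically mixing if for all nonempty open `U, V` there is `N` with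
`T^n(U) ∩ V ≠ ∅` for all `n ≥ N`. -/
def TopologicallyMixing {X : Type*} [TopologicalSpace X] (T : X → X) : Prop :=
  ∀ U V : Set X, IsOpen U → IsOpen V → U.Nonempty → V.Nonempty →
    ∃ N : ℕ, ∀ n : ℕ, N ≤ n → (T^[n] '' U ∩ V).Nonempty

/-- Bowen's specification property. -/
def BowenSpecification {X : Type*} [MetricSpace X] (T : X → X) : Prop :=
  ∀ ε : ℝ, 0 < ε → ∃ N : ℕ, 0 < N ∧
    ∀ s : ℕ, 2 ≤ s → ∀ y : ℕ → X, ∀ j k : ℕ → ℕ,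
      j 0 = 0 → (∀ m, m < s → j m ≤ k m) →
      (∀ m, m + 1 < s → k m < j (m + 1) ∧ N ≤ j (m + 1) - k m) →
      ∃ x : X, ∀ m, m < s → ∀ i, j m ≤ i → i ≤ k m →
        dist (T^[i] x) (T^[i] (y m)) < ε

/-! ### Outline

The carpet, rescaled to `[-1, 1]²`, is a blow-up of the sphere at a countable dense set: the map
`quot` collapses its holes, and the outer boundary is collapsed to one further point of the
pillowcase `ℝ² / (ℤ² ⋊ {±1})`, described by the map `pillow`. A back-and-forth construction
(`matching`) moves the collapsed points to a countable set invariant under a hyperbolic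
automorphism of the torus and free of rational points. The automorphism acts on the directions at
the blown-up points and hence lifts to a homeomorphism of the carpet, which inherits topological
mixing and the density of periodic points.
-/

namespace SierpinskiCarpet

open Filter Topology

/-- The point of the lattice `2ℤ²` with index `m`. -/
def lat (m : ℤ × ℤ) : ℝ × ℝ := (2 * (m.1 : ℝ), 2 * (m.2 : ℝ))

@[simp] lemma lat_fst (m : ℤ × ℤ) : (lat m).1 = 2 * (m.1 : ℝ) := rfl
@[simp] lemma lat_snd (m : ℤ × ℤ) : (lat m).2 = 2 * (m.2 : ℝ) := rfl

lemma lat_add (m n : ℤ × ℤ) : lat (m + n) = lat m + lat n := by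
  ext <;> simp <;> ring

lemma lat_sub (m n : ℤ × ℤ) : lat (m - n) = lat m - lat n := by
  ext <;> simp <;> ring

lemma lat_neg (m : ℤ × ℤ) : lat (-m) = -lat m := by
  ext <;> simp

@[simp] lemma lat_zero : lat 0 = 0 := by
  ext <;> simp

lemma lat_three_zsmul (m : ℤ × ℤ) : lat (3 • m) = (3 : ℝ) • lat m := by
  ext <;> simp <;> ring

lemma two_le_norm_lat {m : ℤ × ℤ} (hm : m ≠ 0) : 2 ≤ ‖lat m‖ := by
  have key : ∀ k : ℤ, k ≠ 0 → 2 ≤ ‖2 * (k : ℝ)‖ := by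
    intro k hk
    have : (1 : ℝ) ≤ |(k : ℝ)| := by exact_mod_cast Int.one_le_abs hk
    rw [Real.norm_eq_abs, abs_mul, abs_two]
    linarith
  by_cases h1 : m.1 = 0
  · have h2 : m.2 ≠ 0 := fun h2 => hm (Prod.ext h1 h2)
    exact (key _ h2).trans (norm_snd_le (lat m))
  · exact (key _ h1).trans (norm_fst_le (lat m))

/-- The Sierpiński carpet rescaled to the square `[-1, 1]²`, described by its complementary
holes. -/
def carpet : Set (ℝ × ℝ) :=
  {x | ‖x‖ ≤ 1 ∧ ∀ (n : ℕ) (m : ℤ × ℤ), 1 / 3 ≤ ‖(3 : ℝ) ^ n • x - lat m‖}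

lemma isCompact_carpet : IsCompact carpet := by
  apply (isCompact_closedBall (0 : ℝ × ℝ) 1).of_isClosed_subset
  · have : carpet = {x | ‖x‖ ≤ 1} ∩
        ⋂ (n : ℕ) (m : ℤ × ℤ), {x | 1 / 3 ≤ ‖(3 : ℝ) ^ n • x - lat m‖} := by
      ext x; simp [carpet]
    rw [this]
    refine (isClosed_le (by fun_prop) (by fun_prop)).inter ?_
    refine isClosed_iInter fun n => isClosed_iInter fun m => ?_
    exact isClosed_le (by fun_prop) (by fun_prop)
  · intro x hx
    simpa using hx.1

lemma exists_digit {u : ℝ} (hu : |u| ≤ 1) :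
    ∃ a : Fin 3, |3 * u - 2 * ((a : ℝ) - 1)| ≤ 1 ∧ (1 / 3 ≤ |u| → a ≠ 1) := by
  rw [abs_le] at hu
  rcases le_or_gt u (-1 / 3) with h | h
  · exact ⟨0, by rw [abs_le]; constructor <;> norm_num <;> linarith, by simp⟩
  rcases lt_or_ge u (1 / 3) with h' | h'
  · refine ⟨1, by rw [abs_le]; constructor <;> norm_num <;> linarith, fun h'' => ?_⟩
    exact absurd h'' (not_le.2 (abs_lt.2 ⟨by linarith, h'⟩))
  · exact ⟨2, by rw [abs_le]; constructor <;> norm_num <;> linarith, by simp⟩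

/-- The branch of the expanding map of `carpet` given by a pair of digits. -/
def expand (a : Fin 3 × Fin 3) (x : ℝ × ℝ) : ℝ × ℝ :=
  (3 * x.1 - 2 * ((a.1 : ℝ) - 1), 3 * x.2 - 2 * ((a.2 : ℝ) - 1))

lemma expand_eq (a : Fin 3 × Fin 3) (x : ℝ × ℝ) :
    expand a x = (3 : ℝ) • x - lat (((a.1 : ℕ) : ℤ) - 1, ((a.2 : ℕ) : ℤ) - 1) := by
  ext <;> simp [expand]

lemma exists_expand_mem {x : ℝ × ℝ} (hx : x ∈ carpet) :
    ∃ a : Fin 3 × Fin 3, ¬(a.1 = 1 ∧ a.2 = 1) ∧ expand a x ∈ carpet := by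
  obtain ⟨a, ha, ha'⟩ := exists_digit (u := x.1) ((norm_fst_le x).trans hx.1)
  obtain ⟨b, hb, hb'⟩ := exists_digit (u := x.2) ((norm_snd_le x).trans hx.1)
  refine ⟨(a, b), ?_, ?_, ?_⟩
  · rintro ⟨h1, h2⟩
    have := hx.2 0 0
    simp only [pow_zero, one_smul, lat_zero, sub_zero, Prod.norm_def, le_sup_iff] at this
    rcases this with h | h
    · exact ha' h h1
    · exact hb' h h2
  · simp only [Prod.norm_def, sup_le_iff]
    exact ⟨ha, hb⟩
  · intro n m
    have := hx.2 (n + 1) (3 ^ n • (((a : ℕ) : ℤ) - 1, ((b : ℕ) : ℤ) - 1) + m)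
    convert this using 2
    rw [expand_eq]
    ext <;> simp <;> ring

lemma hasSum_digits {a : ℕ → Fin 3} {u : ℕ → ℝ} (hu : ∀ n, |u n| ≤ 1)
    (h : ∀ n, u (n + 1) = 3 * u n - 2 * ((a n : ℝ) - 1)) :
    HasSum (fun i => (a i : ℝ) / 3 ^ (i + 1)) ((u 0 + 1) / 2) := by
  rw [hasSum_iff_tendsto_nat_of_nonneg (fun i => by positivity)]
  have h1 : ∀ n, ∑ i ∈ Finset.range n, (a i : ℝ) / 3 ^ (i + 1) =
      (u 0 + 1) / 2 - (u n + 1) / 2 * (1 / 3) ^ n := by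
    intro n
    induction n with
    | zero => simp
    | succ n ih =>
      rw [Finset.sum_range_succ, ih, h n, one_div_pow, one_div_pow]
      field_simp
      ring
  simp_rw [h1]
  have h2 : Filter.Tendsto (fun n => (u n + 1) / 2 * (1 / 3 : ℝ) ^ n) Filter.atTop (nhds 0) := by
    apply squeeze_zero_norm (a := fun n => (1 / 3 : ℝ) ^ n)
    · intro n
      have := abs_le.1 (hu n)
      rw [norm_mul, norm_pow, Real.norm_eq_abs, Real.norm_eq_abs, abs_of_nonneg (by linarith)]
      rw [abs_of_nonneg (by norm_num : (0:ℝ) ≤ 1/3)]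
      exact mul_le_of_le_one_left (by positivity) (by linarith)
    · exact tendsto_pow_atTop_nhds_zero_of_lt_one (by norm_num) (by norm_num)
  simpa using h2.const_sub ((u 0 + 1) / 2)

lemma summable_digits (a : ℕ → Fin 3) : Summable (fun i => (a i : ℝ) / 3 ^ (i + 1)) := by
  have h : Summable (fun i : ℕ => (1 / 3 : ℝ) ^ i) :=
    summable_geometric_of_lt_one (by norm_num) (by norm_num)
  refine Summable.of_nonneg_of_le (fun i => by positivity) (fun i => ?_) h
  have : ((a i : ℕ) : ℝ) ≤ 3 := by exact_mod_cast (a i).2.le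
  rw [one_div_pow, pow_succ, div_le_div_iff₀ (by positivity) (by positivity)]
  nlinarith [pow_pos (by norm_num : (0:ℝ) < 3) i]

/-- The tails of a ternary expansion, rescaled to `[-1, 1]`. -/
noncomputable def digitTail (a : ℕ → Fin 3) (n : ℕ) : ℝ :=
  2 * ∑' i : ℕ, (a (n + i) : ℝ) / 3 ^ (i + 1) - 1

lemma digitTail_succ (a : ℕ → Fin 3) (n : ℕ) :
    digitTail a (n + 1) = 3 * digitTail a n - 2 * ((a n : ℝ) - 1) := by
  unfold digitTail
  rw [(summable_digits (fun i => a (n + i))).tsum_eq_zero_add]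
  have : ∀ i, ((a (n + (i + 1)) : ℕ) : ℝ) / 3 ^ (i + 1 + 1) =
      (1 / 3) * (((a (n + 1 + i) : ℕ) : ℝ) / 3 ^ (i + 1)) := by
    intro i
    rw [show n + (i + 1) = n + 1 + i by ring]
    rw [pow_succ _ (i + 1)]
    field_simp
  simp_rw [this, tsum_mul_left]
  simp
  ring

lemma abs_digitTail_le (a : ℕ → Fin 3) (n : ℕ) : |digitTail a n| ≤ 1 := by
  have h0 : 0 ≤ ∑' i : ℕ, (a (n + i) : ℝ) / 3 ^ (i + 1) := tsum_nonneg fun i => by positivity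
  have h1 : ∑' i : ℕ, (a (n + i) : ℝ) / 3 ^ (i + 1) ≤ 1 := by
    have := hasSum_digits (a := fun _ => 2) (u := fun _ => 1) (by simp) (by norm_num)
    refine ((summable_digits fun i => a (n + i)).tsum_le_tsum (fun i => ?_) this.summable).trans ?_
    · have : ((a (n + i) : ℕ) : ℝ) ≤ ((2 : Fin 3) : ℕ) := by exact_mod_cast Fin.le_last (a (n + i))
      gcongr
    · rw [this.tsum_eq]; norm_num
  unfold digitTail
  rw [abs_le]
  constructor <;> linarith

lemma mem_sierpinskiCarpet_iff (s : ℝ × ℝ) :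
    s ∈ sierpinskiCarpet ↔ (2 : ℝ) • s - (1, 1) ∈ carpet := by
  constructor
  · rintro ⟨a, b, hab, h1, h2⟩
    set X : ℕ → ℝ × ℝ := fun n => (digitTail a n, digitTail b n) with hX
    have hX0 : (2 : ℝ) • s - (1, 1) = X 0 := by
      ext <;> simp [hX, digitTail, h1, h2]
    have hXle : ∀ n, ‖X n‖ ≤ 1 := fun n =>
      max_le (abs_digitTail_le a n) (abs_digitTail_le b n)
    have hXs : ∀ n, X (n + 1) = expand (a n, b n) (X n) := fun n =>
      Prod.ext (digitTail_succ a n) (digitTail_succ b n)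
    have hXge : ∀ n, 1 / 3 ≤ ‖X n‖ := by
      intro n
      set j : ℤ × ℤ := (((a n : ℕ) : ℤ) - 1, ((b n : ℕ) : ℤ) - 1) with hj
      have hj0 : j ≠ 0 := by
        intro h
        apply hab n
        rw [hj, Prod.ext_iff] at h
        simp only [Prod.fst_zero, Prod.snd_zero] at h
        constructor <;> apply Fin.ext <;> simp <;> omega
      have h3 : lat j = (3 : ℝ) • X n - X (n + 1) := by rw [hXs, expand_eq]; simp [hj]
      have h4 := two_le_norm_lat hj0
      rw [h3] at h4
      have h5 := norm_sub_le ((3 : ℝ) • X n) (X (n + 1))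
      rw [norm_smul, Real.norm_eq_abs, abs_of_pos (by norm_num : (0:ℝ) < 3)] at h5
      have := hXle (n + 1)
      linarith
    rw [hX0]
    refine ⟨hXle 0, fun n m => ?_⟩
    have hN : ∃ N : ℤ × ℤ, (3 : ℝ) ^ n • X 0 = X n + lat N := by
      induction n with
      | zero => exact ⟨0, by simp⟩
      | succ n ih =>
        obtain ⟨N, hN⟩ := ih
        refine ⟨(((a n : ℕ) : ℤ) - 1, ((b n : ℕ) : ℤ) - 1) + 3 • N, ?_⟩
        rw [pow_succ', mul_smul, hN, hXs, expand_eq, lat_add, lat_three_zsmul, smul_add]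
        abel
    obtain ⟨N, hN⟩ := hN
    rw [hN, add_sub_assoc, ← lat_sub]
    by_cases hNm : N - m = 0
    · simpa [hNm] using hXge n
    · have h1 := two_le_norm_lat hNm
      have h2 := norm_sub_le (X n + lat (N - m)) (X n)
      rw [add_sub_cancel_left] at h2
      have := hXle n
      linarith
  · intro hx
    choose! A hA hA' using fun x (hx : x ∈ carpet) => exists_expand_mem hx
    set X : ℕ → ℝ × ℝ := fun n => (fun x => expand (A x) x)^[n] ((2 : ℝ) • s - (1, 1)) with hX
    have hXs : ∀ n, X (n + 1) = expand (A (X n)) (X n) := fun n =>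
      Function.iterate_succ_apply' _ _ _
    have hXm : ∀ n, X n ∈ carpet := by
      intro n
      induction n with
      | zero => exact hx
      | succ n ih => rw [hXs]; exact hA' _ ih
    have hX0 : X 0 = (2 : ℝ) • s - (1, 1) := rfl
    refine ⟨fun n => (A (X n)).1, fun n => (A (X n)).2, fun n => hA _ (hXm n), ?_, ?_⟩
    · rw [(hasSum_digits (u := fun n => (X n).1) (fun n => (norm_fst_le (X n)).trans (hXm n).1)
        (fun n => by rw [hXs]; rfl)).tsum_eq, hX0]
      simp
    · rw [(hasSum_digits (u := fun n => (X n).2) (fun n => (norm_snd_le (X n)).trans (hXm n).1)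
        (fun n => by rw [hXs]; rfl)).tsum_eq, hX0]
      simp

/-- The affine homeomorphism from the Sierpiński carpet to its rescaled version. -/
noncomputable def rescale : ↥sierpinskiCarpet ≃ₜ ↥carpet where
  toFun s := ⟨(2 : ℝ) • s.1 - (1, 1), (mem_sierpinskiCarpet_iff s).1 s.2⟩
  invFun x := ⟨(1 / 2 : ℝ) • (x.1 + (1, 1)), by
    rw [mem_sierpinskiCarpet_iff, smul_smul]; simp⟩
  left_inv s := by ext <;> simp
  right_inv x := by ext <;> simp
  continuous_toFun := by fun_prop
  continuous_invFun := by fun_prop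

section Radial

lemma ne_zero_of_third_le {F : Type*} [NormedAddCommGroup F] {x : F} (h : 1 / 3 ≤ ‖x‖) :
    x ≠ 0 := by
  rintro rfl
  norm_num at h

variable {F : Type*} [NormedAddCommGroup F] [NormedSpace ℝ F]

/-- The direction of a vector. -/
noncomputable def dir (v : F) : F := ‖v‖⁻¹ • v

lemma norm_dir {v : F} (hv : v ≠ 0) : ‖dir v‖ = 1 := by
  rw [dir, norm_smul, norm_inv, norm_norm, inv_mul_cancel₀ (norm_ne_zero_iff.2 hv)]

lemma dir_of_norm_eq_one {v : F} (hv : ‖v‖ = 1) : dir v = v := by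
  rw [dir, hv, inv_one, one_smul]

lemma norm_smul_dir (v : F) : ‖v‖ • dir v = v := by
  by_cases hv : v = 0
  · simp [hv]
  · rw [dir, smul_smul, mul_inv_cancel₀ (norm_ne_zero_iff.2 hv), one_smul]

lemma dir_smul {c : ℝ} (hc : 0 < c) (v : F) : dir (c • v) = dir v := by
  rw [dir, dir, norm_smul, Real.norm_eq_abs, abs_of_pos hc, smul_smul, mul_inv, mul_assoc,
    mul_comm, mul_assoc, mul_inv_cancel₀ hc.ne', mul_one]

lemma continuousAt_dir {v : F} (hv : v ≠ 0) : ContinuousAt dir v :=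
  (continuousAt_id.norm.inv₀ (norm_ne_zero_iff.2 hv)).smul continuousAt_id

/-- The radial shrinking map, moving every vector by `1` towards the origin. -/
noncomputable def shrink (v : F) : F := (1 - (max 1 ‖v‖)⁻¹) • v

lemma norm_shrink_sub_le (v w : F) : ‖shrink v - shrink w‖ ≤ ‖v - w‖ := by
  wlog h : ‖w‖ ≤ ‖v‖ generalizing v w
  · rw [norm_sub_rev, norm_sub_rev v]
    exact this w v (le_of_not_ge h)
  set M := max 1 ‖v‖
  set m := max 1 ‖w‖
  have hm : 1 ≤ m := le_max_left _ _
  have hmM : m ≤ M := max_le_max_left 1 h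
  have hM : 1 ≤ M := hm.trans hmM
  have hw : ‖w‖ ≤ m := le_max_right _ _
  have hMm : M - m ≤ ‖v - w‖ := by
    have := norm_sub_norm_le v w
    rcases max_choice 1 ‖v‖ with h1 | h1
    · have : M = 1 := h1
      linarith [norm_nonneg (v - w)]
    · have : M = ‖v‖ := h1
      linarith
  have e : shrink v - shrink w = (1 - M⁻¹) • (v - w) + (m⁻¹ - M⁻¹) • w := by
    simp only [shrink, smul_sub, sub_smul, one_smul, M, m]
    abel
  have h1 : 0 ≤ 1 - M⁻¹ := sub_nonneg.2 (inv_le_one_of_one_le₀ hM)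
  have h2 : 0 ≤ m⁻¹ - M⁻¹ := sub_nonneg.2 (inv_anti₀ (by linarith) hmM)
  rw [e]
  refine (norm_add_le _ _).trans ?_
  rw [norm_smul, norm_smul, Real.norm_eq_abs, Real.norm_eq_abs, abs_of_nonneg h1,
    abs_of_nonneg h2]
  have h3 : (m⁻¹ - M⁻¹) * ‖w‖ ≤ M⁻¹ * ‖v - w‖ := by
    calc (m⁻¹ - M⁻¹) * ‖w‖ ≤ (m⁻¹ - M⁻¹) * m := by gcongr
      _ = M⁻¹ * (M - m) := by field_simp
      _ ≤ M⁻¹ * ‖v - w‖ := by gcongr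
  linarith

/-- The collapse of the ball of radius `1/3` to the origin which fixes the unit sphere. -/
noncomputable def collapse (x : F) : F := (1 / 2 : ℝ) • shrink ((3 : ℝ) • x)

lemma norm_three_smul (x : F) : ‖(3 : ℝ) • x‖ = 3 * ‖x‖ := by
  rw [norm_smul]; norm_num

lemma norm_collapse_sub_le (x y : F) : ‖collapse x - collapse y‖ ≤ 3 / 2 * ‖x - y‖ := by
  rw [collapse, collapse, ← smul_sub, norm_smul]
  have := norm_shrink_sub_le ((3 : ℝ) • x) ((3 : ℝ) • y)
  rw [← smul_sub, norm_three_smul] at this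
  norm_num
  linarith

lemma collapse_of_le {x : F} (h : ‖x‖ ≤ 1 / 3) : collapse x = 0 := by
  have : ‖(3 : ℝ) • x‖ ≤ 1 := by rw [norm_three_smul]; linarith
  rw [collapse, shrink, max_eq_left this]
  simp

lemma collapse_of_ge {x : F} (h : 1 / 3 ≤ ‖x‖) :
    collapse x = (3 / 2 : ℝ) • x + (-1 / 2 : ℝ) • dir x := by
  have h1 : 1 ≤ ‖(3 : ℝ) • x‖ := by rw [norm_three_smul]; linarith
  rw [collapse, shrink, max_eq_right h1, norm_three_smul, dir, smul_smul, smul_smul, smul_smul,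
    ← add_smul]
  congr 1
  have : ‖x‖ ≠ 0 := by linarith
  field_simp
  ring

lemma collapse_of_ge' {x : F} (h : 1 / 3 ≤ ‖x‖) :
    collapse x = ((3 * ‖x‖ - 1) / 2) • dir x := by
  rw [collapse_of_ge h]
  nth_rw 1 [← norm_smul_dir x]
  rw [smul_smul, ← add_smul]
  congr 1
  ring

lemma norm_collapse_of_ge {x : F} (h : 1 / 3 ≤ ‖x‖) : ‖collapse x‖ = (3 * ‖x‖ - 1) / 2 := by
  rw [collapse_of_ge' h, norm_smul, norm_dir (ne_zero_of_third_le h), mul_one, Real.norm_eq_abs,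
    abs_of_nonneg (by linarith)]

lemma collapse_of_norm_eq_one {x : F} (h : ‖x‖ = 1) : collapse x = x := by
  rw [collapse_of_ge' (by rw [h]; norm_num), h, dir_of_norm_eq_one h]
  norm_num

lemma norm_collapse_le_one {x : F} (h : ‖x‖ ≤ 1) : ‖collapse x‖ ≤ 1 := by
  rcases le_total ‖x‖ (1 / 3) with h' | h'
  · simp [collapse_of_le h']
  · rw [norm_collapse_of_ge h']; linarith

lemma norm_eq_one_of_norm_collapse {x : F} (h : ‖collapse x‖ = 1) : ‖x‖ = 1 := by
  rcases le_total ‖x‖ (1 / 3) with h' | h'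
  · simp [collapse_of_le h'] at h
  · rw [norm_collapse_of_ge h'] at h; linarith

lemma collapse_eq_zero_iff {x : F} : collapse x = 0 ↔ ‖x‖ ≤ 1 / 3 := by
  refine ⟨fun h => ?_, collapse_of_le⟩
  by_contra! h'
  have := norm_collapse_of_ge h'.le
  rw [h, norm_zero] at this
  linarith

lemma norm_collapse_sub_self_le {x : F} (h : ‖x‖ ≤ 1) : ‖collapse x - x‖ ≤ (1 - ‖x‖) / 2 := by
  rcases le_total ‖x‖ (1 / 3) with h' | h'
  · rw [collapse_of_le h', zero_sub, norm_neg]; linarith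
  · rw [collapse_of_ge' h']
    nth_rw 3 [← norm_smul_dir x]
    rw [← sub_smul, norm_smul, norm_dir (ne_zero_of_third_le h'), mul_one, Real.norm_eq_abs]
    rw [show (3 * ‖x‖ - 1) / 2 - ‖x‖ = -((1 - ‖x‖) / 2) by ring, abs_neg,
      abs_of_nonneg (by linarith)]

lemma collapse_injective_off {x y : F} (h : collapse x = collapse y) (h0 : collapse x ≠ 0) :
    x = y := by
  have hx : 1 / 3 < ‖x‖ := not_le.1 fun hx => h0 (collapse_eq_zero_iff.2 hx)
  have hy : 1 / 3 < ‖y‖ := not_le.1 fun hy => h0 (h.trans (collapse_eq_zero_iff.2 hy))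
  have h1 := congrArg norm h
  rw [norm_collapse_of_ge hx.le, norm_collapse_of_ge hy.le] at h1
  have h2 : ‖x‖ = ‖y‖ := by linarith
  rw [collapse_of_ge' hx.le, collapse_of_ge' hy.le, h2] at h
  have h3 := smul_right_injective F (show (3 * ‖y‖ - 1) / 2 ≠ 0 by linarith) h
  rw [← norm_smul_dir x, ← norm_smul_dir y, h2]
  exact congrArg _ h3

end Radial

/-- The index of a box of the tiling of the plane by translates of `[-1, 1]²` which contains
a given point. -/
noncomputable def boxIndex (x : ℝ × ℝ) : ℤ × ℤ := (round (x.1 / 2), round (x.2 / 2))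

lemma norm_sub_boxIndex_le (x : ℝ × ℝ) : ‖x - lat (boxIndex x)‖ ≤ 1 := by
  have key : ∀ u : ℝ, |u - 2 * (round (u / 2) : ℝ)| ≤ 1 := by
    intro u
    have := abs_sub_round (u / 2)
    rw [abs_le] at this ⊢
    constructor <;> linarith
  exact max_le (key _) (key _)

/-- The collapse of all the central holes of the boxes `2ℤ² + [-1, 1]²`. -/
noncomputable def tileCollapse (x : ℝ × ℝ) : ℝ × ℝ :=
  lat (boxIndex x) + collapse (x - lat (boxIndex x))

lemma norm_eq_one_of_two_boxes {x : ℝ × ℝ} {m n : ℤ × ℤ} (hmn : m ≠ n) (hm : ‖x - lat m‖ ≤ 1)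
    (hn : ‖x - lat n‖ ≤ 1) : ‖x - lat m‖ = 1 := by
  have h1 := two_le_norm_lat (sub_ne_zero.2 hmn)
  have h2 := norm_sub_le (x - lat n) (x - lat m)
  rw [show x - lat n - (x - lat m) = lat (m - n) by rw [lat_sub]; abel] at h2
  linarith

lemma tileCollapse_eq {x : ℝ × ℝ} {m : ℤ × ℤ} (hm : ‖x - lat m‖ ≤ 1) :
    tileCollapse x = lat m + collapse (x - lat m) := by
  by_cases h : m = boxIndex x
  · rw [h, tileCollapse]
  · rw [tileCollapse, collapse_of_norm_eq_one (norm_eq_one_of_two_boxes h hm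
      (norm_sub_boxIndex_le x)), collapse_of_norm_eq_one (norm_eq_one_of_two_boxes (Ne.symm h)
      (norm_sub_boxIndex_le x) hm)]
    abel

lemma tileCollapse_add_lat (x : ℝ × ℝ) (m : ℤ × ℤ) :
    tileCollapse (x + lat m) = tileCollapse x + lat m := by
  have h : x + lat m - lat (boxIndex x + m) = x - lat (boxIndex x) := by rw [lat_add]; abel
  rw [tileCollapse_eq (m := boxIndex x + m) (by rw [h]; exact norm_sub_boxIndex_le x), h,
    tileCollapse, lat_add]
  abel

lemma norm_tileCollapse_sub_le {x : ℝ × ℝ} {m : ℤ × ℤ} (hm : ‖x - lat m‖ ≤ 1) :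
    ‖tileCollapse x - lat m‖ ≤ 1 := by
  rw [tileCollapse_eq hm, add_sub_cancel_left]
  exact norm_collapse_le_one hm

lemma norm_tileCollapse_sub_self_le' (x : ℝ × ℝ) :
    ‖tileCollapse x - x‖ ≤ (1 - ‖x - lat (boxIndex x)‖) / 2 := by
  have e : tileCollapse x - x = collapse (x - lat (boxIndex x)) - (x - lat (boxIndex x)) := by
    rw [tileCollapse]; abel
  rw [e]
  exact norm_collapse_sub_self_le (norm_sub_boxIndex_le x)

lemma norm_tileCollapse_sub_self_le (x : ℝ × ℝ) : ‖tileCollapse x - x‖ ≤ 1 / 2 := by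
  have := norm_tileCollapse_sub_self_le' x
  linarith [norm_nonneg (x - lat (boxIndex x))]

lemma norm_tileCollapse_sub_tileCollapse_le (x y : ℝ × ℝ) :
    ‖tileCollapse x - tileCollapse y‖ ≤ 3 / 2 * ‖x - y‖ := by
  by_cases h : boxIndex x = boxIndex y
  · have := norm_collapse_sub_le (x - lat (boxIndex x)) (y - lat (boxIndex x))
    rw [sub_sub_sub_cancel_right] at this
    have e : tileCollapse x - tileCollapse y =
        collapse (x - lat (boxIndex x)) - collapse (y - lat (boxIndex x)) := by
      rw [tileCollapse, tileCollapse, ← h]; abel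
    rwa [e]
  · have h1 := norm_tileCollapse_sub_self_le' x
    have h2 := norm_tileCollapse_sub_self_le' y
    have h3 := two_le_norm_lat (sub_ne_zero.2 h)
    have h4 : ‖lat (boxIndex x - boxIndex y)‖ ≤
        ‖x - y‖ + ‖y - lat (boxIndex y)‖ + ‖x - lat (boxIndex x)‖ := by
      rw [show lat (boxIndex x - boxIndex y) = (x - y) + (y - lat (boxIndex y)) -
        (x - lat (boxIndex x)) by rw [lat_sub]; abel]
      exact (norm_sub_le _ _).trans (add_le_add_left (norm_add_le _ _) _)
    have h5 : ‖tileCollapse x - tileCollapse y‖ ≤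
        ‖x - y‖ + ‖tileCollapse x - x‖ + ‖tileCollapse y - y‖ := by
      rw [show tileCollapse x - tileCollapse y = (x - y) + (tileCollapse x - x) -
        (tileCollapse y - y) by abel]
      exact (norm_sub_le _ _).trans (add_le_add_left (norm_add_le _ _) _)
    linarith

lemma tileCollapse_eq_lat_iff {x : ℝ × ℝ} {m : ℤ × ℤ} :
    tileCollapse x = lat m ↔ ‖x - lat m‖ ≤ 1 / 3 := by
  constructor
  · intro h
    have h1 : ‖lat (m - boxIndex x)‖ ≤ 1 := by
      rw [lat_sub, ← h]
      exact norm_tileCollapse_sub_le (norm_sub_boxIndex_le x)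
    have h2 : m = boxIndex x := by
      by_contra hne
      have := two_le_norm_lat (sub_ne_zero.2 hne)
      linarith
    subst h2
    rwa [tileCollapse, add_eq_left, collapse_eq_zero_iff] at h
  · intro h
    rw [tileCollapse_eq (h.trans (by norm_num)), collapse_of_le h, add_zero]

/-- The grid of points with an odd integer coordinate. -/
def grid : Set (ℝ × ℝ) := {x | ∃ j : ℤ, x.1 = 2 * j + 1 ∨ x.2 = 2 * j + 1}

lemma mem_grid_of_norm {x : ℝ × ℝ} {m : ℤ × ℤ} (h : ‖x - lat m‖ = 1) : x ∈ grid := by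
  rcases max_choice ‖(x - lat m).1‖ ‖(x - lat m).2‖ with h' | h'
  · rw [Prod.norm_def, h', Real.norm_eq_abs, Prod.fst_sub, lat_fst] at h
    rcases (abs_eq zero_le_one).1 h with h | h
    · exact ⟨m.1, Or.inl (by linarith)⟩
    · exact ⟨m.1 - 1, Or.inl (by push_cast; linarith)⟩
  · rw [Prod.norm_def, h', Real.norm_eq_abs, Prod.snd_sub, lat_snd] at h
    rcases (abs_eq zero_le_one).1 h with h | h
    · exact ⟨m.2, Or.inr (by linarith)⟩
    · exact ⟨m.2 - 1, Or.inr (by push_cast; linarith)⟩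

lemma norm_of_mem_grid {x : ℝ × ℝ} (hx : x ∈ grid) {m : ℤ × ℤ} (h : ‖x - lat m‖ ≤ 1) :
    ‖x - lat m‖ = 1 := by
  have key : ∀ (u : ℝ) (j k : ℤ), u = 2 * j + 1 → 1 ≤ ‖u - 2 * (k : ℝ)‖ := by
    rintro u j k rfl
    have : 1 ≤ |2 * j + 1 - 2 * k| := Int.one_le_abs (by omega)
    rw [Real.norm_eq_abs]
    exact_mod_cast this
  refine le_antisymm h ?_
  obtain ⟨j, hj | hj⟩ := hx
  · exact (key _ j m.1 hj).trans (norm_fst_le (x - lat m))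
  · exact (key _ j m.2 hj).trans (norm_snd_le (x - lat m))

lemma three_smul_mem_grid {x : ℝ × ℝ} (hx : x ∈ grid) : (3 : ℝ) • x ∈ grid := by
  obtain ⟨j, hj | hj⟩ := hx
  · exact ⟨3 * j + 1, Or.inl (by simp [hj]; ring)⟩
  · exact ⟨3 * j + 1, Or.inr (by simp [hj]; ring)⟩

lemma three_pow_smul_mem_grid {x : ℝ × ℝ} (hx : x ∈ grid) (n : ℕ) : (3 : ℝ) ^ n • x ∈ grid := by
  induction n with
  | zero => simpa
  | succ n ih => rw [pow_succ', mul_smul]; exact three_smul_mem_grid ih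

lemma lat_notMem_grid (m : ℤ × ℤ) : lat m ∉ grid := by
  intro h
  have := norm_of_mem_grid h (m := m) (by simp)
  simp at this

lemma tileCollapse_of_mem_grid {x : ℝ × ℝ} (hx : x ∈ grid) : tileCollapse x = x := by
  rw [tileCollapse, collapse_of_norm_eq_one (norm_of_mem_grid hx (norm_sub_boxIndex_le x))]
  abel

lemma mem_grid_of_tileCollapse {x : ℝ × ℝ} (hx : tileCollapse x ∈ grid) : x ∈ grid := by
  have h := norm_of_mem_grid hx (norm_tileCollapse_sub_le (norm_sub_boxIndex_le x))
  rw [tileCollapse, add_sub_cancel_left] at h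
  exact mem_grid_of_norm (norm_eq_one_of_norm_collapse h)

lemma tileCollapse_injective_off {x y : ℝ × ℝ} (h : tileCollapse x = tileCollapse y)
    (h0 : tileCollapse x ∉ Set.range lat) : x = y := by
  by_cases hxy : boxIndex x = boxIndex y
  · rw [tileCollapse, tileCollapse, ← hxy] at h
    have := collapse_injective_off (add_left_cancel h)
      fun h' => h0 ⟨boxIndex x, by rw [tileCollapse, h', add_zero]⟩
    exact sub_left_injective this
  · have h1 := norm_tileCollapse_sub_le (norm_sub_boxIndex_le x)
    have h2 := norm_tileCollapse_sub_le (norm_sub_boxIndex_le y)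
    rw [← h] at h2
    have hg := mem_grid_of_norm (norm_eq_one_of_two_boxes hxy h1 h2)
    have hg' : tileCollapse y ∈ grid := h ▸ hg
    rwa [tileCollapse_of_mem_grid (mem_grid_of_tileCollapse hg),
      tileCollapse_of_mem_grid (mem_grid_of_tileCollapse hg')] at h

/-- The contraction `x ↦ tileCollapse (x / 3)`. -/
noncomputable def contr (x : ℝ × ℝ) : ℝ × ℝ := tileCollapse ((1 / 3 : ℝ) • x)

lemma norm_contr_sub_le (x y : ℝ × ℝ) : ‖contr x - contr y‖ ≤ 1 / 2 * ‖x - y‖ := by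
  have := norm_tileCollapse_sub_tileCollapse_le ((1 / 3 : ℝ) • x) ((1 / 3 : ℝ) • y)
  rw [← smul_sub, norm_smul] at this
  rw [contr, contr]
  norm_num at this ⊢
  linarith

lemma continuous_contr : Continuous contr := by
  refine (LipschitzWith.of_dist_le_mul (K := 1 / 2) fun x y => ?_).continuous
  simpa [dist_eq_norm] using norm_contr_sub_le x y

lemma norm_contr_iterate_sub_le (n : ℕ) (x y : ℝ × ℝ) :
    ‖contr^[n] x - contr^[n] y‖ ≤ (1 / 2) ^ n * ‖x - y‖ := by
  induction n with
  | zero => simp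
  | succ n ih =>
    rw [Function.iterate_succ_apply', Function.iterate_succ_apply']
    refine (norm_contr_sub_le _ _).trans ?_
    rw [pow_succ', mul_assoc]
    gcongr

lemma contr_add_lat (x : ℝ × ℝ) (m : ℤ × ℤ) : contr (x + (3 : ℝ) • lat m) = contr x + lat m := by
  rw [contr, contr, ← tileCollapse_add_lat, smul_add, smul_smul]
  norm_num

lemma contr_three_smul (x : ℝ × ℝ) : contr ((3 : ℝ) • x) = tileCollapse x := by
  rw [contr, smul_smul]
  norm_num

/-- The approximations of the quotient map collapsing the holes of the carpet. -/
noncomputable def quotApprox (n : ℕ) (x : ℝ × ℝ) : ℝ × ℝ := contr^[n] ((3 : ℝ) ^ n • x)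

lemma quotApprox_succ (n : ℕ) (x : ℝ × ℝ) :
    quotApprox (n + 1) x = contr (quotApprox n ((3 : ℝ) • x)) := by
  rw [quotApprox, quotApprox, Function.iterate_succ_apply', smul_smul, pow_succ]

lemma dist_quotApprox_succ (x : ℝ × ℝ) (n : ℕ) :
    dist (quotApprox n x) (quotApprox (n + 1) x) ≤ 1 / 2 * (1 / 2) ^ n := by
  rw [dist_comm, dist_eq_norm, quotApprox, quotApprox, Function.iterate_succ_apply, pow_succ',
    mul_smul, contr_three_smul]
  refine (norm_contr_iterate_sub_le _ _ _).trans ?_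
  rw [mul_comm]
  gcongr
  exact norm_tileCollapse_sub_self_le _

/-- The quotient map collapsing the holes of the carpet. -/
noncomputable def quot (x : ℝ × ℝ) : ℝ × ℝ := limUnder atTop (fun n => quotApprox n x)

lemma tendsto_quotApprox (x : ℝ × ℝ) :
    Tendsto (fun n => quotApprox n x) atTop (𝓝 (quot x)) :=
  (cauchySeq_of_le_geometric (1 / 2) (1 / 2) (by norm_num)
    (dist_quotApprox_succ x)).tendsto_limUnder

lemma dist_quotApprox_quot (n : ℕ) (x : ℝ × ℝ) :
    dist (quotApprox n x) (quot x) ≤ (1 / 2) ^ n := by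
  refine (dist_le_of_le_geometric_of_tendsto (1 / 2) (1 / 2) (by norm_num)
    (dist_quotApprox_succ x) (tendsto_quotApprox x) n).trans_eq ?_
  ring

lemma norm_quot_sub_le (x : ℝ × ℝ) : ‖quot x - x‖ ≤ 1 := by
  have := dist_quotApprox_quot 0 x
  rw [dist_comm, dist_eq_norm] at this
  simpa [quotApprox] using this

lemma continuous_quot : Continuous quot := by
  have h : TendstoUniformly quotApprox quot atTop := by
    rw [Metric.tendstoUniformly_iff]
    intro ε hε
    obtain ⟨N, hN⟩ := exists_pow_lt_of_lt_one hε (by norm_num : (1 / 2 : ℝ) < 1)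
    filter_upwards [eventually_ge_atTop N] with n hn x
    rw [dist_comm]
    refine (dist_quotApprox_quot n x).trans_lt (lt_of_le_of_lt ?_ hN)
    exact pow_le_pow_of_le_one (by norm_num) (by norm_num) hn
  refine h.continuous (Frequently.of_forall fun n => ?_)
  exact (continuous_contr.iterate n).comp (by fun_prop)

lemma quot_eq_contr (x : ℝ × ℝ) : quot x = contr (quot ((3 : ℝ) • x)) := by
  refine tendsto_nhds_unique ((tendsto_quotApprox x).comp (tendsto_add_atTop_nat 1)) ?_
  refine Tendsto.congr (fun n => (quotApprox_succ n x).symm) ?_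
  exact (continuous_contr.tendsto _).comp (tendsto_quotApprox _)

lemma quot_eq_contr_iterate (n : ℕ) (x : ℝ × ℝ) :
    quot x = contr^[n] (quot ((3 : ℝ) ^ n • x)) := by
  induction n with
  | zero => simp
  | succ n ih =>
    rw [ih, quot_eq_contr, Function.iterate_succ_apply, smul_smul, pow_succ']

lemma quot_add_lat (x : ℝ × ℝ) (m : ℤ × ℤ) : quot (x + lat m) = quot x + lat m := by
  have h : ∀ n (x : ℝ × ℝ) (m : ℤ × ℤ), quotApprox n (x + lat m) = quotApprox n x + lat m := by
    intro n
    induction n with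
    | zero => intro x m; simp [quotApprox]
    | succ n ih =>
      intro x m
      rw [quotApprox_succ, smul_add, ← lat_three_zsmul, ih, lat_three_zsmul, contr_add_lat,
        ← quotApprox_succ]
  refine tendsto_nhds_unique (tendsto_quotApprox _) ?_
  simp_rw [h]
  exact (tendsto_quotApprox x).add_const _

lemma quot_of_mem_grid {x : ℝ × ℝ} (hx : x ∈ grid) : quot x = x := by
  have h : ∀ n (x : ℝ × ℝ), x ∈ grid → quotApprox n x = x := by
    intro n
    induction n with
    | zero => intro x _; simp [quotApprox]
    | succ n ih =>
      intro x hx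
      rw [quotApprox_succ, ih _ (three_smul_mem_grid hx), contr_three_smul,
        tileCollapse_of_mem_grid hx]
  refine tendsto_nhds_unique (tendsto_quotApprox _) ?_
  simp_rw [fun n => h n x hx]
  exact tendsto_const_nhds

lemma eq_of_norm_three_pow_smul_sub_le {x y : ℝ × ℝ} {C : ℝ}
    (h : ∀ n : ℕ, ‖(3 : ℝ) ^ n • x - (3 : ℝ) ^ n • y‖ ≤ C) : x = y := by
  by_contra hne
  have h0 : 0 < ‖x - y‖ := norm_pos_iff.2 (sub_ne_zero.2 hne)
  obtain ⟨n, hn⟩ := pow_unbounded_of_one_lt (C / ‖x - y‖) (by norm_num : (1 : ℝ) < 3)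
  have h1 := h n
  rw [← smul_sub, norm_smul, norm_pow] at h1
  rw [div_lt_iff₀ h0] at hn
  norm_num at h1
  linarith

lemma quot_of_quot_mem_grid {x : ℝ × ℝ} (hx : quot x ∈ grid) : quot x = x := by
  have h : ∀ n : ℕ, quot ((3 : ℝ) ^ n • x) = (3 : ℝ) ^ n • quot x := by
    intro n
    induction n with
    | zero => simp
    | succ n ih =>
      have h1 : quot ((3 : ℝ) ^ n • x) ∈ grid := ih ▸ three_pow_smul_mem_grid hx n
      rw [quot_eq_contr, contr] at h1
      have h2 := tileCollapse_of_mem_grid (mem_grid_of_tileCollapse h1)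
      rw [← contr, ← quot_eq_contr, ih, smul_smul, ← pow_succ'] at h2
      rw [pow_succ', mul_smul _ _ (quot x), h2, smul_smul, pow_succ']
      norm_num
  refine eq_of_norm_three_pow_smul_sub_le (C := 1) fun n => ?_
  rw [← h]
  exact norm_quot_sub_le _

@[simp] lemma quot_zero : quot 0 = 0 := by
  have h : ∀ n, quotApprox n 0 = 0 := by
    intro n
    induction n with
    | zero => simp [quotApprox]
    | succ n ih =>
      rw [quotApprox_succ, smul_zero, ih, contr, smul_zero, ← lat_zero, tileCollapse_eq_lat_iff]
      simp
  refine tendsto_nhds_unique (tendsto_quotApprox _) ?_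
  simp_rw [h]
  exact tendsto_const_nhds

lemma quot_lat (m : ℤ × ℤ) : quot (lat m) = lat m := by
  have := quot_add_lat 0 m
  simpa using this

lemma norm_quot_lt_one {x : ℝ × ℝ} (hx : ‖x‖ < 1) : ‖quot x‖ < 1 := by
  by_contra! h
  have hc : ContinuousOn (fun t : ℝ => ‖quot (t • x)‖) (Set.Icc 0 1) :=
    (continuous_quot.comp (by fun_prop : Continuous fun t : ℝ => t • x)).norm.continuousOn
  obtain ⟨t, ht, ht'⟩ := intermediate_value_Icc zero_le_one hc
    (show (1 : ℝ) ∈ _ by simpa using h)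
  simp only at ht'
  have hg : quot (t • x) ∈ grid := mem_grid_of_norm (m := 0) (by simpa using ht')
  rw [quot_of_quot_mem_grid hg, norm_smul, Real.norm_eq_abs, abs_of_nonneg ht.1] at ht'
  nlinarith [ht.2, norm_nonneg x]

lemma quot_of_norm_eq_one {x : ℝ × ℝ} (hx : ‖x‖ = 1) : quot x = x :=
  quot_of_mem_grid (mem_grid_of_norm (m := 0) (by simpa using hx))

lemma norm_quot_le_one {x : ℝ × ℝ} (hx : ‖x‖ ≤ 1) : ‖quot x‖ ≤ 1 := by
  rcases hx.lt_or_eq with h | h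
  · exact (norm_quot_lt_one h).le
  · rw [quot_of_norm_eq_one h, h]

lemma norm_quot_sub_lat_le_one_iff {x : ℝ × ℝ} {m : ℤ × ℤ} :
    ‖quot x - lat m‖ ≤ 1 ↔ ‖x - lat m‖ ≤ 1 := by
  have key : ∀ {x : ℝ × ℝ} {m : ℤ × ℤ}, ‖x - lat m‖ ≤ 1 → ‖quot x - lat m‖ ≤ 1 := by
    intro x m h
    have := norm_quot_le_one h
    rwa [sub_eq_add_neg, ← lat_neg, quot_add_lat, lat_neg, ← sub_eq_add_neg] at this
  refine ⟨fun h => ?_, key⟩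
  by_cases hm : m = boxIndex x
  · rw [hm]; exact norm_sub_boxIndex_le x
  · have := norm_eq_one_of_two_boxes hm h (key (norm_sub_boxIndex_le x))
    rwa [quot_of_quot_mem_grid (mem_grid_of_norm this)] at h

lemma quot_eq_lat_iff {x : ℝ × ℝ} {m : ℤ × ℤ} : quot x = lat m ↔ ‖x - lat m‖ ≤ 1 / 3 := by
  have key : ∀ y : ℝ × ℝ, ‖y - lat m‖ ≤ 1 / 3 ↔ ‖(3 : ℝ) • y - lat (3 • m)‖ ≤ 1 := by
    intro y
    rw [lat_three_zsmul, ← smul_sub, norm_three_smul]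
    constructor <;> intro h <;> linarith
  rw [quot_eq_contr, contr, tileCollapse_eq_lat_iff, key, key, smul_smul,
    ← norm_quot_sub_lat_le_one_iff (x := (3 : ℝ) • x)]
  norm_num

lemma contr_injective_off {x y : ℝ × ℝ} (h : contr x = contr y)
    (h0 : contr x ∉ Set.range lat) : x = y :=
  smul_right_injective _ (by norm_num : (1 / 3 : ℝ) ≠ 0) (tileCollapse_injective_off h h0)

lemma quot_injective_off {x y : ℝ × ℝ} (h : quot x = quot y)
    (h0 : ∀ n : ℕ, quot ((3 : ℝ) ^ n • x) ∉ Set.range lat) : x = y := by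
  have h1 : ∀ n : ℕ, quot ((3 : ℝ) ^ n • x) = quot ((3 : ℝ) ^ n • y) := by
    intro n
    induction n with
    | zero => simpa
    | succ n ih =>
      have := h0 n
      rw [quot_eq_contr] at this
      rw [quot_eq_contr, quot_eq_contr ((3 : ℝ) ^ n • y)] at ih
      rw [pow_succ', mul_smul, mul_smul]
      exact contr_injective_off ih this
  refine eq_of_norm_three_pow_smul_sub_le (C := 2) fun n => ?_
  have h2 := norm_quot_sub_le ((3 : ℝ) ^ n • x)
  have h3 := norm_quot_sub_le ((3 : ℝ) ^ n • y)
  rw [h1] at h2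
  have h4 := norm_sub_le (quot ((3 : ℝ) ^ n • y) - (3 : ℝ) ^ n • y)
    (quot ((3 : ℝ) ^ n • y) - (3 : ℝ) ^ n • x)
  rw [sub_sub_sub_cancel_left] at h4
  linarith

section Liftable

variable {F : Type*} [NormedAddCommGroup F] [NormedSpace ℝ F]

/-- The filter of points tending to `p` from the direction `θ`. -/
noncomputable def dirFilter (p θ : F) : Filter F :=
  𝓝[≠] p ⊓ comap (fun y => dir (y - p)) (𝓝 θ)

lemma tendsto_dirFilter {α : Type*} {l : Filter α} {f : α → F} {p θ : F} :
    Tendsto f l (dirFilter p θ) ↔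
      Tendsto f l (𝓝 p) ∧ (∀ᶠ a in l, f a ≠ p) ∧ Tendsto (fun a => dir (f a - p)) l (𝓝 θ) := by
  rw [dirFilter, tendsto_inf, tendsto_nhdsWithin_iff, tendsto_comap_iff, and_assoc]
  rfl

lemma tendsto_id_dirFilter (p θ : F) :
    Tendsto id (dirFilter p θ) (𝓝 p) ∧ (∀ᶠ y in dirFilter p θ, y ≠ p) ∧
      Tendsto (fun y => dir (y - p)) (dirFilter p θ) (𝓝 θ) :=
  tendsto_dirFilter.1 tendsto_id

/-- A map is liftable at a point if it induces an injective map between the directions at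
the point and the directions at its image. -/
def Liftable (f : F → F) (p : F) : Prop :=
  ∃ φ : F → F, (∀ θ, ‖θ‖ = 1 → ‖φ θ‖ = 1) ∧ Set.InjOn φ {θ | ‖θ‖ = 1} ∧
    ∀ θ, ‖θ‖ = 1 → Tendsto f (dirFilter p θ) (dirFilter (f p) (φ θ))

lemma Liftable.comp {f g : F → F} {p : F} (hg : Liftable g (f p)) (hf : Liftable f p) :
    Liftable (g ∘ f) p := by
  obtain ⟨φ, h1, h2, h3⟩ := hf
  obtain ⟨ψ, k1, k2, k3⟩ := hg
  exact ⟨ψ ∘ φ, fun θ hθ => k1 _ (h1 _ hθ), k2.comp h2 (fun θ hθ => h1 _ hθ),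
    fun θ hθ => (k3 _ (h1 _ hθ)).comp (h3 _ hθ)⟩

lemma liftable_id (p : F) : Liftable id p :=
  ⟨id, fun _ h => h, Set.injOn_id _, fun _ _ => tendsto_id⟩

lemma Liftable.congr {f g : F → F} {p : F} (hf : Liftable f p) (h : f =ᶠ[𝓝 p] g) :
    Liftable g p := by
  obtain ⟨φ, h1, h2, h3⟩ := hf
  refine ⟨φ, h1, h2, fun θ hθ => ?_⟩
  rw [← h.eq_of_nhds]
  exact (h3 θ hθ).congr' ((tendsto_id_dirFilter p θ).1.eventually h)

/-- One-sided directional derivatives exist in every direction. -/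
def DirDifferentiable (f : F → F) (p : F) : Prop :=
  ∀ θ : F, ∃ v, HasDerivWithinAt (fun t : ℝ => f (p + t • θ)) v (Set.Ioi 0) 0

lemma tendsto_of_hasDerivWithinAt {f : F → F} {p θ v : F}
    (h : HasDerivWithinAt (fun t : ℝ => f (p + t • θ)) v (Set.Ioi 0) 0) :
    Tendsto (fun t : ℝ => t⁻¹ • (f (p + t • θ) - f p)) (𝓝[>] 0) (𝓝 v) := by
  rw [hasDerivWithinAt_iff_tendsto_slope' (by simp)] at h
  refine h.congr fun t => ?_
  simp [slope]

lemma tendsto_quotient_dirFilter {f : F → F} {p θ v : F} {C : ℝ} {s : Set F} (hs : s ∈ 𝓝 p)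
    (hC : ∀ y ∈ s, ∀ y' ∈ s, ‖f y - f y'‖ ≤ C * ‖y - y'‖)
    (hv : HasDerivWithinAt (fun t : ℝ => f (p + t • θ)) v (Set.Ioi 0) 0) :
    Tendsto (fun y => ‖y - p‖⁻¹ • (f y - f p)) (dirFilter p θ) (𝓝 v) := by
  obtain ⟨h1, h2, h3⟩ := tendsto_id_dirFilter p θ
  have ht0 : Tendsto (fun y => ‖y - p‖) (dirFilter p θ) (𝓝 0) := by
    have := (tendsto_norm_sub_self p).comp h1
    simpa using this
  have ht : Tendsto (fun y => ‖y - p‖) (dirFilter p θ) (𝓝[>] 0) := by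
    refine tendsto_nhdsWithin_iff.2 ⟨ht0, ?_⟩
    filter_upwards [h2] with y hy
    exact norm_pos_iff.2 (sub_ne_zero.2 hy)
  have hlim := (tendsto_of_hasDerivWithinAt hv).comp ht
  have hdiff : Tendsto (fun y => ‖y - p‖⁻¹ • (f y - f (p + ‖y - p‖ • θ))) (dirFilter p θ)
      (𝓝 0) := by
    have hb : Tendsto (fun y => C * ‖dir (y - p) - θ‖) (dirFilter p θ) (𝓝 0) := by
      have := ((h3.sub_const θ).norm).const_mul C
      simpa using this
    refine squeeze_zero_norm' ?_ hb
    have hmem : ∀ᶠ y in dirFilter p θ, p + ‖y - p‖ • θ ∈ s := by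
      have : Tendsto (fun y => p + ‖y - p‖ • θ) (dirFilter p θ) (𝓝 p) := by
        have := (ht0.smul_const θ).const_add p
        simpa using this
      exact this.eventually hs
    filter_upwards [h2, hmem, h1.eventually hs] with y hy hy1 hy2
    have hpos : 0 < ‖y - p‖ := norm_pos_iff.2 (sub_ne_zero.2 hy)
    have h4 := hC y hy2 _ hy1
    have h5 : y - (p + ‖y - p‖ • θ) = ‖y - p‖ • (dir (y - p) - θ) := by
      rw [smul_sub, norm_smul_dir]; abel
    rw [h5, norm_smul, norm_norm] at h4
    rw [norm_smul, norm_inv, norm_norm, inv_mul_le_iff₀ hpos]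
    linarith
  have := hdiff.add hlim
  rw [zero_add] at this
  refine this.congr fun y => ?_
  simp only [Function.comp_apply, ← smul_add]
  congr 1
  abel

lemma liftable_of_dirDifferentiable {f : F → F} {p : F} {c C : ℝ} {s : Set F} (hs : s ∈ 𝓝 p)
    (hc : 0 < c) (hc' : ∀ y ∈ s, ∀ y' ∈ s, c * ‖y - y'‖ ≤ ‖f y - f y'‖)
    (hC : ∀ y ∈ s, ∀ y' ∈ s, ‖f y - f y'‖ ≤ C * ‖y - y'‖)
    (hd : DirDifferentiable f p) : Liftable f p := by
  choose v hv using hd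
  have hline : ∀ θ : F, Tendsto (fun t : ℝ => p + t • θ) (𝓝[>] 0) (𝓝 p) := by
    intro θ
    have : Tendsto (fun t : ℝ => p + t • θ) (𝓝 0) (𝓝 (p + (0 : ℝ) • θ)) :=
      Continuous.tendsto (by fun_prop) 0
    rw [zero_smul, add_zero] at this
    exact this.mono_left nhdsWithin_le_nhds
  have hlow : ∀ θ θ' : F, c * ‖θ - θ'‖ ≤ ‖v θ - v θ'‖ := by
    intro θ θ'
    have h1 := ((tendsto_of_hasDerivWithinAt (hv θ)).sub
      (tendsto_of_hasDerivWithinAt (hv θ'))).norm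
    refine ge_of_tendsto h1 ?_
    filter_upwards [(hline θ).eventually hs, (hline θ').eventually hs, self_mem_nhdsWithin]
      with t ht ht' htpos
    have htpos : 0 < t := htpos
    rw [← smul_sub, sub_sub_sub_cancel_right, norm_smul, norm_inv, Real.norm_eq_abs,
      abs_of_pos htpos, le_inv_mul_iff₀ htpos]
    have h2 := hc' _ ht _ ht'
    rw [add_sub_add_left_eq_sub, ← smul_sub, norm_smul, Real.norm_eq_abs, abs_of_pos htpos] at h2
    linarith
  have hv0 : v 0 = 0 := by
    have h1 := tendsto_of_hasDerivWithinAt (hv 0)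
    simp only [smul_zero, add_zero, sub_self] at h1
    exact tendsto_nhds_unique h1 tendsto_const_nhds
  have hvne : ∀ θ, ‖θ‖ = 1 → v θ ≠ 0 := by
    intro θ hθ h0
    have := hlow θ 0
    rw [hv0, h0, sub_zero, sub_zero, norm_zero, hθ] at this
    linarith
  have hvhom : ∀ (a : ℝ) (θ : F), 0 < a → v (a • θ) = a • v θ := by
    intro a θ ha
    have h1 := tendsto_of_hasDerivWithinAt (hv (a • θ))
    have h2 : Tendsto (fun t : ℝ => t * a) (𝓝[>] 0) (𝓝[>] 0) := by
      refine tendsto_nhdsWithin_iff.2 ⟨?_, ?_⟩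
      · have : Tendsto (fun t : ℝ => t * a) (𝓝 0) (𝓝 (0 * a)) :=
          Continuous.tendsto (by fun_prop) 0
        rw [zero_mul] at this
        exact this.mono_left nhdsWithin_le_nhds
      · filter_upwards [self_mem_nhdsWithin] with t ht
        exact mul_pos ht ha
    have h3 := ((tendsto_of_hasDerivWithinAt (hv θ)).comp h2).const_smul a
    refine tendsto_nhds_unique h1 (h3.congr fun t => ?_)
    simp only [Function.comp_apply, smul_smul, mul_inv]
    rw [mul_comm, mul_assoc, inv_mul_cancel₀ ha.ne', mul_one]
  refine ⟨fun θ => dir (v θ), fun θ hθ => norm_dir (hvne θ hθ), ?_, ?_⟩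
  · intro θ hθ θ' hθ' h
    have h1 : 0 < ‖v θ‖ := norm_pos_iff.2 (hvne θ hθ)
    have h2 : 0 < ‖v θ'‖ := norm_pos_iff.2 (hvne θ' hθ')
    have h3 : v (‖v θ'‖ • θ) = v (‖v θ‖ • θ') := by
      have e : v θ = ‖v θ‖ • dir (v θ') := by
        rw [← show dir (v θ) = dir (v θ') from h, norm_smul_dir]
      rw [hvhom _ _ h1, hvhom _ _ h2]
      calc ‖v θ'‖ • v θ = ‖v θ'‖ • ‖v θ‖ • dir (v θ') := congrArg _ e
        _ = ‖v θ‖ • v θ' := by rw [smul_comm, norm_smul_dir]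
    have h4 := hlow (‖v θ'‖ • θ) (‖v θ‖ • θ')
    rw [h3, sub_self, norm_zero] at h4
    have h5 : ‖v θ'‖ • θ = ‖v θ‖ • θ' := by
      rw [← sub_eq_zero, ← norm_le_zero_iff]
      nlinarith
    have h6 := congrArg norm h5
    have hθ1 : ‖θ‖ = 1 := hθ
    have hθ2 : ‖θ'‖ = 1 := hθ'
    rw [norm_smul, norm_smul, norm_norm, norm_norm, hθ1, hθ2, mul_one, mul_one] at h6
    rw [h6] at h5
    exact smul_right_injective F h1.ne' h5
  · intro θ hθ
    obtain ⟨h1, h2, h3⟩ := tendsto_id_dirFilter p θ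
    have hq := tendsto_quotient_dirFilter hs hC (hv θ)
    have hmem := h1.eventually hs
    refine tendsto_dirFilter.2 ⟨?_, ?_, ?_⟩
    · have ht : Tendsto (fun y => ‖y - p‖) (dirFilter p θ) (𝓝 0) := by
        have := (tendsto_norm_sub_self p).comp h1
        simpa using this
      have h4 := (ht.smul hq).add_const (f p)
      rw [zero_smul, zero_add] at h4
      refine h4.congr' ?_
      filter_upwards [h2] with y hy
      rw [smul_inv_smul₀ (norm_ne_zero_iff.2 (sub_ne_zero.2 hy)), sub_add_cancel]
    · filter_upwards [h2, hmem] with y hy hys heq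
      have := hc' y hys p (mem_of_mem_nhds hs)
      rw [heq, sub_self, norm_zero] at this
      have hpos : 0 < ‖y - p‖ := norm_pos_iff.2 (sub_ne_zero.2 hy)
      nlinarith
    · refine ((continuousAt_dir (hvne θ hθ)).tendsto.comp hq).congr' ?_
      filter_upwards [h2] with y hy
      exact dir_smul (inv_pos.2 (norm_pos_iff.2 (sub_ne_zero.2 hy))) _

lemma norm_dir_sub_dir_le {v : F} (hv : v ≠ 0) (w : F) :
    ‖dir v - dir w‖ ≤ 2 / ‖v‖ * ‖v - w‖ := by
  have hpos : 0 < ‖v‖ := norm_pos_iff.2 hv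
  have e : ‖v‖ • (dir v - dir w) = (v - w) + (‖w‖ - ‖v‖) • dir w := by
    rw [smul_sub, norm_smul_dir, sub_smul, norm_smul_dir]; abel
  have h1 : ‖dir w‖ ≤ 1 := by
    by_cases hw : w = 0
    · simp [hw, dir]
    · exact (norm_dir hw).le
  have h2 : ‖v‖ * ‖dir v - dir w‖ ≤ 2 * ‖v - w‖ := by
    rw [← norm_norm v, ← norm_smul, e]
    refine (norm_add_le _ _).trans ?_
    rw [norm_smul, Real.norm_eq_abs]
    have h3 := abs_norm_sub_norm_le w v
    rw [norm_sub_rev] at h3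
    nlinarith [abs_nonneg (‖w‖ - ‖v‖), norm_nonneg (dir w)]
  rw [div_mul_eq_mul_div, le_div_iff₀ hpos]
  linarith

lemma dirDifferentiable_dir {p : F} (hp : p ≠ 0) : DirDifferentiable dir p := by
  intro θ
  have hconv : ConvexOn ℝ Set.univ (fun t : ℝ => ‖p + t • θ‖) := by
    have h := (convexOn_univ_norm (E := F)).comp_affineMap (AffineMap.lineMap p (p + θ) : ℝ →ᵃ[ℝ] F)
    rw [Set.preimage_univ] at h
    have e : (fun t : ℝ => ‖p + t • θ‖) = norm ∘ (AffineMap.lineMap p (p + θ) : ℝ →ᵃ[ℝ] F) := by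
      ext t
      simp [AffineMap.lineMap_apply, add_comm]
    rwa [e]
  have h1 := hconv.hasDerivWithinAt_rightDeriv_of_mem_interior (x := 0) (by simp)
  have h2 : HasDerivWithinAt (fun t : ℝ => p + t • θ) ((1 : ℝ) • θ) (Set.Ioi 0) 0 :=
    ((hasDerivWithinAt_id _ _).smul_const θ).const_add p
  exact ⟨_, (h1.inv (by simpa using hp)).smul h2⟩

/-- A map `y ↦ a y + b y/‖y‖` is liftable at points which it moves along their ray. -/
lemma liftable_radial {a b : ℝ} {p : F} (ha : a ≠ 0) (hp : p ≠ 0) (hab : 0 < a * ‖p‖ + b) :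
    Liftable (fun y => a • y + b • dir y) p := by
  set R : F → F := fun y => a • y + b • dir y with hR
  have hRdir : ∀ y, R y = (a * ‖y‖ + b) • dir y := by
    intro y
    rw [add_smul, mul_smul, norm_smul_dir]
  have hp0 : 0 < ‖p‖ := norm_pos_iff.2 hp
  set r := (a * ‖p‖ + b) / 2 with hr
  set s : Set F := {y | ‖p‖ / 2 < ‖y‖ ∧ r < a * ‖y‖ + b} with hs
  have hsp : s ∈ 𝓝 p := by
    refine IsOpen.mem_nhds ?_ ⟨by linarith, by linarith⟩
    exact (isOpen_lt continuous_const continuous_norm).inter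
      (isOpen_lt continuous_const ((continuous_const.mul continuous_norm).add continuous_const))
  have hne : ∀ y ∈ s, y ≠ 0 := fun y hy => norm_pos_iff.1 (by linarith [hy.1])
  have hRn : ∀ y ∈ s, r ≤ ‖R y‖ := by
    intro y hy
    rw [hRdir, norm_smul, norm_dir (hne y hy), mul_one, Real.norm_eq_abs]
    exact hy.2.le.trans (le_abs_self _)
  have hr0 : 0 < r := by positivity
  have hRd : ∀ y ∈ s, dir (R y) = dir y := by
    intro y hy
    rw [hRdir, dir_smul (by linarith [hy.2]), dir_of_norm_eq_one (norm_dir (hne y hy))]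
  refine liftable_of_dirDifferentiable (c := |a| / (1 + |b| * (2 / r)))
    (C := |a| + |b| * (2 / (‖p‖ / 2))) hsp (by positivity) ?_ ?_ ?_
  · intro y hy y' hy'
    have e : a • (y - y') = (R y - R y') - b • (dir (R y) - dir (R y')) := by
      rw [hRd y hy, hRd y' hy']
      simp only [hR, smul_sub]
      abel
    have h1 : |a| * ‖y - y'‖ ≤ ‖R y - R y'‖ + |b| * (2 / r * ‖R y - R y'‖) := by
      rw [← Real.norm_eq_abs a, ← norm_smul, e]
      refine (norm_sub_le _ _).trans ?_
      rw [norm_smul, Real.norm_eq_abs]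
      have h3 : R y ≠ 0 := norm_pos_iff.1 (hr0.trans_le (hRn y hy))
      have h2 : ‖dir (R y) - dir (R y')‖ ≤ 2 / r * ‖R y - R y'‖ := by
        refine (norm_dir_sub_dir_le h3 _).trans ?_
        gcongr
        exact hRn y hy
      gcongr
    rw [div_mul_eq_mul_div, div_le_iff₀ (by positivity)]
    linarith
  · intro y hy y' hy'
    have e : R y - R y' = a • (y - y') + b • (dir y - dir y') := by
      simp only [hR, smul_sub]
      abel
    rw [e]
    refine (norm_add_le _ _).trans ?_
    rw [norm_smul, norm_smul, Real.norm_eq_abs, Real.norm_eq_abs, add_mul, mul_assoc |b|]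
    gcongr
    refine (norm_dir_sub_dir_le (hne y hy) _).trans ?_
    gcongr
    exact hy.1.le
  · intro θ
    obtain ⟨v, hv⟩ := dirDifferentiable_dir hp θ
    have h2 : HasDerivWithinAt (fun t : ℝ => p + t • θ) ((1 : ℝ) • θ) (Set.Ioi 0) 0 :=
      ((hasDerivWithinAt_id _ _).smul_const θ).const_add p
    exact ⟨_, (h2.const_smul a).add (hv.const_smul b)⟩

lemma liftable_affine (L : F ≃L[ℝ] F) (w p : F) : Liftable (fun y => L y + w) p := by
  by_cases hF : Subsingleton F
  · refine ⟨id, fun _ h => h, Set.injOn_id _, fun θ hθ => ?_⟩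
    rw [Subsingleton.elim θ 0, norm_zero] at hθ
    norm_num at hθ
  have hF' : Nontrivial F := not_subsingleton_iff_nontrivial.1 hF
  have hpos := L.symm.norm_pos
  refine liftable_of_dirDifferentiable (c := ‖(L.symm : F →L[ℝ] F)‖⁻¹) (C := ‖(L : F →L[ℝ] F)‖)
    (s := Set.univ) univ_mem (inv_pos.2 hpos) ?_ ?_ ?_
  · intro y _ y' _
    rw [add_sub_add_right_eq_sub, ← map_sub, inv_mul_le_iff₀ hpos]
    have := (L.symm : F →L[ℝ] F).le_opNorm (L (y - y'))
    simpa using this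
  · intro y _ y' _
    rw [add_sub_add_right_eq_sub, ← map_sub]
    exact (L : F →L[ℝ] F).le_opNorm (y - y')
  · intro θ
    have h2 : HasDerivWithinAt (fun t : ℝ => p + t • θ) ((1 : ℝ) • θ) (Set.Ioi 0) 0 :=
      ((hasDerivWithinAt_id _ _).smul_const θ).const_add p
    exact ⟨_, ((L : F →L[ℝ] F).hasFDerivAt.comp_hasDerivWithinAt _ h2).add_const w⟩

lemma liftable_smul_add {c : ℝ} (hc : c ≠ 0) (w p : F) : Liftable (fun y => c • y + w) p :=
  liftable_affine (ContinuousLinearEquiv.smulLeft (Units.mk0 c hc)) w p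

end Liftable

/-- The points of the open square to which the holes of the carpet are collapsed. -/
def centers : Set (ℝ × ℝ) :=
  {d | ‖d‖ < 1 ∧ ∃ (n : ℕ) (m : ℤ × ℤ), d = contr^[n] (lat m)}

lemma countable_centers : centers.Countable := by
  refine (Set.countable_range fun p : ℕ × (ℤ × ℤ) => contr^[p.1] (lat p.2)).mono ?_
  rintro d ⟨-, n, m, rfl⟩
  exact ⟨(n, m), rfl⟩

lemma contr_iterate_lat (n : ℕ) (m : ℤ × ℤ) :
    contr^[n] (lat m) = quot ((1 / 3 : ℝ) ^ n • lat m) := by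
  rw [quot_eq_contr_iterate n, smul_smul, ← mul_pow]
  norm_num [quot_lat]

lemma contr_iterate_lat_notMem_grid (n : ℕ) (m : ℤ × ℤ) : contr^[n] (lat m) ∉ grid := by
  intro h
  rw [contr_iterate_lat] at h
  rw [quot_of_quot_mem_grid h] at h
  have := three_pow_smul_mem_grid h n
  rw [smul_smul, ← mul_pow] at this
  norm_num at this
  exact lat_notMem_grid m this

/-- Every point of the square is covered by a point outside the holes. -/
lemma exists_tileCollapse_eq (y : ℝ × ℝ) :
    ∃ v : ℝ × ℝ, tileCollapse v = y ∧ ∀ m, 1 / 3 ≤ ‖v - lat m‖ := by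
  set t := y - lat (boxIndex y) with ht
  have ht1 : ‖t‖ ≤ 1 := norm_sub_boxIndex_le y
  obtain ⟨u, hu, hu1, hu2⟩ : ∃ u : ℝ × ℝ, collapse u = t ∧ 1 / 3 ≤ ‖u‖ ∧ ‖u‖ ≤ 1 := by
    by_cases h0 : t = 0
    · refine ⟨(1 / 3, 0), ?_, ?_, ?_⟩
      · rw [h0, collapse_eq_zero_iff]; norm_num [Prod.norm_def]
      · norm_num [Prod.norm_def]
      · norm_num [Prod.norm_def]
    · have hn : ‖((2 * ‖t‖ + 1) / 3) • dir t‖ = (2 * ‖t‖ + 1) / 3 := by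
        rw [norm_smul, norm_dir h0, mul_one, Real.norm_eq_abs, abs_of_pos (by positivity)]
      refine ⟨((2 * ‖t‖ + 1) / 3) • dir t, ?_, ?_, ?_⟩
      · rw [collapse_of_ge' (by rw [hn]; linarith [norm_nonneg t]), hn, dir_smul (by positivity),
          dir_of_norm_eq_one (norm_dir h0)]
        rw [show (3 * ((2 * ‖t‖ + 1) / 3) - 1) / 2 = ‖t‖ by ring, norm_smul_dir]
      · rw [hn]; linarith [norm_nonneg t]
      · rw [hn]; linarith
  refine ⟨lat (boxIndex y) + u, ?_, fun m => ?_⟩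
  · rw [tileCollapse_eq (m := boxIndex y) (by simpa using hu2), add_sub_cancel_left, hu, ht]
    abel
  · by_cases hm : boxIndex y = m
    · rw [← hm]; simpa using hu1
    · have h1 := two_le_norm_lat (sub_ne_zero.2 hm)
      have h2 := norm_sub_le (lat (boxIndex y) + u - lat m) u
      rw [show lat (boxIndex y) + u - lat m - u = lat (boxIndex y - m) by rw [lat_sub]; abel] at h2
      linarith

lemma exists_mem_carpet_quot_eq {y : ℝ × ℝ} (hy : ‖y‖ ≤ 1) : ∃ x ∈ carpet, quot x = y := by
  choose v hv hv' using exists_tileCollapse_eq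
  set Y : ℕ → ℝ × ℝ := fun n => (fun z => (3 : ℝ) • v z)^[n] y with hY
  have hYs : ∀ n, Y (n + 1) = (3 : ℝ) • v (Y n) := fun n => Function.iterate_succ_apply' _ _ _
  have hYc : ∀ n, contr (Y (n + 1)) = Y n := fun n => by rw [hYs, contr_three_smul, hv]
  have hstep : ∀ n, dist ((1 / 3 : ℝ) ^ n • Y n) ((1 / 3 : ℝ) ^ (n + 1) • Y (n + 1)) ≤
      1 / 2 * (1 / 3) ^ n := by
    intro n
    have h1 := norm_tileCollapse_sub_self_le (v (Y n))
    rw [hv] at h1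
    rw [dist_eq_norm, hYs, pow_succ, mul_smul, smul_smul (1 / 3 : ℝ) 3, ← smul_sub, norm_smul,
      Real.norm_eq_abs, abs_of_pos (by positivity)]
    norm_num
    rw [mul_comm]
    gcongr
  have hcau := cauchySeq_of_le_geometric (1 / 3) (1 / 2) (by norm_num) hstep
  obtain ⟨x, hx⟩ := cauchySeq_tendsto_of_complete hcau
  have hclose : ∀ n, ‖Y n - (3 : ℝ) ^ n • x‖ ≤ 1 := by
    intro n
    have h1 := dist_le_of_le_geometric_of_tendsto (1 / 3) (1 / 2) (by norm_num) hstep hx n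
    have h2 : Y n - (3 : ℝ) ^ n • x = (3 : ℝ) ^ n • ((1 / 3 : ℝ) ^ n • Y n - x) := by
      rw [smul_sub, smul_smul, ← mul_pow]
      norm_num
    rw [h2, norm_smul, Real.norm_eq_abs, abs_of_pos (by positivity), ← dist_eq_norm]
    calc (3 : ℝ) ^ n * dist ((1 / 3 : ℝ) ^ n • Y n) x
        ≤ 3 ^ n * (1 / 2 * (1 / 3) ^ n / (1 - 1 / 3)) := by gcongr
      _ = (3 * (1 / 3)) ^ n * (3 / 4) := by rw [mul_pow]; ring
      _ ≤ 1 := by norm_num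
  have hdist : ∀ n, ‖quot ((3 : ℝ) ^ n • x) - Y n‖ ≤ 2 := by
    intro n
    have h1 := norm_quot_sub_le ((3 : ℝ) ^ n • x)
    have h2 := hclose n
    have h3 := norm_sub_le (quot ((3 : ℝ) ^ n • x) - (3 : ℝ) ^ n • x) (Y n - (3 : ℝ) ^ n • x)
    rw [sub_sub_sub_cancel_right] at h3
    linarith
  have hdist' : ∀ k n, ‖quot ((3 : ℝ) ^ n • x) - Y n‖ ≤ (1 / 2) ^ k * 2 := by
    intro k
    induction k with
    | zero => simpa using hdist
    | succ k ih =>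
      intro n
      rw [quot_eq_contr, ← hYc, smul_smul, ← pow_succ']
      refine (norm_contr_sub_le _ _).trans ?_
      rw [pow_succ' (1 / 2 : ℝ), mul_assoc]
      gcongr
      exact ih (n + 1)
  have hq : ∀ n, quot ((3 : ℝ) ^ n • x) = Y n := by
    intro n
    have h1 : Tendsto (fun k : ℕ => (1 / 2 : ℝ) ^ k * 2) atTop (𝓝 (0 * 2)) :=
      (tendsto_pow_atTop_nhds_zero_of_lt_one (by norm_num) (by norm_num)).mul_const 2
    rw [zero_mul] at h1
    rw [← sub_eq_zero, ← norm_le_zero_iff]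
    exact ge_of_tendsto' h1 fun k => hdist' k n
  have hq0 : quot x = y := by simpa [hY] using hq 0
  refine ⟨x, ⟨?_, fun n m => ?_⟩, hq0⟩
  · have := (norm_quot_sub_lat_le_one_iff (x := x) (m := 0)).1 (by simpa [hq0] using hy)
    simpa using this
  · by_contra! h
    have h1 : ‖(3 : ℝ) ^ (n + 1) • x - lat (3 • m)‖ < 1 := by
      rw [lat_three_zsmul, pow_succ', mul_smul, ← smul_sub, norm_three_smul]
      linarith
    have h2 := norm_quot_lt_one h1
    rw [sub_eq_add_neg, ← lat_neg, quot_add_lat, lat_neg, ← sub_eq_add_neg, hq, hYs,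
      lat_three_zsmul, ← smul_sub, norm_three_smul] at h2
    linarith [hv' (Y n) m]

lemma mem_closure_centers {y : ℝ × ℝ} (hy : ‖y‖ < 1) : y ∈ closure centers := by
  obtain ⟨x, -, rfl⟩ := exists_mem_carpet_quot_eq hy.le
  set a : ℕ → ℝ × ℝ := fun n => (1 / 3 : ℝ) ^ n • lat (boxIndex ((3 : ℝ) ^ n • x))
  have ha : Tendsto a atTop (𝓝 x) := by
    rw [tendsto_iff_norm_sub_tendsto_zero]
    refine squeeze_zero (g := fun n => (1 / 3 : ℝ) ^ n) (fun _ => norm_nonneg _) (fun n => ?_)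
      (tendsto_pow_atTop_nhds_zero_of_lt_one (by norm_num) (by norm_num))
    have h1 := norm_sub_boxIndex_le ((3 : ℝ) ^ n • x)
    have h2 : x - a n = (1 / 3 : ℝ) ^ n •
        ((3 : ℝ) ^ n • x - lat (boxIndex ((3 : ℝ) ^ n • x))) := by
      rw [smul_sub, smul_smul, ← mul_pow]
      norm_num [a]
    rw [norm_sub_rev, h2, norm_smul, Real.norm_eq_abs, abs_of_pos (by positivity)]
    exact mul_le_of_le_one_right (by positivity) h1
  have hqa := (continuous_quot.tendsto x).comp ha
  refine mem_closure_of_tendsto hqa ?_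
  filter_upwards [hqa.norm.eventually_lt_const hy] with n hn
  exact ⟨hn, n, _, (contr_iterate_lat n _).symm⟩

lemma exists_reduced_center {d : ℝ × ℝ} (hd : d ∈ centers) :
    ∃ (n : ℕ) (m : ℤ × ℤ), d = contr^[n] (lat m) ∧
      ∀ i < n, contr^[i + 1] (lat m) ∉ Set.range lat := by
  classical
  have hex : ∃ n m, d = contr^[n] (lat m) := hd.2
  obtain ⟨m, hm⟩ := Nat.find_spec hex
  refine ⟨Nat.find hex, m, hm, ?_⟩
  rintro i hi ⟨m', hm'⟩
  refine Nat.find_min hex (m := Nat.find hex - (i + 1)) (by omega) ⟨m', ?_⟩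
  rw [hm', ← Function.iterate_add_apply, Nat.sub_add_cancel hi]
  exact hm

lemma quot_three_pow_smul_eq_lat {n : ℕ} {m : ℤ × ℤ} {x : ℝ × ℝ}
    (h : quot x = contr^[n] (lat m)) (hr : ∀ i < n, contr^[i + 1] (lat m) ∉ Set.range lat) :
    quot ((3 : ℝ) ^ n • x) = lat m := by
  induction n generalizing x with
  | zero => simpa using h
  | succ n ih =>
    rw [pow_succ, mul_smul]
    refine ih ?_ fun i hi => hr i (by omega)
    have h1 := hr n (by omega)
    rw [← h, quot_eq_contr] at h1
    rw [quot_eq_contr, Function.iterate_succ_apply'] at h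
    exact contr_injective_off h h1

/-- The points of the carpet which are not on the boundary of a complementary domain. -/
def carpetInt : Set (ℝ × ℝ) :=
  {x | ‖x‖ < 1 ∧ ∀ (n : ℕ) (m : ℤ × ℤ), 1 / 3 < ‖(3 : ℝ) ^ n • x - lat m‖}

lemma carpetInt_subset_carpet : carpetInt ⊆ carpet :=
  fun _ hx => ⟨hx.1.le, fun n m => (hx.2 n m).le⟩

lemma norm_quot_lt_one_of_mem_carpetInt {x : ℝ × ℝ} (hx : x ∈ carpetInt) : ‖quot x‖ < 1 :=
  norm_quot_lt_one hx.1

lemma quot_notMem_centers {x : ℝ × ℝ} (hx : x ∈ carpetInt) : quot x ∉ centers := by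
  intro h
  obtain ⟨n, m, hd, hr⟩ := exists_reduced_center h
  have := quot_eq_lat_iff.1 (quot_three_pow_smul_eq_lat hd hr)
  linarith [hx.2 n m]

lemma quot_three_pow_smul_notMem {x : ℝ × ℝ} (hx1 : ‖quot x‖ < 1) (hx : quot x ∉ centers) (n : ℕ) :
    quot ((3 : ℝ) ^ n • x) ∉ Set.range lat := by
  rintro ⟨m, hm⟩
  exact hx ⟨hx1, n, m, by rw [hm, ← quot_eq_contr_iterate]⟩

lemma mem_carpetInt_of_quot {x : ℝ × ℝ} (hx : ‖quot x‖ < 1) (hx' : quot x ∉ centers) :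
    x ∈ carpetInt := by
  refine ⟨?_, fun n m => ?_⟩
  · have h := (norm_quot_sub_lat_le_one_iff (x := x) (m := 0)).1 (by simpa using hx.le)
    rw [lat_zero, sub_zero] at h
    refine lt_of_le_of_ne h fun h1 => ?_
    rw [quot_of_norm_eq_one h1, h1] at hx
    exact lt_irrefl _ hx
  · by_contra! h
    exact quot_three_pow_smul_notMem hx hx' n ⟨m, (quot_eq_lat_iff.2 h).symm⟩

lemma quot_injective_of_mem_carpetInt {x y : ℝ × ℝ} (hx : x ∈ carpetInt) (h : quot x = quot y) :
    x = y :=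
  quot_injective_off h
    (quot_three_pow_smul_notMem (norm_quot_lt_one_of_mem_carpetInt hx) (quot_notMem_centers hx))

lemma half_mem_carpetInt : ((1 / 2, 1 / 2) : ℝ × ℝ) ∈ carpetInt := by
  refine ⟨by norm_num [Prod.norm_def], fun n m => ?_⟩
  have h1 : (1 : ℤ) ≤ |3 ^ n - 4 * m.1| := by
    refine Int.one_le_abs fun h => ?_
    have h2 : Odd ((3 : ℤ) ^ n) := Odd.pow (by decide)
    rw [sub_eq_zero.1 h] at h2
    exact (Int.not_odd_iff_even.2 ⟨2 * m.1, by ring⟩) h2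
  have h2 : (1 : ℝ) ≤ |3 ^ n - 4 * (m.1 : ℝ)| := by exact_mod_cast h1
  refine lt_of_lt_of_le ?_ (norm_fst_le _)
  have h3 : ((3 : ℝ) ^ n • ((1 / 2, 1 / 2) : ℝ × ℝ) - lat m).1 =
      1 / 2 * (3 ^ n - 4 * (m.1 : ℝ)) := by
    simp; ring
  rw [h3, norm_mul, Real.norm_eq_abs (3 ^ n - 4 * (m.1 : ℝ))]
  norm_num
  linarith

lemma mem_carpetInt_of_expand {a : Fin 3 × Fin 3} (ha : ¬(a.1 = 1 ∧ a.2 = 1)) {x : ℝ × ℝ}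
    (hx : expand a x ∈ carpetInt) : x ∈ carpetInt := by
  set j : ℤ × ℤ := (((a.1 : ℕ) : ℤ) - 1, ((a.2 : ℕ) : ℤ) - 1) with hj
  have hj0 : j ≠ 0 := by
    intro h
    apply ha
    rw [hj, Prod.ext_iff] at h
    simp only [Prod.fst_zero, Prod.snd_zero] at h
    constructor <;> apply Fin.ext <;> simp <;> omega
  have hj2 : ‖lat j‖ ≤ 2 := by
    have key : ∀ b : Fin 3, ‖2 * ((((b : ℕ) : ℤ) - 1 : ℤ) : ℝ)‖ ≤ 2 := by
      intro b
      fin_cases b <;> norm_num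
    exact max_le (key _) (key _)
  have e : (3 : ℝ) • x = expand a x + lat j := by rw [expand_eq]; simp [hj]
  have h1 := hx.1
  have hx1 : ‖x‖ < 1 := by
    have h2 := norm_add_le (expand a x) (lat j)
    rw [← e, norm_three_smul] at h2
    linarith
  refine ⟨hx1, fun n m => ?_⟩
  cases n with
  | zero =>
    rw [pow_zero, one_smul]
    by_cases hm : m = 0
    · have h2 := norm_sub_le (expand a x + lat j) (expand a x)
      rw [add_sub_cancel_left, ← e, norm_three_smul] at h2
      have := two_le_norm_lat hj0
      rw [hm, lat_zero, sub_zero]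
      linarith
    · have h2 := norm_sub_le x (x - lat m)
      rw [sub_sub_cancel] at h2
      have := two_le_norm_lat hm
      linarith
  | succ n =>
    have h2 := hx.2 n (m - 3 ^ n • j)
    convert h2 using 2
    rw [expand_eq]
    ext <;> simp [hj] <;> ring

lemma carpet_subset_closure_carpetInt : carpet ⊆ closure carpetInt := by
  have key : ∀ n : ℕ, ∀ x ∈ carpet, ∃ y ∈ carpetInt, dist x y ≤ 2 * (1 / 3) ^ n := by
    intro n
    induction n with
    | zero =>
      intro x hx
      refine ⟨_, half_mem_carpetInt, ?_⟩
      have h1 := half_mem_carpetInt.1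
      have h2 := dist_triangle x 0 ((1 / 2, 1 / 2) : ℝ × ℝ)
      rw [dist_zero_right, dist_zero_left] at h2
      linarith [hx.1]
    | succ n ih =>
      intro x hx
      obtain ⟨a, ha, hax⟩ := exists_expand_mem hx
      obtain ⟨y, hy, hxy⟩ := ih _ hax
      set w : ℝ × ℝ := (1 / 3 : ℝ) • (y + lat (((a.1 : ℕ) : ℤ) - 1, ((a.2 : ℕ) : ℤ) - 1)) with hw
      have hw' : expand a w = y := by
        rw [expand_eq, hw, smul_smul]
        norm_num
      refine ⟨w, mem_carpetInt_of_expand ha (hw' ▸ hy), ?_⟩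
      have h3 : ‖expand a x - expand a w‖ = 3 * ‖x - w‖ := by
        rw [expand_eq, expand_eq, sub_sub_sub_cancel_right, ← smul_sub, norm_three_smul]
      rw [dist_eq_norm, ← hw', h3] at hxy
      rw [dist_eq_norm, pow_succ]
      linarith
  intro x hx
  rw [Metric.mem_closure_iff]
  intro ε hε
  obtain ⟨n, hn⟩ := exists_pow_lt_of_lt_one (show 0 < ε / 2 by linarith)
    (by norm_num : (1 / 3 : ℝ) < 1)
  obtain ⟨y, hy, hxy⟩ := key n x hx
  exact ⟨y, hy, by linarith⟩

lemma liftable_contr {w : ℝ × ℝ} (h1 : contr w ∉ grid) (h2 : contr w ∉ Set.range lat) :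
    Liftable contr w := by
  set r := boxIndex ((1 / 3 : ℝ) • w) with hr
  have hle : ‖(1 / 3 : ℝ) • w - lat r‖ ≤ 1 := norm_sub_boxIndex_le _
  have hlt : ‖(1 / 3 : ℝ) • w - lat r‖ < 1 := by
    refine lt_of_le_of_ne hle fun h => h1 ?_
    have := mem_grid_of_norm h
    rwa [contr, tileCollapse_of_mem_grid this]
  have hgt : 1 / 3 < ‖(1 / 3 : ℝ) • w - lat r‖ := by
    by_contra! h
    exact h2 ⟨r, (tileCollapse_eq_lat_iff.2 h).symm⟩
  have hcomp : Liftable ((fun u => (1 : ℝ) • u + lat r) ∘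
      (fun u => (3 / 2 : ℝ) • u + (-1 / 2 : ℝ) • dir u) ∘
      (fun y => (1 / 3 : ℝ) • y + -lat r)) w := by
    refine (liftable_smul_add one_ne_zero _ _).comp (Liftable.comp ?_
      (liftable_smul_add (by norm_num) _ _))
    rw [← sub_eq_add_neg]
    exact liftable_radial (by norm_num) (ne_zero_of_third_le hgt.le) (by linarith)
  refine hcomp.congr ?_
  have hc : Continuous fun y : ℝ × ℝ => ‖(1 / 3 : ℝ) • y - lat r‖ := by fun_prop
  filter_upwards [hc.continuousAt.eventually_lt_const hlt,
    hc.continuousAt.eventually_const_lt hgt] with y hy1 hy2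
  simp only [Function.comp_apply]
  rw [← sub_eq_add_neg, ← collapse_of_ge hy2.le, one_smul, contr, tileCollapse_eq hy1.le, add_comm]

lemma liftable_contr_iterate {n : ℕ} {m : ℤ × ℤ}
    (hr : ∀ i < n, contr^[i + 1] (lat m) ∉ Set.range lat) : Liftable contr^[n] (lat m) := by
  induction n with
  | zero => exact liftable_id _
  | succ n ih =>
    rw [Function.iterate_succ']
    refine Liftable.comp (liftable_contr ?_ ?_) (ih fun i hi => hr i (by omega))
    · rw [← Function.iterate_succ_apply' contr]
      exact contr_iterate_lat_notMem_grid _ _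
    · rw [← Function.iterate_succ_apply' contr]
      exact hr n (by omega)

lemma exists_direction_quot {d : ℝ × ℝ} (hd : d ∈ centers) :
    ∃ θ : ℝ × ℝ → ℝ × ℝ,
      (∀ x ∈ carpet, quot x = d → ‖θ x‖ = 1 ∧
        Tendsto quot (𝓝[carpetInt] x) (dirFilter d (θ x))) ∧
      ∀ x ∈ carpet, ∀ y ∈ carpet, quot x = d → quot y = d → θ x = θ y → x = y := by
  obtain ⟨n, m, hdn, hr⟩ := exists_reduced_center hd
  obtain ⟨φ, hφ1, hφ2, hφ3⟩ := liftable_contr_iterate hr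
  rw [← hdn] at hφ3
  set V : ℝ × ℝ → ℝ × ℝ := fun x => quot ((3 : ℝ) ^ (n + 1) • x) - lat (3 • m) with hV
  have hVc : Continuous V := by
    have := continuous_quot
    fun_prop
  have hnorm : ∀ x ∈ carpet, quot x = d → ‖(3 : ℝ) ^ (n + 1) • x - lat (3 • m)‖ = 1 := by
    intro x hx hxd
    have h1 := quot_eq_lat_iff.1 (quot_three_pow_smul_eq_lat (hxd.trans hdn) hr)
    have h2 := hx.2 n m
    rw [lat_three_zsmul, pow_succ', mul_smul, ← smul_sub, norm_three_smul]
    linarith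
  have hVx : ∀ x ∈ carpet, quot x = d → V x = (3 : ℝ) ^ (n + 1) • x - lat (3 • m) := by
    intro x hx hxd
    simp only [hV]
    rw [quot_of_mem_grid (mem_grid_of_norm (hnorm x hx hxd))]
  have hV1 : ∀ x ∈ carpet, quot x = d → ‖V x‖ = 1 := fun x hx hxd => by
    rw [hVx x hx hxd, hnorm x hx hxd]
  refine ⟨fun x => φ (V x), fun x hx hxd => ⟨hφ1 _ (hV1 x hx hxd), ?_⟩, ?_⟩
  · have hW : Tendsto (fun x => quot ((3 : ℝ) ^ n • x)) (𝓝[carpetInt] x)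
        (dirFilter (lat m) (V x)) := by
      refine tendsto_dirFilter.2 ⟨?_, ?_, ?_⟩
      · have h1 : Continuous fun x : ℝ × ℝ => quot ((3 : ℝ) ^ n • x) :=
          continuous_quot.comp (by fun_prop)
        have h2 := h1.tendsto x
        rw [quot_three_pow_smul_eq_lat (hxd.trans hdn) hr] at h2
        exact h2.mono_left nhdsWithin_le_nhds
      · filter_upwards [self_mem_nhdsWithin] with y hy h
        have := quot_eq_lat_iff.1 h
        linarith [hy.2 n m]
      · have hV0 : V x ≠ 0 := norm_pos_iff.1 (by rw [hV1 x hx hxd]; norm_num)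
        have h1 : Tendsto (fun y => dir (V y)) (𝓝[carpetInt] x) (𝓝 (V x)) := by
          have := (continuousAt_dir hV0).tendsto.comp (hVc.tendsto x)
          rw [dir_of_norm_eq_one (hV1 x hx hxd)] at this
          exact this.mono_left nhdsWithin_le_nhds
        refine h1.congr' ?_
        have h2 : ∀ᶠ y in 𝓝[carpetInt] x, ‖V y‖ < 3 :=
          (hVc.norm.continuousAt.eventually_lt_const
            (by simp only [hV1 x hx hxd]; norm_num)).filter_mono
            nhdsWithin_le_nhds
        filter_upwards [self_mem_nhdsWithin, h2] with y hy hy2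
        have e : (1 / 3 : ℝ) • quot ((3 : ℝ) ^ (n + 1) • y) - lat m = (1 / 3 : ℝ) • V y := by
          simp only [hV]
          rw [smul_sub, lat_three_zsmul, smul_smul _ _ (lat m)]
          norm_num
        have hn3 : ‖(1 / 3 : ℝ) • V y‖ = 1 / 3 * ‖V y‖ := by rw [norm_smul]; norm_num
        have hW : quot ((3 : ℝ) ^ n • y) - lat m = collapse ((1 / 3 : ℝ) • V y) := by
          rw [quot_eq_contr, smul_smul, ← pow_succ', contr, tileCollapse_eq (m := m) ?_, e,
            add_sub_cancel_left]
          rw [e, hn3]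
          linarith
        have hgt : 1 / 3 < ‖(1 / 3 : ℝ) • V y‖ := by
          by_contra! h
          rw [collapse_of_le h, sub_eq_zero] at hW
          have := quot_eq_lat_iff.1 hW
          linarith [hy.2 n m]
        rw [hW, collapse_of_ge' hgt.le, dir_smul (by linarith), dir_smul (by norm_num),
          dir_of_norm_eq_one (norm_dir ?_)]
        rintro h0
        rw [h0, smul_zero, norm_zero] at hgt
        norm_num at hgt
    refine ((hφ3 _ (hV1 x hx hxd)).comp hW).congr fun y => ?_
    exact (quot_eq_contr_iterate n y).symm
  · intro x hx y hy hxd hyd h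
    have h1 := hφ2 (hV1 x hx hxd) (hV1 y hy hyd) h
    rw [hVx x hx hxd, hVx y hy hyd, sub_left_inj] at h1
    exact smul_right_injective _ (by positivity) h1

/-- `f` differs from the identity by a `c`-Lipschitz map vanishing off the open unit square. -/
structure NearId (c : ℝ) (f : ℝ × ℝ → ℝ × ℝ) : Prop where
  lipschitz : ∀ x y, ‖(f x - x) - (f y - y)‖ ≤ c * ‖x - y‖
  eq_self : ∀ x, 1 ≤ ‖x‖ → f x = x

namespace NearId

variable {c c' : ℝ} {f : ℝ × ℝ → ℝ × ℝ}

lemma mono (hf : NearId c f) (h : c ≤ c') : NearId c' f :=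
  ⟨fun x y => (hf.lipschitz x y).trans (by gcongr), hf.eq_self⟩

lemma le_norm_sub (hf : NearId c f) (x y : ℝ × ℝ) : (1 - c) * ‖x - y‖ ≤ ‖f x - f y‖ := by
  have h := hf.lipschitz x y
  have h1 : ‖x - y‖ ≤ ‖f x - f y‖ + ‖(f x - x) - (f y - y)‖ := by
    calc ‖x - y‖ = ‖(f x - f y) - ((f x - x) - (f y - y))‖ := by congr 1; abel
      _ ≤ _ := norm_sub_le _ _
  linarith

lemma norm_sub_le (hf : NearId c f) (x y : ℝ × ℝ) : ‖f x - f y‖ ≤ (1 + c) * ‖x - y‖ := by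
  have h := hf.lipschitz x y
  have h1 : ‖f x - f y‖ ≤ ‖x - y‖ + ‖(f x - x) - (f y - y)‖ := by
    calc ‖f x - f y‖ = ‖(x - y) + ((f x - x) - (f y - y))‖ := by congr 1; abel
      _ ≤ _ := norm_add_le _ _
  linarith

lemma injective (hf : NearId c f) (hc : c < 1) : Function.Injective f := by
  intro x y hxy
  have h := hf.le_norm_sub x y
  rw [hxy, sub_self, norm_zero] at h
  have : ‖x - y‖ ≤ 0 := by nlinarith [norm_nonneg (x - y)]
  exact sub_eq_zero.1 (norm_le_zero_iff.1 this)

lemma surjective (hf : NearId c f) (hc0 : 0 ≤ c) (hc : c < 1) : Function.Surjective f := by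
  intro d
  have hC : ContractingWith ⟨c, hc0⟩ (fun x => d - (f x - x)) := by
    refine ⟨by exact_mod_cast hc, LipschitzWith.of_dist_le_mul fun x y => ?_⟩
    rw [dist_eq_norm, dist_eq_norm]
    calc ‖d - (f x - x) - (d - (f y - y))‖ = ‖(f x - x) - (f y - y)‖ := by
          rw [← norm_neg]; congr 1; abel
      _ ≤ c * ‖x - y‖ := hf.lipschitz x y
  obtain ⟨x, hx, -⟩ := hC.exists_fixedPoint 0 (edist_ne_top _ _)
  refine ⟨x, ?_⟩
  have : d - (f x - x) = x := hx
  have h2 : d - f x = 0 := by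
    calc d - f x = d - (f x - x) - x := by abel
      _ = 0 := by rw [this, sub_self]
  exact (sub_eq_zero.1 h2).symm

lemma norm_lt_one_iff (hf : NearId c f) (hc : c < 1) {x : ℝ × ℝ} : ‖f x‖ < 1 ↔ ‖x‖ < 1 := by
  constructor
  · intro h
    by_contra hx
    rw [hf.eq_self x (not_lt.1 hx)] at h
    exact hx h
  · intro h
    by_contra hx
    have := hf.injective hc (hf.eq_self (f x) (not_lt.1 hx))
    rw [this] at hx
    exact hx h

lemma continuous (hf : NearId c f) (hc : 0 ≤ c) : Continuous f := by
  refine (LipschitzWith.of_dist_le_mul (K := ⟨1 + c, by linarith⟩) fun x y => ?_).continuous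
  rw [dist_eq_norm, dist_eq_norm]
  exact hf.norm_sub_le x y

lemma add {ε : ℝ} (hf : NearId c f) {b : ℝ × ℝ → ℝ × ℝ} (hb : ∀ x y, ‖b x - b y‖ ≤ ε * ‖x - y‖)
    (hb0 : ∀ x, 1 ≤ ‖x‖ → b x = 0) : NearId (c + ε) (fun x => f x + b x) := by
  refine ⟨fun x y => ?_, fun x hx => by simp [hf.eq_self x hx, hb0 x hx]⟩
  calc ‖f x + b x - x - (f y + b y - y)‖ = ‖((f x - x) - (f y - y)) + (b x - b y)‖ := by
        congr 1; abel
    _ ≤ c * ‖x - y‖ + ε * ‖x - y‖ :=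
        (norm_add_le _ _).trans (add_le_add (hf.lipschitz x y) (hb x y))
    _ = _ := by ring

end NearId

/-- Small smooth pushes supported away from a finite set. -/
lemma exists_push {a : ℝ × ℝ} (ha : ‖a‖ < 1) (P : Finset (ℝ × ℝ)) (haP : a ∉ P) {ε : ℝ}
    (hε : 0 < ε) : ∃ δ > 0, ∀ a' v : ℝ × ℝ, ‖a' - a‖ < δ → ‖v‖ < δ →
      ∃ b : ℝ × ℝ → ℝ × ℝ, b a' = v ∧ (∀ x ∈ P, b x = 0) ∧ (∀ x, 1 ≤ ‖x‖ → b x = 0) ∧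
        Differentiable ℝ b ∧ ∀ x y, ‖b x - b y‖ ≤ ε * ‖x - y‖ := by
  have hopen : IsOpen (Metric.ball (0 : ℝ × ℝ) 1 \ P) :=
    Metric.isOpen_ball.sdiff P.finite_toSet.isClosed
  obtain ⟨r, hr, hrs⟩ := Metric.isOpen_iff.1 hopen a ⟨by simpa using ha, by simpa using haP⟩
  let β : ContDiffBump a := ⟨r / 2, r, by positivity, by linarith⟩
  have hβ0 : ∀ x, x ∉ Metric.ball (0 : ℝ × ℝ) 1 \ (P : Set (ℝ × ℝ)) → β x = 0 := by
    intro x hx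
    refine β.zero_of_le_dist ?_
    by_contra h
    exact hx (hrs (not_le.1 h))
  obtain ⟨C, hC⟩ := ContDiff.lipschitzWith_of_hasCompactSupport (𝕂 := ℝ) β.hasCompactSupport
    (β.contDiff (n := 1)) one_ne_zero
  refine ⟨min (r / 2) (ε / (C + 1)), by positivity, fun a' v ha' hv => ?_⟩
  refine ⟨fun x => β x • v, ?_, ?_, ?_, ?_, ?_⟩
  · have : β a' = 1 := by
      refine β.one_of_mem_closedBall ?_
      rw [mem_closedBall_iff_norm]
      exact (ha'.trans_le (min_le_left _ _)).le
    simp [this]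
  · intro x hx
    simp [hβ0 x fun h => h.2 hx]
  · intro x hx
    simp [hβ0 x fun h => absurd hx (by simpa using h.1)]
  · exact (β.contDiff (n := 1)).differentiable one_ne_zero |>.smul_const v
  · intro x y
    have h1 := hC.dist_le_mul x y
    rw [dist_eq_norm, dist_eq_norm] at h1
    have h2 : (C : ℝ) * ‖v‖ ≤ ε := by
      have hv' : ‖v‖ ≤ ε / (C + 1) := (hv.trans_le (min_le_right _ _)).le
      rw [le_div_iff₀ (by positivity)] at hv'
      nlinarith [norm_nonneg v]
    calc ‖β x • v - β y • v‖ = ‖β x - β y‖ * ‖v‖ := by rw [← sub_smul, norm_smul]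
      _ ≤ (C * ‖x - y‖) * ‖v‖ := by gcongr
      _ = (C * ‖v‖) * ‖x - y‖ := by ring
      _ ≤ _ := by gcongr

/-- A finite stage of the back-and-forth construction matching `D` with `E`. -/
structure Stage (D E : Set (ℝ × ℝ)) (c : ℝ) where
  map : ℝ × ℝ → ℝ × ℝ
  pts : Finset (ℝ × ℝ)
  nearId : NearId c map
  pts_subset : ∀ a ∈ pts, a ∈ D
  map_mem : ∀ a ∈ pts, map a ∈ E

/-- `t` refines `s` by an `ε`-small perturbation. -/
structure Refines {D D' : Set (ℝ × ℝ)} {c c' : ℝ} (ε : ℝ) (s : Stage D D' c)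
    (t : Stage D D' c') : Prop where
  subset : s.pts ⊆ t.pts
  eq_on : ∀ a ∈ s.pts, t.map a = s.map a
  eq_off : ∀ x, 1 ≤ ‖x‖ → t.map x = s.map x
  differentiable : Differentiable ℝ fun x => t.map x - s.map x
  lipschitz : ∀ x y, ‖(t.map x - s.map x) - (t.map y - s.map y)‖ ≤ ε * ‖x - y‖

lemma Refines.trans {D D' : Set (ℝ × ℝ)} {c c' c'' ε ε' : ℝ} {s : Stage D D' c}
    {t : Stage D D' c'} {u : Stage D D' c''} (h : Refines ε s t) (h' : Refines ε' t u) :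
    Refines (ε + ε') s u where
  subset := h.subset.trans h'.subset
  eq_on a ha := by rw [h'.eq_on a (h.subset ha), h.eq_on a ha]
  eq_off x hx := by rw [h'.eq_off x hx, h.eq_off x hx]
  differentiable := by
    have := h.differentiable.add h'.differentiable
    simpa [Pi.add_def] using this
  lipschitz x y := by
    calc ‖(u.map x - s.map x) - (u.map y - s.map y)‖
        = ‖((t.map x - s.map x) - (t.map y - s.map y)) +
            ((u.map x - t.map x) - (u.map y - t.map y))‖ := by congr 1; abel
      _ ≤ _ := (norm_add_le _ _).trans (add_le_add (h.lipschitz x y) (h'.lipschitz x y))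
      _ = _ := by ring

section BackAndForth

variable {D D' : Set (ℝ × ℝ)} {c : ℝ}

/-- Refine a stage so that a point `a`, close to an untreated point `a₀`, is sent to `d`. -/
lemma Stage.exists_refine_of_push (s : Stage D D' c) {a₀ : ℝ × ℝ} (ha₀ : ‖a₀‖ < 1)
    (haP : a₀ ∉ s.pts) {ε : ℝ} (hε : 0 < ε) : ∃ δ > 0, ∀ a ∈ D, ∀ d ∈ D', ‖a - a₀‖ < δ →
      ‖d - s.map a‖ < δ → ∃ t : Stage D D' (c + ε), Refines ε s t ∧ a ∈ t.pts ∧ t.map a = d := by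
  classical
  obtain ⟨δ, hδ, H⟩ := exists_push ha₀ s.pts haP hε
  refine ⟨δ, hδ, fun a ha d hd h1 h2 => ?_⟩
  obtain ⟨b, hba, hbP, hb1, hbd, hbl⟩ := H a _ h1 h2
  refine ⟨⟨fun x => s.map x + b x, insert a s.pts, s.nearId.add hbl hb1, ?_, ?_⟩, ⟨?_, ?_, ?_, ?_,
    ?_⟩, ?_, ?_⟩
  · intro x hx
    rcases Finset.mem_insert.1 hx with rfl | hx
    exacts [ha, s.pts_subset x hx]
  · intro x hx
    rcases Finset.mem_insert.1 hx with rfl | hx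
    · simpa [hba] using hd
    · simpa [hbP x hx] using s.map_mem x hx
  · exact Finset.subset_insert _ _
  · intro x hx
    simp [hbP x hx]
  · intro x hx
    simp [hb1 x hx]
  · simpa using hbd
  · simpa using hbl
  · simp
  · simp [hba]

lemma Refines.self (s : Stage D D' c) {ε : ℝ} (hε : 0 < ε) :
    ∃ t : Stage D D' (c + ε), Refines ε s t ∧ t.map = s.map ∧ t.pts = s.pts :=
  ⟨⟨s.map, s.pts, s.nearId.mono (by linarith), s.pts_subset, s.map_mem⟩,
    ⟨subset_rfl, fun _ _ => rfl, fun _ _ => rfl, by simp,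
      fun x y => by simpa using by positivity⟩, rfl, rfl⟩

lemma Stage.exists_forth (s : Stage D D' c) (hc : c < 1) (hD : D ⊆ Metric.ball 0 1)
    (hD' : Metric.ball 0 1 ⊆ closure D') {a : ℝ × ℝ} (ha : a ∈ D) {ε : ℝ} (hε : 0 < ε) :
    ∃ t : Stage D D' (c + ε), Refines ε s t ∧ a ∈ t.pts := by
  by_cases haP : a ∈ s.pts
  · obtain ⟨t, ht, -, h⟩ := Refines.self s hε
    exact ⟨t, ht, h ▸ haP⟩
  have ha1 : ‖a‖ < 1 := by simpa using hD ha
  obtain ⟨δ, hδ, H⟩ := s.exists_refine_of_push ha1 haP hε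
  have hfa : s.map a ∈ closure D' := hD' (by simpa using (s.nearId.norm_lt_one_iff hc).2 ha1)
  obtain ⟨d, hd, hdist⟩ := Metric.mem_closure_iff.1 hfa δ hδ
  obtain ⟨t, ht, hat, -⟩ := H a ha d hd (by simpa using hδ) (by rwa [← dist_eq_norm, dist_comm])
  exact ⟨t, ht, hat⟩

lemma Stage.exists_back (s : Stage D D' c) (hc0 : 0 ≤ c) (hc : c < 1)
    (hD' : D' ⊆ Metric.ball 0 1) (hD : Metric.ball 0 1 ⊆ closure D) {d : ℝ × ℝ} (hd : d ∈ D')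
    {ε : ℝ} (hε : 0 < ε) :
    ∃ t : Stage D D' (c + ε), Refines ε s t ∧ ∃ a ∈ t.pts, t.map a = d := by
  obtain ⟨a₀, rfl⟩ := s.nearId.surjective hc0 hc d
  by_cases haP : a₀ ∈ s.pts
  · obtain ⟨t, ht, h', h⟩ := Refines.self s hε
    exact ⟨t, ht, a₀, h ▸ haP, by rw [h']⟩
  have ha1 : ‖a₀‖ < 1 := (s.nearId.norm_lt_one_iff hc).1 (by simpa using hD' hd)
  obtain ⟨δ, hδ, H⟩ := s.exists_refine_of_push ha1 haP hε
  obtain ⟨a, ha, hdist⟩ := Metric.mem_closure_iff.1 (hD (show a₀ ∈ _ by simpa using ha1)) (δ / 2)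
    (by positivity)
  rw [dist_eq_norm] at hdist
  have h1 := s.nearId.norm_sub_le a₀ a
  obtain ⟨t, ht, hat, h⟩ := H a ha _ hd (by rw [norm_sub_rev]; linarith)
    (by nlinarith [norm_nonneg (a₀ - a)])
  exact ⟨t, ht, a, hat, h⟩

lemma Stage.exists_back_and_forth (s : Stage D D' c) (hc0 : 0 ≤ c)
    (hDU : D ⊆ Metric.ball 0 1) (hDU' : D' ⊆ Metric.ball 0 1)
    (hD : Metric.ball 0 1 ⊆ closure D) (hD' : Metric.ball 0 1 ⊆ closure D')
    {a d : ℝ × ℝ} (ha : a ∈ D) (hd : d ∈ D') {ε : ℝ} (hε : 0 < ε) (hcε : c + ε < 1) :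
    ∃ t : Stage D D' (c + ε), Refines ε s t ∧ a ∈ t.pts ∧ ∃ a' ∈ t.pts, t.map a' = d := by
  obtain ⟨t, ht, hat⟩ := s.exists_forth (by linarith) hDU hD' ha (half_pos hε)
  obtain ⟨u, hu, a', ha', hda⟩ := t.exists_back (by linarith) (by linarith) hDU' hD hd
    (half_pos hε)
  have e1 : c + ε / 2 + ε / 2 = c + ε := by ring
  have h := ht.trans hu
  rw [add_halves] at h
  refine ⟨⟨u.map, u.pts, e1 ▸ u.nearId, u.pts_subset, u.map_mem⟩,
    ⟨h.subset, h.eq_on, h.eq_off, h.differentiable, h.lipschitz⟩, hu.subset hat, a', ha', hda⟩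

/-- Countable dense subsets of the open square are matched by a bi-Lipschitz map of the plane
which is the identity off the square and has one-sided directional derivatives. -/
theorem exists_nearId_image_eq (hDc : D.Countable) (hDc' : D'.Countable)
    (hDU : D ⊆ Metric.ball 0 1) (hDU' : D' ⊆ Metric.ball 0 1)
    (hD : Metric.ball 0 1 ⊆ closure D) (hD' : Metric.ball 0 1 ⊆ closure D') :
    ∃ g : ℝ × ℝ → ℝ × ℝ, NearId (1 / 2) g ∧ (∀ p, DirDifferentiable g p) ∧ g '' D = D' := by
  have h0 : (0 : ℝ × ℝ) ∈ Metric.ball 0 1 := by simp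
  obtain ⟨α, rfl⟩ := hDc.exists_eq_range (closure_nonempty_iff.1 ⟨0, hD h0⟩)
  obtain ⟨α', rfl⟩ := hDc'.exists_eq_range (closure_nonempty_iff.1 ⟨0, hD' h0⟩)
  let γ : ℕ → ℝ := fun n => 1 / 2 - 1 / 2 * (1 / 2) ^ n
  let ε : ℕ → ℝ := fun n => 1 / 2 * (1 / 2) ^ (n + 1)
  have hγε : ∀ n, γ n + ε n = γ (n + 1) := fun n => by simp only [γ, ε]; ring
  have hpow : ∀ n : ℕ, (1 / 2 : ℝ) ^ n ≤ 1 := fun n => pow_le_one₀ (by norm_num) (by norm_num)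
  have hγ0 : ∀ n, 0 ≤ γ n := fun n => by have := hpow n; simp only [γ]; linarith
  have hγ1 : ∀ n, γ n ≤ 1 / 2 := fun n => by
    have : (0 : ℝ) ≤ (1 / 2) ^ n := by positivity
    simp only [γ]; linarith
  have hε0 : ∀ n, 0 < ε n := fun n => by positivity
  have hstep : ∀ n (s : Stage (Set.range α) (Set.range α') (γ n)),
      ∃ t : Stage (Set.range α) (Set.range α') (γ (n + 1)), Refines (ε n) s t ∧ α n ∈ t.pts ∧
        ∃ a' ∈ t.pts, t.map a' = α' n := fun n s => by
    rw [← hγε]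
    exact s.exists_back_and_forth (hγ0 n) hDU hDU' hD hD' ⟨n, rfl⟩ ⟨n, rfl⟩ (hε0 n)
      (by rw [hγε]; linarith [hγ1 (n + 1)])
  choose next hnext using hstep
  let s₀ : Stage (Set.range α) (Set.range α') (γ 0) :=
    ⟨id, ∅, ⟨fun x y => by simp [γ], fun _ _ => rfl⟩, by simp, by simp⟩
  let S : ∀ n, Stage (Set.range α) (Set.range α') (γ n) := fun n => Nat.rec s₀ next n
  have hS : ∀ n, Refines (ε n) (S n) (S (n + 1)) := fun n => (hnext n (S n)).1
  have hSα : ∀ n, α n ∈ (S (n + 1)).pts := fun n => (hnext n (S n)).2.1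
  have hSα' : ∀ n, ∃ a ∈ (S (n + 1)).pts, (S (n + 1)).map a = α' n := fun n => (hnext n (S n)).2.2
  let b : ℕ → ℝ × ℝ → ℝ × ℝ := fun n x => (S (n + 1)).map x - (S n).map x
  have hsum : ∀ n x, (S n).map x = x + ∑ i ∈ Finset.range n, b i x := by
    intro n x
    rw [Finset.sum_range_sub (fun i => (S i).map x)]
    change _ = x + (_ - x)
    abel
  have hεs : Summable ε := (summable_geometric_of_lt_one (by norm_num)
    (by norm_num : (1 / 2 : ℝ) < 1)).comp_injective (add_left_injective 1) |>.mul_left _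
  have hb1 : ∀ n x, 1 ≤ ‖x‖ → b n x = 0 := fun n x hx => by simp [b, (hS n).eq_off x hx]
  have hbl : ∀ n x y, ‖b n x - b n y‖ ≤ ε n * ‖x - y‖ := fun n => (hS n).lipschitz
  have hbb : ∀ n x, ‖b n x‖ ≤ ε n * ‖x - (2, 0)‖ := fun n x => by
    have := hbl n x (2, 0)
    rwa [hb1 n (2, 0) (by simp [Prod.norm_def]), sub_zero] at this
  have hbs : ∀ x, Summable fun n => b n x := fun x =>
    Summable.of_norm_bounded (hεs.mul_right _) (fun n => hbb n x)
  let g : ℝ × ℝ → ℝ × ℝ := fun x => x + ∑' n, b n x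
  have hgtend : ∀ x, Tendsto (fun n => (S n).map x) atTop (𝓝 (g x)) := fun x => by
    simp only [hsum]
    exact tendsto_const_nhds.add (hbs x).hasSum.tendsto_sum_nat
  have hmono : ∀ m n, m ≤ n → (S m).pts ⊆ (S n).pts := fun m n h =>
    monotone_nat_of_le_succ (f := fun n => (S n).pts) (fun n => (hS n).subset) h
  have hgP : ∀ n, ∀ a ∈ (S n).pts, g a = (S n).map a := by
    intro n a ha
    refine tendsto_nhds_unique (hgtend a) (tendsto_const_nhds.congr' ?_)
    filter_upwards [eventually_ge_atTop n] with m hm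
    induction m, hm using Nat.le_induction with
    | base => rfl
    | succ m hm ih => rw [ih, (hS m).eq_on a (hmono n m hm ha)]
  refine ⟨g, ⟨fun x y => ?_, fun x hx => by simp [g, hb1 _ x hx]⟩, fun p θ => ?_, ?_⟩
  · have hlim : Tendsto (fun n => ‖((S n).map x - x) - ((S n).map y - y)‖) atTop
        (𝓝 ‖(g x - x) - (g y - y)‖) :=
      (((hgtend x).sub_const x).sub ((hgtend y).sub_const y)).norm
    refine le_of_tendsto' hlim fun n => ?_
    exact ((S n).nearId.lipschitz x y).trans (by gcongr; exact hγ1 n)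
  · have hd : ∀ n, ∃ v, HasDerivWithinAt (fun t : ℝ => b n (p + t • θ)) v (Set.Ioi 0) 0 := by
      intro n
      have hdiff : Differentiable ℝ fun t : ℝ => b n (p + t • θ) :=
        Differentiable.comp (hS n).differentiable (by fun_prop)
      exact ⟨_, (hdiff 0).hasDerivAt.hasDerivWithinAt⟩
    choose v hv using hd
    refine ⟨θ + ∑' n, v n, ?_⟩
    have h1 : HasDerivWithinAt (fun t : ℝ => p + t • θ) θ (Set.Ioi 0) 0 := by
      simpa using (((hasDerivAt_id (0 : ℝ)).smul_const θ).const_add p).hasDerivWithinAt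
    refine HasDerivWithinAt.add h1 ?_
    rw [hasDerivWithinAt_iff_tendsto_slope' (by simp)]
    have hv' : ∀ n, Tendsto (slope (fun t : ℝ => b n (p + t • θ)) 0) (𝓝[>] 0) (𝓝 (v n)) :=
      fun n => (hasDerivWithinAt_iff_tendsto_slope' (by simp)).1 (hv n)
    have key := tendsto_tsum_of_dominated_convergence (𝓕 := 𝓝[>] (0 : ℝ))
      (f := fun t n => slope (fun t : ℝ => b n (p + t • θ)) 0 t) (g := v)
      (bound := fun n => ε n * ‖θ‖) (hεs.mul_right _) hv' ?_
    · refine key.congr fun t => ?_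
      simp only [slope_def_module]
      rw [← Summable.tsum_sub (hbs _) (hbs _), ← Summable.tsum_const_smul]
      exact (hbs _).sub (hbs _)
    · filter_upwards [self_mem_nhdsWithin] with t ht n
      have ht' : (0 : ℝ) < t := ht
      rw [slope_def_module, norm_smul, norm_inv, sub_zero, Real.norm_of_nonneg ht'.le]
      have := hbl n (p + t • θ) (p + (0 : ℝ) • θ)
      rw [show p + t • θ - (p + (0 : ℝ) • θ) = t • θ by simp, norm_smul,
        Real.norm_of_nonneg ht'.le] at this
      rw [inv_mul_le_iff₀ ht']
      linarith
  · ext d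
    constructor
    · rintro ⟨-, ⟨n, rfl⟩, rfl⟩
      rw [hgP (n + 1) _ (hSα n)]
      exact (S (n + 1)).map_mem _ (hSα n)
    · rintro ⟨n, rfl⟩
      obtain ⟨a, ha, h⟩ := hSα' n
      exact ⟨a, (S (n + 1)).pts_subset a ha, by rw [hgP (n + 1) _ ha, h]⟩

end BackAndForth

/-- The point of the plane with integer coordinates `n`. -/
def intPt (n : ℤ × ℤ) : ℝ × ℝ := ((n.1 : ℝ), (n.2 : ℝ))

/-- The quotient map of the plane by the group generated by integer translations and `-1`,
realised in three-space; its image is a topological sphere (the pillow). -/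
noncomputable def pillow (z : ℝ × ℝ) : ℝ × ℝ × ℝ :=
  (Real.cos (2 * Real.pi * z.1), Real.cos (2 * Real.pi * z.2),
    Real.sin (2 * Real.pi * z.1) * Real.sin (2 * Real.pi * z.2))

lemma continuous_pillow : Continuous pillow := by
  unfold pillow
  fun_prop

lemma cos_two_pi_eq_iff {x y : ℝ} :
    Real.cos (2 * Real.pi * x) = Real.cos (2 * Real.pi * y) ↔ ∃ k : ℤ, y = x + k ∨ y = -x + k := by
  rw [Real.cos_eq_cos_iff]
  have hpi := Real.pi_ne_zero
  refine exists_congr fun k => or_congr ?_ ?_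
  · rw [show 2 * (k : ℝ) * Real.pi + 2 * Real.pi * x = 2 * Real.pi * (x + k) by ring]
    exact mul_right_inj' (by positivity)
  · rw [show 2 * (k : ℝ) * Real.pi - 2 * Real.pi * x = 2 * Real.pi * (-x + k) by ring]
    exact mul_right_inj' (by positivity)

lemma sin_two_pi_add_int (x : ℝ) (k : ℤ) :
    Real.sin (2 * Real.pi * (x + k)) = Real.sin (2 * Real.pi * x) := by
  rw [show 2 * Real.pi * (x + k) = 2 * Real.pi * x + k * (2 * Real.pi) by ring]
  exact Real.sin_add_int_mul_two_pi _ _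

lemma cos_two_pi_add_int (x : ℝ) (k : ℤ) :
    Real.cos (2 * Real.pi * (x + k)) = Real.cos (2 * Real.pi * x) := by
  rw [show 2 * Real.pi * (x + k) = 2 * Real.pi * x + k * (2 * Real.pi) by ring]
  exact Real.cos_add_int_mul_two_pi _ _

lemma sin_two_pi_eq_zero_iff {x : ℝ} : Real.sin (2 * Real.pi * x) = 0 ↔ ∃ k : ℤ, 2 * x = k := by
  rw [Real.sin_eq_zero_iff]
  refine exists_congr fun k => ?_
  rw [show 2 * Real.pi * x = (2 * x) * Real.pi by ring, mul_left_inj' Real.pi_ne_zero]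
  exact eq_comm

lemma pillow_add_intPt (z : ℝ × ℝ) (n : ℤ × ℤ) : pillow (z + intPt n) = pillow z := by
  simp only [pillow, intPt, Prod.fst_add, Prod.snd_add, sin_two_pi_add_int, cos_two_pi_add_int]

lemma pillow_neg (z : ℝ × ℝ) : pillow (-z) = pillow z := by
  simp [pillow]

lemma pillow_eq_iff {z w : ℝ × ℝ} :
    pillow z = pillow w ↔ ∃ n : ℤ × ℤ, w = z + intPt n ∨ w = -z + intPt n := by
  constructor
  · intro h
    simp only [pillow, Prod.mk.injEq] at h
    obtain ⟨h1, h2, h3⟩ := h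
    obtain ⟨k, hk⟩ := cos_two_pi_eq_iff.1 h1
    obtain ⟨l, hl⟩ := cos_two_pi_eq_iff.1 h2
    have hneg : ∀ x : ℝ, Real.sin (2 * Real.pi * -x) = -Real.sin (2 * Real.pi * x) := fun x => by
      rw [mul_neg, Real.sin_neg]
    rcases hk with hk | hk <;> rcases hl with hl | hl
    · exact ⟨(k, l), Or.inl (Prod.ext hk hl)⟩
    · rw [hk, hl, sin_two_pi_add_int, sin_two_pi_add_int, hneg] at h3
      have : Real.sin (2 * Real.pi * z.1) * Real.sin (2 * Real.pi * z.2) = 0 := by linarith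
      rcases mul_eq_zero.1 this with h | h
      · obtain ⟨j, hj⟩ := sin_two_pi_eq_zero_iff.1 h
        refine ⟨(k + j, l), Or.inr (Prod.ext ?_ hl)⟩
        simp [intPt]; linarith
      · obtain ⟨j, hj⟩ := sin_two_pi_eq_zero_iff.1 h
        refine ⟨(k, l - j), Or.inl (Prod.ext hk ?_)⟩
        simp [intPt]; linarith
    · rw [hk, hl, sin_two_pi_add_int, sin_two_pi_add_int, hneg] at h3
      have : Real.sin (2 * Real.pi * z.1) * Real.sin (2 * Real.pi * z.2) = 0 := by linarith
      rcases mul_eq_zero.1 this with h | h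
      · obtain ⟨j, hj⟩ := sin_two_pi_eq_zero_iff.1 h
        refine ⟨(k - j, l), Or.inl (Prod.ext ?_ hl)⟩
        simp [intPt]; linarith
      · obtain ⟨j, hj⟩ := sin_two_pi_eq_zero_iff.1 h
        refine ⟨(k, l + j), Or.inr (Prod.ext hk ?_)⟩
        simp [intPt]; linarith
    · exact ⟨(k, l), Or.inr (Prod.ext hk hl)⟩
  · rintro ⟨n, rfl | rfl⟩
    · rw [pillow_add_intPt]
    · rw [pillow_add_intPt, pillow_neg]

lemma isClosed_range_intPt : IsClosed (Set.range intPt) := by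
  have := (Int.isClosedEmbedding_coe_real.prodMap Int.isClosedEmbedding_coe_real).isClosed_range
  exact this

lemma intPt_eq_zero_of_norm_lt {n : ℤ × ℤ} (h : ‖intPt n‖ < 1) : n = 0 := by
  rw [intPt, Prod.norm_def, max_lt_iff] at h
  simp only [Real.norm_eq_abs] at h
  have h1 : |n.1| < 1 := by exact_mod_cast h.1
  have h2 : |n.2| < 1 := by exact_mod_cast h.2
  exact Prod.ext (Int.abs_lt_one_iff.1 h1) (Int.abs_lt_one_iff.1 h2)

/-- Away from the half-integer points, `pillow` is locally injective. -/
lemma eventually_eq_of_pillow_eq {ζ : ℝ × ℝ} (hζ : (2 : ℝ) • ζ ∉ Set.range intPt) :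
    ∀ᶠ p in 𝓝 ζ ×ˢ 𝓝 ζ, pillow p.1 = pillow p.2 → p.1 = p.2 := by
  rw [← nhds_prod_eq]
  have h1 : ∀ᶠ p : (ℝ × ℝ) × (ℝ × ℝ) in 𝓝 (ζ, ζ), p.1 + p.2 ∉ Set.range intPt := by
    have hc : ContinuousAt (fun p : (ℝ × ℝ) × (ℝ × ℝ) => p.1 + p.2) (ζ, ζ) := by fun_prop
    refine hc.eventually_mem (isClosed_range_intPt.isOpen_compl.mem_nhds ?_)
    simpa [two_smul] using hζ
  have h2 : ∀ᶠ p : (ℝ × ℝ) × (ℝ × ℝ) in 𝓝 (ζ, ζ), ‖p.2 - p.1‖ < 1 := by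
    have hc : ContinuousAt (fun p : (ℝ × ℝ) × (ℝ × ℝ) => ‖p.2 - p.1‖) (ζ, ζ) := by fun_prop
    exact hc.eventually_lt continuousAt_const (by simp)
  filter_upwards [h1, h2] with p hp1 hp2 hp
  obtain ⟨n, hn | hn⟩ := pillow_eq_iff.1 hp
  · have : n = 0 := intPt_eq_zero_of_norm_lt (by rw [hn] at hp2; simpa using hp2)
    rw [hn, this]
    simp [intPt, ← Prod.zero_eq_mk]
  · exact absurd ⟨n, by rw [hn]; abel⟩ hp1

/-! ### A fundamental domain parametrised by the square -/

/-- Inversion of the outer annulus of the unit square onto the unit square. -/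
noncomputable def flip (y : ℝ × ℝ) : ℝ × ℝ :=
  ((2 - 2 * ‖y‖) * (max ‖y‖ (1 / 2))⁻¹) • y

/-- Parametrisation of the front face of the pillow. -/
noncomputable def front (y : ℝ × ℝ) : ℝ × ℝ := ((2 * y.1 + 1) / 4, (2 * y.2 + 1) / 4)

/-- Parametrisation of the back face of the pillow. -/
noncomputable def back (u : ℝ × ℝ) : ℝ × ℝ := (-(u.1 + 1) / 4, (u.2 + 1) / 4)

/-- The map of the unit square to the plane whose composition with `pillow` collapses exactly the
boundary. -/
noncomputable def sect (y : ℝ × ℝ) : ℝ × ℝ :=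
  if ‖y‖ ≤ 1 / 2 then front y else back (flip y)

/-- The centre of the back face, to which the boundary of the square is collapsed. -/
noncomputable def backCenter : ℝ × ℝ := (-1 / 4, 1 / 4)

lemma flip_of_ge {y : ℝ × ℝ} (hy : 1 / 2 ≤ ‖y‖) : flip y = (2 - 2 * ‖y‖) • dir y := by
  rw [flip, max_eq_left hy, dir, smul_smul]

lemma norm_flip {y : ℝ × ℝ} (hy : 1 / 2 ≤ ‖y‖) (hy1 : ‖y‖ ≤ 1) : ‖flip y‖ = 2 - 2 * ‖y‖ := by
  have hy0 : y ≠ 0 := norm_pos_iff.1 (by linarith)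
  rw [flip_of_ge hy, norm_smul, norm_dir hy0, mul_one, Real.norm_of_nonneg (by linarith)]

lemma norm_le_iff {y : ℝ × ℝ} {r : ℝ} : ‖y‖ ≤ r ↔ |y.1| ≤ r ∧ |y.2| ≤ r := by
  rw [Prod.norm_def, max_le_iff, Real.norm_eq_abs, Real.norm_eq_abs]

lemma norm_lt_iff {y : ℝ × ℝ} {r : ℝ} : ‖y‖ < r ↔ |y.1| < r ∧ |y.2| < r := by
  rw [Prod.norm_def, max_lt_iff, Real.norm_eq_abs, Real.norm_eq_abs]

lemma pillow_front_eq_pillow_back {y : ℝ × ℝ} (hy : ‖y‖ = 1 / 2) :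
    pillow (front y) = pillow (back (flip y)) := by
  have hf : flip y = (2 : ℝ) • y := by
    rw [flip_of_ge hy.ge, dir, hy, smul_smul]; norm_num
  have h2 : Real.sin (2 * Real.pi * (front y).1) * Real.sin (2 * Real.pi * (front y).2) = 0 := by
    rw [Prod.norm_def, Real.norm_eq_abs, Real.norm_eq_abs] at hy
    rw [mul_eq_zero, sin_two_pi_eq_zero_iff, sin_two_pi_eq_zero_iff]
    have key : ∀ t : ℝ, |t| = 1 / 2 → ∃ k : ℤ, 2 * ((2 * t + 1) / 4) = k := by
      intro t ht
      rcases eq_or_eq_neg_of_abs_eq ht with h | h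
      · exact ⟨1, by rw [h]; norm_num⟩
      · exact ⟨0, by rw [h]; norm_num⟩
    rcases max_choice |y.1| |y.2| with h | h
    · exact Or.inl (key _ (h ▸ hy))
    · exact Or.inr (key _ (h ▸ hy))
  have e : back (flip y) = (-(front y).1, (front y).2) := by
    rw [hf]; simp only [back, front, Prod.smul_fst, Prod.smul_snd, smul_eq_mul, Prod.mk.injEq]
    constructor
    · ring
    · trivial
  rw [e]
  simp only [pillow, mul_neg, Real.cos_neg, Real.sin_neg, Prod.mk.injEq, true_and]
  rw [h2, neg_mul, h2, neg_zero]

lemma continuous_flip : Continuous flip := by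
  unfold flip
  have h : ∀ y : ℝ × ℝ, max ‖y‖ (1 / 2) ≠ 0 := fun y => by
    have : (1 / 2 : ℝ) ≤ max ‖y‖ (1 / 2) := le_max_right _ _
    linarith
  fun_prop (disch := exact h _)

lemma continuous_back : Continuous back := by
  unfold back
  fun_prop

lemma pillow_sect (y : ℝ × ℝ) :
    pillow (sect y) = if ‖y‖ ≤ 1 / 2 then pillow (front y) else pillow (back (flip y)) := by
  rw [sect]; split_ifs <;> rfl

lemma continuous_pillow_sect : Continuous fun y => pillow (sect y) := by
  simp only [pillow_sect]
  refine Continuous.if_le ?_ ?_ (by fun_prop) (by fun_prop) fun y => pillow_front_eq_pillow_back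
  · exact continuous_pillow.comp (by unfold front; fun_prop)
  · exact continuous_pillow.comp (continuous_back.comp continuous_flip)

lemma pillow_sect_of_ge {y : ℝ × ℝ} (hy : 1 / 2 ≤ ‖y‖) :
    pillow (sect y) = pillow (back (flip y)) := by
  rw [pillow_sect]
  split_ifs with h
  · exact pillow_front_eq_pillow_back (le_antisymm h hy)
  · rfl

lemma back_zero : back 0 = backCenter := by
  simp [back, backCenter]

lemma sect_of_norm_eq_one {y : ℝ × ℝ} (hy : ‖y‖ = 1) : sect y = backCenter := by
  rw [sect, if_neg (by rw [hy]; norm_num), ← back_zero, flip_of_ge (by rw [hy]; norm_num), hy]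
  norm_num

lemma exists_flip_eq {u : ℝ × ℝ} (hu : ‖u‖ ≤ 1) : ∃ y, 1 / 2 ≤ ‖y‖ ∧ ‖y‖ ≤ 1 ∧ flip y = u := by
  by_cases hu0 : u = 0
  · have h1 : ‖((1, 0) : ℝ × ℝ)‖ = 1 := by simp [Prod.norm_def]
    refine ⟨(1, 0), by rw [h1]; norm_num, h1.le, ?_⟩
    rw [flip, h1, hu0]; norm_num
  · have hu' : 0 < ‖u‖ := norm_pos_iff.2 hu0
    have hpos : 0 < 1 - ‖u‖ / 2 := by linarith
    have hn : ‖(1 - ‖u‖ / 2) • dir u‖ = 1 - ‖u‖ / 2 := by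
      rw [norm_smul, norm_dir hu0, mul_one, Real.norm_of_nonneg hpos.le]
    refine ⟨(1 - ‖u‖ / 2) • dir u, by rw [hn]; linarith, by rw [hn]; linarith, ?_⟩
    rw [flip_of_ge (by rw [hn]; linarith), hn, dir_smul hpos, dir_of_norm_eq_one (norm_dir hu0)]
    nth_rw 3 [← norm_smul_dir u]
    congr 1
    ring

lemma exists_pillow_sect_eq (w : ℝ × ℝ) : ∃ y, ‖y‖ ≤ 1 ∧ pillow (sect y) = pillow w := by
  obtain ⟨v, hv, hv1, hv2, hv3⟩ : ∃ v, pillow v = pillow w ∧ |v.1| ≤ 1 / 2 ∧ 0 ≤ v.2 ∧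
      v.2 ≤ 1 / 2 := by
    have h1 := abs_sub_round w.1
    have h2 := abs_sub_round w.2
    have hw : pillow (w.1 - round w.1, w.2 - round w.2) = pillow w := by
      refine pillow_eq_iff.2 ⟨(round w.1, round w.2), Or.inl ?_⟩
      simp [intPt]
    rcases le_total 0 (w.2 - round w.2) with h | h
    · exact ⟨_, hw, h1, h, (le_abs_self _).trans h2⟩
    · refine ⟨-(w.1 - round w.1, w.2 - round w.2), by rw [pillow_neg, hw], ?_, ?_, ?_⟩
      · simpa [abs_sub_comm] using h1
      · simpa using h
      · simp only [Prod.snd_neg]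
        linarith [neg_abs_le (w.2 - round w.2)]
  rw [← hv]
  rw [abs_le] at hv1
  rcases le_or_gt 0 v.1 with h | h
  · have hn : ‖(((4 * v.1 - 1) / 2, (4 * v.2 - 1) / 2) : ℝ × ℝ)‖ ≤ 1 / 2 := by
      rw [norm_le_iff, abs_le, abs_le]
      refine ⟨⟨?_, ?_⟩, ?_, ?_⟩ <;> simp only <;> linarith
    refine ⟨_, hn.trans (by norm_num), ?_⟩
    rw [sect, if_pos hn]
    congr 1
    ext <;> simp only [front] <;> ring
  · have hn : ‖((-4 * v.1 - 1, 4 * v.2 - 1) : ℝ × ℝ)‖ ≤ 1 := by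
      rw [norm_le_iff, abs_le, abs_le]
      refine ⟨⟨?_, ?_⟩, ?_, ?_⟩ <;> simp only <;> linarith
    obtain ⟨y, hy1, hy2, hy⟩ := exists_flip_eq hn
    refine ⟨y, hy2, ?_⟩
    rw [pillow_sect_of_ge hy1, hy]
    congr 1
    ext <;> simp only [back] <;> ring

lemma eq_of_sub_eq_int {a b : ℝ} (ha : a ∈ Set.Icc 0 (1 / 2 : ℝ)) (hb : b ∈ Set.Icc 0 (1 / 2 : ℝ))
    {n : ℤ} (h : b = a + n) : b = a := by
  have h1 : (n : ℝ) < 1 := by linarith [ha.1, hb.2]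
  have h2 : (-1 : ℝ) < n := by linarith [ha.2, hb.1]
  have h1' : n < 1 := by exact_mod_cast h1
  have h2' : -1 < n := by exact_mod_cast h2
  have : n = 0 := by omega
  simp [h, this]

lemma eq_of_add_eq_int {a b : ℝ} (ha : a ∈ Set.Icc 0 (1 / 2 : ℝ)) (hb : b ∈ Set.Icc 0 (1 / 2 : ℝ))
    {n : ℤ} (h : b = -a + n) : b = a := by
  have h1 : (n : ℝ) < 2 := by linarith [ha.2, hb.2]
  have h2 : (-1 : ℝ) < n := by linarith [ha.1, hb.1]
  have h1' : n < 2 := by exact_mod_cast h1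
  have h2' : -1 < n := by exact_mod_cast h2
  obtain rfl | rfl : n = 0 ∨ n = 1 := by omega
  · push_cast at h; linarith [ha.1, hb.1]
  · push_cast at h; linarith [ha.2, hb.2]

lemma eq_of_pillow_eq_of_mem {z w : ℝ × ℝ} (hz1 : z.1 ∈ Set.Icc 0 (1 / 2 : ℝ))
    (hz2 : z.2 ∈ Set.Icc 0 (1 / 2 : ℝ)) (hw1 : w.1 ∈ Set.Icc 0 (1 / 2 : ℝ))
    (hw2 : w.2 ∈ Set.Icc 0 (1 / 2 : ℝ)) (h : pillow z = pillow w) : z = w := by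
  obtain ⟨n, rfl | rfl⟩ := pillow_eq_iff.1 h
  · exact Prod.ext (eq_of_sub_eq_int hz1 hw1 rfl).symm (eq_of_sub_eq_int hz2 hw2 rfl).symm
  · exact Prod.ext (eq_of_add_eq_int hz1 hw1 rfl).symm (eq_of_add_eq_int hz2 hw2 rfl).symm

lemma front_mem {y : ℝ × ℝ} (hy : ‖y‖ ≤ 1 / 2) :
    (front y).1 ∈ Set.Icc 0 (1 / 2 : ℝ) ∧ (front y).2 ∈ Set.Icc 0 (1 / 2 : ℝ) := by
  rw [norm_le_iff, abs_le, abs_le] at hy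
  simp only [front, Set.mem_Icc]
  refine ⟨⟨?_, ?_⟩, ?_, ?_⟩ <;> linarith

lemma back_mem {u : ℝ × ℝ} (hu : ‖u‖ < 1) :
    -(back u).1 ∈ Set.Ioo 0 (1 / 2 : ℝ) ∧ (back u).2 ∈ Set.Ioo 0 (1 / 2 : ℝ) := by
  rw [norm_lt_iff, abs_lt, abs_lt] at hu
  simp only [back, Set.mem_Ioo]
  refine ⟨⟨?_, ?_⟩, ?_, ?_⟩ <;> linarith

lemma pillow_front_ne_pillow_back {y u : ℝ × ℝ} (hy : ‖y‖ ≤ 1 / 2) (hu : ‖u‖ < 1) :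
    pillow (front y) ≠ pillow (back u) := by
  intro h
  obtain ⟨⟨h1, h2⟩, h3, h4⟩ := front_mem hy
  obtain ⟨⟨h5, h6⟩, h7, h8⟩ := back_mem hu
  obtain ⟨n, hn | hn⟩ := pillow_eq_iff.1 h
  · have e : (back u).1 = (front y).1 + n.1 := congrArg Prod.fst hn
    have e1 : (-1 : ℝ) < n.1 := by linarith
    have e2 : (n.1 : ℝ) < 0 := by linarith
    have e1' : -1 < n.1 := by exact_mod_cast e1
    have e2' : n.1 < 0 := by exact_mod_cast e2
    omega
  · have e : (back u).2 = -(front y).2 + n.2 := congrArg Prod.snd hn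
    have e1 : (0 : ℝ) < n.2 := by linarith
    have e2 : (n.2 : ℝ) < 1 := by linarith
    have e1' : 0 < n.2 := by exact_mod_cast e1
    have e2' : n.2 < 1 := by exact_mod_cast e2
    omega

lemma pillow_mirror {z w : ℝ × ℝ} (h : pillow z = pillow w) :
    pillow (-z.1, z.2) = pillow (-w.1, w.2) := by
  simp only [pillow, Prod.mk.injEq] at h ⊢
  simpa [mul_neg, Real.cos_neg, Real.sin_neg] using h

lemma flip_injOn {y y' : ℝ × ℝ} (hy : 1 / 2 ≤ ‖y‖) (hy1 : ‖y‖ < 1) (hy' : 1 / 2 ≤ ‖y'‖)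
    (hy1' : ‖y'‖ ≤ 1) (h : flip y = flip y') : y = y' := by
  have hn : ‖y‖ = ‖y'‖ := by
    have h1 := norm_flip hy hy1.le
    have h2 := norm_flip hy' hy1'
    rw [h] at h1; linarith
  rw [flip_of_ge hy, flip_of_ge hy', ← hn] at h
  have hd : dir y = dir y' := smul_right_injective _ (by linarith : (2 - 2 * ‖y‖ : ℝ) ≠ 0) h
  rw [← norm_smul_dir y, ← norm_smul_dir y', hn, hd]

/-- `pillow ∘ sect` is injective on the open square, and separates it from the boundary. -/
lemma eq_of_pillow_sect_eq {y y' : ℝ × ℝ} (hy : ‖y‖ < 1) (hy' : ‖y'‖ ≤ 1)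
    (h : pillow (sect y) = pillow (sect y')) : y = y' := by
  rcases le_or_gt ‖y‖ (1 / 2) with h1 | h1 <;> rcases le_or_gt ‖y'‖ (1 / 2) with h2 | h2
  · rw [sect, sect, if_pos h1, if_pos h2] at h
    have := eq_of_pillow_eq_of_mem (front_mem h1).1 (front_mem h1).2 (front_mem h2).1
      (front_mem h2).2 h
    simp only [front, Prod.mk.injEq] at this
    exact Prod.ext (by linarith [this.1]) (by linarith [this.2])
  · rw [sect, sect, if_pos h1, if_neg h2.not_ge] at h
    exact absurd h (pillow_front_ne_pillow_back h1 (by rw [norm_flip h2.le hy']; linarith))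
  · rw [sect, sect, if_pos h2, if_neg h1.not_ge] at h
    exact absurd h.symm (pillow_front_ne_pillow_back h2 (by rw [norm_flip h1.le hy.le]; linarith))
  · rw [sect, sect, if_neg h2.not_ge, if_neg h1.not_ge] at h
    refine flip_injOn h1.le hy h2.le hy' ?_
    have m1 := back_mem (show ‖flip y‖ < 1 by rw [norm_flip h1.le hy.le]; linarith)
    have m2 := back_mem (show ‖flip y'‖ < 1 by rw [norm_flip h2.le hy']; linarith)
    have := eq_of_pillow_eq_of_mem (z := (-(back (flip y)).1, (back (flip y)).2))
      (w := (-(back (flip y')).1, (back (flip y')).2)) (Set.Ioo_subset_Icc_self m1.1)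
      (Set.Ioo_subset_Icc_self m1.2)
      (Set.Ioo_subset_Icc_self m2.1) (Set.Ioo_subset_Icc_self m2.2) (pillow_mirror h)
    simp only [back, Prod.mk.injEq] at this
    exact Prod.ext (by linarith [this.1]) (by linarith [this.2])

lemma sect_eq_of_pillow_sect_eq {y y' : ℝ × ℝ} (hy : ‖y‖ ≤ 1) (hy' : ‖y'‖ ≤ 1)
    (h : pillow (sect y) = pillow (sect y')) : sect y = sect y' := by
  rcases hy.lt_or_eq with hy1 | hy1
  · rw [eq_of_pillow_sect_eq hy1 hy' h]
  rcases hy'.lt_or_eq with hy1' | hy1'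
  · rw [eq_of_pillow_sect_eq hy1' hy h.symm]
  · rw [sect_of_norm_eq_one hy1, sect_of_norm_eq_one hy1']

lemma norm_eq_one_of_pillow_sect_eq {y : ℝ × ℝ} (hy : ‖y‖ ≤ 1)
    (h : pillow (sect y) = pillow backCenter) : ‖y‖ = 1 := by
  rcases hy.lt_or_eq with hy1 | hy1
  · have h1 : ‖((1, 0) : ℝ × ℝ)‖ = 1 := by simp [Prod.norm_def]
    rw [← sect_of_norm_eq_one h1] at h
    rw [eq_of_pillow_sect_eq hy1 h1.le h, h1]
  · exact hy1

lemma norm_mirror (v : ℝ × ℝ) : ‖((-v.1, v.2) : ℝ × ℝ)‖ = ‖v‖ := by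
  simp [Prod.norm_def]

/-- Near the boundary of the square, `sect` approaches `backCenter` with controlled direction. -/
lemma tendsto_sect_boundary {y : ℝ × ℝ} (hy : ‖y‖ = 1) :
    Tendsto sect (𝓝[Metric.ball 0 1] y) (dirFilter backCenter (-y.1, y.2)) := by
  have hy0 : y ≠ 0 := norm_pos_iff.1 (by rw [hy]; norm_num)
  have hhalf : ∀ᶠ x in 𝓝[Metric.ball 0 1] y, 1 / 2 < ‖x‖ ∧ ‖x‖ < 1 := by
    have h1 : ∀ᶠ x in 𝓝 y, 1 / 2 < ‖x‖ :=
      continuous_norm.continuousAt.eventually_mem (Ioi_mem_nhds (by rw [hy]; norm_num))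
    filter_upwards [nhdsWithin_le_nhds h1, self_mem_nhdsWithin] with x hx hx'
    exact ⟨hx, by simpa using hx'⟩
  have hform : ∀ x : ℝ × ℝ, 1 / 2 < ‖x‖ → sect x - backCenter =
      ((2 - 2 * ‖x‖) / 4) • ((-(dir x).1, (dir x).2) : ℝ × ℝ) := by
    intro x hx
    rw [sect, if_neg hx.not_ge, flip_of_ge hx.le]
    ext <;> simp only [back, backCenter, Prod.fst_sub, Prod.snd_sub, Prod.smul_fst, Prod.smul_snd,
      smul_eq_mul] <;> ring
  have hn : ∀ x : ℝ × ℝ, 1 / 2 < ‖x‖ → ‖((-(dir x).1, (dir x).2) : ℝ × ℝ)‖ = 1 := fun x hx => by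
    rw [norm_mirror, norm_dir (norm_pos_iff.1 (by linarith))]
  rw [tendsto_dirFilter]
  refine ⟨?_, ?_, ?_⟩
  · have h0 : Tendsto (fun x : ℝ × ℝ => back (flip x)) (𝓝 y) (𝓝 backCenter) := by
      have hc : Continuous fun x : ℝ × ℝ => back (flip x) :=
        continuous_back.comp continuous_flip
      have := hc.tendsto y
      rwa [flip, hy, show (2 - 2 * (1 : ℝ)) = 0 by norm_num, zero_mul, zero_smul, back_zero] at this
    refine (h0.mono_left nhdsWithin_le_nhds).congr' ?_
    filter_upwards [hhalf] with x hx
    rw [sect, if_neg hx.1.not_ge]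
  · filter_upwards [hhalf] with x hx h
    have h2 := hform x hx.1
    rw [h, sub_self] at h2
    have h3 := congrArg norm h2
    rw [norm_zero, norm_smul, hn x hx.1, mul_one, Real.norm_of_nonneg (by linarith [hx.2])] at h3
    linarith [hx.2]
  · have h0 : Tendsto (fun x : ℝ × ℝ => ((-(dir x).1, (dir x).2) : ℝ × ℝ)) (𝓝 y)
        (𝓝 (-y.1, y.2)) := by
      have hd : Tendsto dir (𝓝 y) (𝓝 y) := by
        have := continuousAt_dir hy0
        rwa [ContinuousAt, dir_of_norm_eq_one hy] at this
      have hc : Continuous fun v : ℝ × ℝ => ((-v.1, v.2) : ℝ × ℝ) := by fun_prop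
      exact (hc.tendsto y).comp hd
    refine (h0.mono_left nhdsWithin_le_nhds).congr' ?_
    filter_upwards [hhalf] with x hx
    rw [hform x hx.1, dir_smul (by linarith [hx.2]), dir_of_norm_eq_one (hn x hx.1)]

/-- The linear part of `back`. -/
noncomputable def backLinear : (ℝ × ℝ) ≃L[ℝ] (ℝ × ℝ) :=
  (ContinuousLinearEquiv.smulLeft (Units.mk0 (-1 / 4 : ℝ) (by norm_num))).prodCongr
    (ContinuousLinearEquiv.smulLeft (Units.mk0 (1 / 4 : ℝ) (by norm_num)))

lemma back_eq (u : ℝ × ℝ) : back u = backLinear u + backCenter := by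
  ext
  · simp only [back, backLinear, backCenter, ContinuousLinearEquiv.prodCongr_apply, Prod.fst_add]
    change _ = (-1 / 4 : ℝ) * u.1 + _
    ring
  · simp only [back, backLinear, backCenter, ContinuousLinearEquiv.prodCongr_apply, Prod.snd_add]
    change _ = (1 / 4 : ℝ) * u.2 + _
    ring

lemma liftable_sect {y : ℝ × ℝ} (hy : ‖y‖ < 1) (hy' : ‖y‖ ≠ 1 / 2) : Liftable sect y := by
  rcases hy'.lt_or_gt with h | h
  · refine (liftable_smul_add (c := 1 / 2) (by norm_num) ((1 / 4, 1 / 4) : ℝ × ℝ) y).congr ?_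
    filter_upwards [continuous_norm.continuousAt.eventually_mem (Iio_mem_nhds h)] with x hx
    rw [sect, if_pos (le_of_lt hx)]
    ext <;> simp only [front, Prod.fst_add, Prod.snd_add, Prod.smul_fst, Prod.smul_snd,
      smul_eq_mul] <;> ring
  · have h1 := liftable_radial (a := -2) (b := 2) (p := y) (by norm_num)
      (norm_pos_iff.1 (by linarith)) (by linarith)
    refine ((liftable_affine backLinear backCenter _).comp h1).congr ?_
    filter_upwards [continuous_norm.continuousAt.eventually_mem (Ioi_mem_nhds h)] with x hx
    have hx' : 1 / 2 < ‖x‖ := hx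
    rw [sect, if_neg hx'.not_ge, flip_of_ge hx'.le, back_eq]
    simp only [Function.comp]
    congr 2
    nth_rw 1 [← norm_smul_dir x]
    rw [smul_smul, ← add_smul]
    congr 1
    ring

/-- The points of the pillow over which a compact set lies inside an open set form an open set. -/
lemma isOpen_setOf_fiber_subset {X : Type*} [TopologicalSpace X] {K : Set X} (hK : IsCompact K)
    {f : X → ℝ × ℝ × ℝ} (hf : ContinuousOn f K) {N : Set X} (hN : IsOpen N) :
    IsOpen {z | ∀ x ∈ K, f x = pillow z → x ∈ N} := by
  have hc : IsClosed (f '' (K \ N)) :=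
    ((hK.diff hN).image_of_continuousOn (hf.mono Set.sdiff_subset)).isClosed
  convert (hc.preimage continuous_pillow).isOpen_compl using 1
  ext z
  simp only [Set.mem_ofPred_eq, Set.mem_compl_iff, Set.mem_preimage, Set.mem_image, Set.mem_sdiff,
    not_exists, not_and]
  exact ⟨fun h x hx hxz => hx.2 (h x hx.1 hxz),
    fun h x hx hxz => by_contra fun hxN => h x ⟨hx, hxN⟩ hxz⟩

/-! ### The hyperbolic automorphism -/

/-- The hyperbolic matrix `[[1, 4], [4, 17]]`, congruent to the identity modulo `4`. -/
noncomputable def catMap : (ℝ × ℝ) ≃L[ℝ] (ℝ × ℝ) :=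
  ContinuousLinearEquiv.equivOfInverse
    ((ContinuousLinearMap.fst ℝ ℝ ℝ + (4 : ℝ) • ContinuousLinearMap.snd ℝ ℝ ℝ).prod
      ((4 : ℝ) • ContinuousLinearMap.fst ℝ ℝ ℝ + (17 : ℝ) • ContinuousLinearMap.snd ℝ ℝ ℝ))
    (((17 : ℝ) • ContinuousLinearMap.fst ℝ ℝ ℝ - (4 : ℝ) • ContinuousLinearMap.snd ℝ ℝ ℝ).prod
      (ContinuousLinearMap.snd ℝ ℝ ℝ - (4 : ℝ) • ContinuousLinearMap.fst ℝ ℝ ℝ))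
    (fun z => by ext <;> simp <;> ring) (fun z => by ext <;> simp <;> ring)

lemma catMap_apply (z : ℝ × ℝ) : catMap z = (z.1 + 4 * z.2, 4 * z.1 + 17 * z.2) := rfl

lemma catMap_symm_apply (z : ℝ × ℝ) : catMap.symm z = (17 * z.1 - 4 * z.2, z.2 - 4 * z.1) := rfl

/-- The slope of the expanding eigenvector of `catMap`. -/
noncomputable def eigSlope : ℝ := 2 + √5

lemma eigSlope_sq : eigSlope ^ 2 = 4 * eigSlope + 1 := by
  have : √5 ^ 2 = 5 := Real.sq_sqrt (by norm_num)
  rw [eigSlope]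
  linear_combination this

/-- The expanding eigenvalue of `catMap`. -/
noncomputable def eigVal : ℝ := 1 + 4 * eigSlope

lemma eigVal_pos : 1 < eigVal := by
  have : 0 ≤ √5 := Real.sqrt_nonneg _
  rw [eigVal, eigSlope]; linarith

lemma catMap_eigenvector : catMap (1, eigSlope) = eigVal • (1, eigSlope) := by
  rw [catMap_apply]
  ext
  · simp [eigVal]
  · simp only [eigVal, Prod.smul_snd, smul_eq_mul]
    linear_combination -4 * eigSlope_sq

lemma catMap_symm_eigenvector : catMap.symm (1, eigSlope) = eigVal⁻¹ • (1, eigSlope) := by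
  rw [ContinuousLinearEquiv.symm_apply_eq, map_smul, catMap_eigenvector, smul_smul,
    inv_mul_cancel₀ (by linarith [eigVal_pos]), one_smul]

/-! ### The countable set of points to be blown up -/

/-- The field of real algebraic numbers. -/
noncomputable def algReal : IntermediateField ℚ ℝ := algebraicClosure ℚ ℝ

lemma countable_algReal : (algReal : Set ℝ).Countable := by
  refine (Algebraic.countable ℚ ℝ).mono fun x hx => ?_
  exact mem_algebraicClosure_iff.1 hx

/-- A transcendental number. -/
noncomputable def tau : ℝ := liouvilleNumber (2 : ℕ)

lemma tau_notMem : tau ∉ algReal := by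
  intro h
  exact transcendental_liouvilleNumber le_rfl
    ((IsFractionRing.isAlgebraic_iff ℤ ℚ ℝ).2 (mem_algebraicClosure_iff.1 h))

lemma eigSlope_mem : eigSlope ∈ algReal := by
  have h5 : √5 ∈ algReal := by
    refine mem_algebraicClosure_iff.2 (IsAlgebraic.of_pow two_pos ?_)
    rw [Real.sq_sqrt (by norm_num)]
    exact mem_algebraicClosure_iff.1 (ofNat_mem (algebraicClosure ℚ ℝ) 5)
  exact add_mem (ofNat_mem _ 2) h5

lemma eigSlope_ne_zero : eigSlope ≠ 0 := by
  have : 0 ≤ √5 := Real.sqrt_nonneg _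
  rw [eigSlope]; linarith

lemma eigVal_mem : eigVal ∈ algReal :=
  add_mem (one_mem _) (mul_mem (ofNat_mem _ 4) eigSlope_mem)

/-- A countable dense subset of the plane, invariant under `catMap`, avoiding algebraic points. -/
def blowUp : Set (ℝ × ℝ) :=
  {z | ∃ κ ∈ algReal, κ ≠ 0 ∧ ∃ p : ℝ × ℝ, p.1 ∈ algReal ∧ p.2 ∈ algReal ∧
    z = (tau * κ) • (1, eigSlope) + p}

lemma countable_blowUp : blowUp.Countable := by
  have h := countable_algReal
  refine ((h.prod (h.prod h)).image
    fun q : ℝ × ℝ × ℝ => (tau * q.1) • ((1, eigSlope) : ℝ × ℝ) + q.2).mono ?_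
  rintro z ⟨κ, hκ, -, p, hp1, hp2, rfl⟩
  exact ⟨(κ, p), ⟨hκ, hp1, hp2⟩, rfl⟩

lemma tau_mul_notMem {κ : ℝ} (hκ : κ ∈ algReal) (hκ0 : κ ≠ 0) {p : ℝ} (hp : p ∈ algReal) :
    tau * κ + p ∉ algReal := by
  intro h
  have h1 : tau * κ ∈ algReal := by simpa using sub_mem h hp
  have h2 := mul_mem h1 (inv_mem hκ)
  rw [mul_assoc, mul_inv_cancel₀ hκ0, mul_one] at h2
  exact tau_notMem h2

lemma notMem_of_mem_blowUp {z : ℝ × ℝ} (hz : z ∈ blowUp) : z.1 ∉ algReal ∧ z.2 ∉ algReal := by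
  obtain ⟨κ, hκ, hκ0, p, hp1, hp2, rfl⟩ := hz
  constructor
  · simpa using tau_mul_notMem hκ hκ0 hp1
  · have := tau_mul_notMem (mul_mem hκ eigSlope_mem) (mul_ne_zero hκ0 eigSlope_ne_zero) hp2
    simpa [mul_assoc] using this

lemma neg_mem_blowUp {z : ℝ × ℝ} (hz : z ∈ blowUp) : -z ∈ blowUp := by
  obtain ⟨κ, hκ, hκ0, p, hp1, hp2, rfl⟩ := hz
  refine ⟨-κ, neg_mem hκ, neg_ne_zero.2 hκ0, -p, neg_mem hp1, neg_mem hp2, ?_⟩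
  rw [mul_neg, neg_smul, neg_add]

lemma add_intPt_mem_blowUp {z : ℝ × ℝ} (hz : z ∈ blowUp) (n : ℤ × ℤ) : z + intPt n ∈ blowUp := by
  obtain ⟨κ, hκ, hκ0, p, hp1, hp2, rfl⟩ := hz
  refine ⟨κ, hκ, hκ0, p + intPt n, add_mem hp1 (intCast_mem _ _), add_mem hp2 (intCast_mem _ _),
    add_assoc _ _ _⟩

lemma mem_blowUp_of_pillow_eq {z w : ℝ × ℝ} (h : pillow z = pillow w) (hz : z ∈ blowUp) :
    w ∈ blowUp := by
  obtain ⟨n, rfl | rfl⟩ := pillow_eq_iff.1 h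
  · exact add_intPt_mem_blowUp hz n
  · exact add_intPt_mem_blowUp (neg_mem_blowUp hz) n

lemma catMap_mem_blowUp {z : ℝ × ℝ} (hz : z ∈ blowUp) : catMap z ∈ blowUp := by
  obtain ⟨κ, hκ, hκ0, p, hp1, hp2, rfl⟩ := hz
  refine ⟨κ * eigVal, mul_mem hκ eigVal_mem, mul_ne_zero hκ0 (by linarith [eigVal_pos]), catMap p,
    add_mem hp1 (mul_mem (ofNat_mem _ 4) hp2),
    add_mem (mul_mem (ofNat_mem _ 4) hp1) (mul_mem (ofNat_mem _ 17) hp2), ?_⟩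
  rw [map_add, map_smul, catMap_eigenvector, smul_smul, mul_assoc]

lemma catMap_symm_mem_blowUp {z : ℝ × ℝ} (hz : z ∈ blowUp) : catMap.symm z ∈ blowUp := by
  obtain ⟨κ, hκ, hκ0, p, hp1, hp2, rfl⟩ := hz
  refine ⟨κ * eigVal⁻¹, mul_mem hκ (inv_mem eigVal_mem),
    mul_ne_zero hκ0 (inv_ne_zero (by linarith [eigVal_pos])), catMap.symm p,
    sub_mem (mul_mem (ofNat_mem _ 17) hp1) (mul_mem (ofNat_mem _ 4) hp2),
    sub_mem hp2 (mul_mem (ofNat_mem _ 4) hp1), ?_⟩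
  rw [map_add, map_smul, catMap_symm_eigenvector, smul_smul, mul_assoc]

/-- The point of the plane with rational coordinates `q`. -/
def ratPt (q : ℚ × ℚ) : ℝ × ℝ := ((q.1 : ℝ), (q.2 : ℝ))

lemma denseRange_ratPt : DenseRange ratPt :=
  DenseRange.prodMap Rat.denseRange_cast Rat.denseRange_cast

lemma ratCast_mem_algReal (q : ℚ) : (q : ℝ) ∈ algReal := by
  simp

lemma ratPt_notMem_blowUp (q : ℚ × ℚ) : ratPt q ∉ blowUp := fun h =>
  (notMem_of_mem_blowUp h).1 (ratCast_mem_algReal q.1)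

lemma dense_blowUp : Dense blowUp := by
  have h1 : DenseRange fun q => (tau * 1) • ((1, eigSlope) : ℝ × ℝ) + ratPt q :=
    (Homeomorph.addLeft ((tau * 1) • ((1, eigSlope) : ℝ × ℝ))).surjective.denseRange.comp
      denseRange_ratPt (Homeomorph.addLeft _).continuous
  refine Dense.mono ?_ h1
  rintro - ⟨q, rfl⟩
  exact ⟨1, one_mem _, one_ne_zero, ratPt q, ratCast_mem_algReal _, ratCast_mem_algReal _, rfl⟩

lemma backCenter_eq_ratPt : backCenter = ratPt (-1 / 4, 1 / 4) := by
  ext <;> simp [backCenter, ratPt]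

lemma backCenter_notMem_blowUp : backCenter ∉ blowUp :=
  backCenter_eq_ratPt ▸ ratPt_notMem_blowUp _

/-- The points of the plane lying over the points of the pillow that get blown up. -/
def special : Set (ℝ × ℝ) := {z | z ∈ blowUp ∨ pillow z = pillow backCenter}

lemma mem_special_of_pillow_eq {z w : ℝ × ℝ} (h : pillow z = pillow w) (hz : z ∈ special) :
    w ∈ special :=
  hz.imp (mem_blowUp_of_pillow_eq h) fun h' => h.symm.trans h'

lemma two_smul_notMem_of_mem_special {z : ℝ × ℝ} (hz : z ∈ special) :
    (2 : ℝ) • z ∉ Set.range intPt := by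
  rintro ⟨n, hn⟩
  rcases hz with hz | hz
  · refine (notMem_of_mem_blowUp hz).1 ?_
    have : z.1 = ((n.1 / 2 : ℚ) : ℝ) := by
      have := congrArg Prod.fst hn
      simp only [intPt, Prod.smul_fst, smul_eq_mul] at this
      push_cast; linarith
    rw [this]
    exact ratCast_mem_algReal _
  · obtain ⟨m, hm⟩ := pillow_eq_iff.1 hz
    have h1 := congrArg Prod.fst hn
    simp only [intPt, Prod.smul_fst, smul_eq_mul] at h1
    have key : ∃ k : ℤ, (k : ℝ) = 2 * backCenter.1 := by
      rcases hm with hm | hm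
      · refine ⟨n.1 + 2 * m.1, ?_⟩
        rw [hm]; simp only [intPt, Prod.fst_add]; push_cast; linarith
      · refine ⟨-n.1 + 2 * m.1, ?_⟩
        rw [hm]; simp only [intPt, Prod.fst_add, Prod.fst_neg]; push_cast; linarith
    obtain ⟨k, hk⟩ := key
    have h2 : (k : ℝ) * 2 = -1 := by rw [hk, backCenter]; norm_num
    have h3 : k * 2 = -1 := by exact_mod_cast h2
    omega

/-- Linear automorphisms compatible with the pillow and the blown-up set. -/
structure Admissible (L : (ℝ × ℝ) ≃L[ℝ] (ℝ × ℝ)) : Prop where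
  map_intPt : ∀ n, ∃ m, L (intPt n) = intPt m
  map_backCenter : pillow (L backCenter) = pillow backCenter
  map_blowUp : ∀ z ∈ blowUp, L z ∈ blowUp

lemma Admissible.pillow_eq {L : (ℝ × ℝ) ≃L[ℝ] (ℝ × ℝ)} (hL : Admissible L) {z w : ℝ × ℝ}
    (h : pillow z = pillow w) : pillow (L z) = pillow (L w) := by
  obtain ⟨n, rfl | rfl⟩ := pillow_eq_iff.1 h <;> obtain ⟨m, hm⟩ := hL.map_intPt n
  · rw [map_add, hm, pillow_add_intPt]
  · rw [map_add, hm, pillow_add_intPt, map_neg, pillow_neg]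

lemma Admissible.mem_special {L : (ℝ × ℝ) ≃L[ℝ] (ℝ × ℝ)} (hL : Admissible L) {z : ℝ × ℝ}
    (hz : z ∈ special) : L z ∈ special :=
  hz.imp (hL.map_blowUp z) fun h => (hL.pillow_eq h).trans hL.map_backCenter

lemma admissible_catMap : Admissible catMap where
  map_intPt n := ⟨(n.1 + 4 * n.2, 4 * n.1 + 17 * n.2), by simp [catMap_apply, intPt]⟩
  map_backCenter := by
    refine pillow_eq_iff.2 ⟨(-1, -3), Or.inl ?_⟩
    rw [catMap_apply]
    ext <;> norm_num [backCenter, intPt]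
  map_blowUp _ := catMap_mem_blowUp

lemma admissible_catMap_symm : Admissible catMap.symm where
  map_intPt n := ⟨(17 * n.1 - 4 * n.2, n.2 - 4 * n.1), by simp [catMap_symm_apply, intPt]⟩
  map_backCenter := by
    refine pillow_eq_iff.2 ⟨(5, -1), Or.inl ?_⟩
    rw [catMap_symm_apply]
    ext <;> norm_num [backCenter, intPt]
  map_blowUp _ := catMap_symm_mem_blowUp

/-! ### The blown-up points in the square -/

/-- The points of the open square lying over `blowUp`. -/
def sectBlowUp : Set (ℝ × ℝ) := {y | ‖y‖ < 1 ∧ sect y ∈ blowUp}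

lemma countable_sectBlowUp : sectBlowUp.Countable :=
  Set.MapsTo.countable_of_injOn (f := sect) (fun _ hy => hy.2)
    (fun _ hy _ hy' h => eq_of_pillow_sect_eq hy.1 hy'.1.le (congrArg pillow h)) countable_blowUp

lemma ball_subset_closure_sectBlowUp : Metric.ball 0 1 ⊆ closure sectBlowUp := by
  intro y hy
  have hy1 : ‖y‖ < 1 := by simpa using hy
  rw [mem_closure_iff]
  intro N hN hyN
  have hN' : IsOpen (N ∩ Metric.ball 0 1) := hN.inter Metric.isOpen_ball
  have hO := isOpen_setOf_fiber_subset (isCompact_closedBall (0 : ℝ × ℝ) 1)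
    continuous_pillow_sect.continuousOn hN'
  obtain ⟨w, hw, hwO⟩ := dense_blowUp.exists_mem_open hO ⟨sect y, fun x hx hxy => by
    rw [← eq_of_pillow_sect_eq hy1 (by simpa using hx) hxy.symm]
    exact ⟨hyN, hy⟩⟩
  obtain ⟨y', hy', h⟩ := exists_pillow_sect_eq w
  have hmem := hwO y' (by simpa using hy') h
  exact ⟨y', hmem.1, by simpa using hmem.2, mem_blowUp_of_pillow_eq h.symm hw⟩

lemma liftable_sect_of_mem {y : ℝ × ℝ} (hy : y ∈ sectBlowUp) : Liftable sect y := by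
  refine liftable_sect hy.1 fun h => ?_
  have hs := notMem_of_mem_blowUp hy.2
  rw [sect, if_pos h.le] at hs
  have key : ∀ t : ℝ, |t| = 1 / 2 → (2 * t + 1) / 4 ∈ algReal := by
    intro t ht
    rcases eq_or_eq_neg_of_abs_eq ht with h | h
    · rw [h]
      convert ratCast_mem_algReal (1 / 2) using 1
      norm_num
    · rw [h]
      convert ratCast_mem_algReal 0 using 1
      norm_num
  rw [Prod.norm_def, Real.norm_eq_abs, Real.norm_eq_abs] at h
  rcases max_choice |y.1| |y.2| with h' | h'
  · exact hs.1 (key _ (h' ▸ h))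
  · exact hs.2 (key _ (h' ▸ h))

lemma centers_subset_ball : centers ⊆ Metric.ball 0 1 := fun d hd => by simpa using hd.1

lemma exists_matching : ∃ g : ℝ × ℝ → ℝ × ℝ, NearId (1 / 2) g ∧ (∀ p, DirDifferentiable g p) ∧
    g '' centers = sectBlowUp :=
  exists_nearId_image_eq countable_centers countable_sectBlowUp centers_subset_ball
    (fun y hy => by simpa using hy.1) (fun y hy => mem_closure_centers (by simpa using hy))
    ball_subset_closure_sectBlowUp

/-- A homeomorphism of the square matching the collapsed holes with the blown-up points. -/
noncomputable def matching : ℝ × ℝ → ℝ × ℝ := exists_matching.choose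

lemma nearId_matching : NearId (1 / 2) matching := exists_matching.choose_spec.1

lemma image_matching : matching '' centers = sectBlowUp := exists_matching.choose_spec.2.2

lemma injective_matching : Function.Injective matching := nearId_matching.injective (by norm_num)

lemma norm_matching_lt_one_iff {x : ℝ × ℝ} : ‖matching x‖ < 1 ↔ ‖x‖ < 1 :=
  nearId_matching.norm_lt_one_iff (by norm_num)

lemma norm_matching_le_one_iff {x : ℝ × ℝ} : ‖matching x‖ ≤ 1 ↔ ‖x‖ ≤ 1 := by
  rcases lt_or_ge ‖x‖ 1 with h | h
  · exact iff_of_true (norm_matching_lt_one_iff.2 h).le h.le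
  · rw [nearId_matching.eq_self x h]

lemma matching_mem_iff {d : ℝ × ℝ} : matching d ∈ sectBlowUp ↔ d ∈ centers := by
  rw [← image_matching, injective_matching.mem_set_image]

lemma liftable_matching (p : ℝ × ℝ) : Liftable matching p :=
  liftable_of_dirDifferentiable (c := 1 - 1 / 2) (C := 1 + 1 / 2) univ_mem (by norm_num)
    (fun y _ y' _ => nearId_matching.le_norm_sub y y')
    (fun y _ y' _ => nearId_matching.norm_sub_le y y') (exists_matching.choose_spec.2.1 p)

/-- Planar coordinates on the carpet. -/
noncomputable def chart (x : ℝ × ℝ) : ℝ × ℝ := sect (matching (quot x))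

/-- The projection of the carpet to the pillow. -/
noncomputable def proj (x : ℝ × ℝ) : ℝ × ℝ × ℝ := pillow (chart x)

lemma continuous_proj : Continuous proj :=
  continuous_pillow_sect.comp ((nearId_matching.continuous (by norm_num)).comp continuous_quot)

lemma norm_matching_quot_le {x : ℝ × ℝ} (hx : x ∈ carpet) : ‖matching (quot x)‖ ≤ 1 :=
  norm_matching_le_one_iff.2 (norm_quot_le_one hx.1)

lemma exists_proj_eq (w : ℝ × ℝ) : ∃ x ∈ carpet, proj x = pillow w := by
  obtain ⟨y, hy, h⟩ := exists_pillow_sect_eq w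
  obtain ⟨p, rfl⟩ := nearId_matching.surjective (by norm_num) (by norm_num) y
  obtain ⟨x, hx, rfl⟩ := exists_mem_carpet_quot_eq (norm_matching_le_one_iff.1 hy)
  exact ⟨x, hx, h⟩

lemma norm_eq_one_of_chart {x : ℝ × ℝ} (hx : x ∈ carpet)
    (h : pillow (chart x) = pillow backCenter) : ‖x‖ = 1 := by
  have h1 := norm_eq_one_of_pillow_sect_eq (norm_matching_quot_le hx) h
  rcases hx.1.lt_or_eq with h2 | h2
  · exact absurd (norm_matching_lt_one_iff.2 (norm_quot_lt_one h2)) h1.not_lt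
  · exact h2

lemma chart_notMem_special {x : ℝ × ℝ} (hx : x ∈ carpetInt) : chart x ∉ special := by
  have h1 := norm_quot_lt_one_of_mem_carpetInt hx
  rintro (h | h)
  · exact quot_notMem_centers hx (matching_mem_iff.1 ⟨norm_matching_lt_one_iff.2 h1, h⟩)
  · have := norm_eq_one_of_chart (carpetInt_subset_carpet hx) h
    exact hx.1.ne this

lemma mem_carpetInt_of_chart {x : ℝ × ℝ} (hx : x ∈ carpet) (h : chart x ∉ special) :
    x ∈ carpetInt := by
  have h1 : ‖matching (quot x)‖ < 1 := by
    refine (norm_matching_quot_le hx).lt_of_ne fun h1 => h (Or.inr ?_)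
    rw [chart, sect_of_norm_eq_one h1]
  refine mem_carpetInt_of_quot (norm_matching_lt_one_iff.1 h1) fun h2 => h (Or.inl ?_)
  exact (matching_mem_iff.2 h2).2

lemma eq_of_proj_eq {x x' : ℝ × ℝ} (hx : x ∈ carpetInt) (hx' : x' ∈ carpet)
    (h : proj x = proj x') : x = x' := by
  have h1 := norm_quot_lt_one_of_mem_carpetInt hx
  exact quot_injective_of_mem_carpetInt hx (injective_matching
    (eq_of_pillow_sect_eq (norm_matching_lt_one_iff.2 h1) (norm_matching_quot_le hx') h))

lemma chart_eq_of_proj_eq {x x' : ℝ × ℝ} (hx : x ∈ carpet) (hx' : x' ∈ carpet)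
    (h : proj x = proj x') : chart x = chart x' :=
  sect_eq_of_pillow_sect_eq (norm_matching_quot_le hx) (norm_matching_quot_le hx') h

/-- The fibre of the carpet over a blown-up point is parametrised by directions. -/
lemma exists_direction_chart {ζ : ℝ × ℝ} (hζ : ζ ∈ special) : ∃ θ : ℝ × ℝ → ℝ × ℝ,
    (∀ x ∈ carpet, chart x = ζ → ‖θ x‖ = 1 ∧
      Tendsto chart (𝓝[carpetInt] x) (dirFilter ζ (θ x))) ∧
    ∀ x ∈ carpet, ∀ x' ∈ carpet, chart x = ζ → chart x' = ζ → θ x = θ x' → x = x' := by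
  rcases hζ with hζ | hζ
  · by_cases hex : ∃ x ∈ carpet, chart x = ζ
    · obtain ⟨x₀, hx₀, rfl⟩ := hex
      have h1 : ‖matching (quot x₀)‖ < 1 := by
        refine (norm_matching_quot_le hx₀).lt_of_ne fun h1 => backCenter_notMem_blowUp ?_
        rwa [chart, sect_of_norm_eq_one h1] at hζ
      have hmem : matching (quot x₀) ∈ sectBlowUp := ⟨h1, hζ⟩
      have hd : quot x₀ ∈ centers := matching_mem_iff.1 hmem
      have hquot : ∀ x ∈ carpet, chart x = chart x₀ → quot x = quot x₀ := fun x hx h =>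
        injective_matching (eq_of_pillow_sect_eq h1 (norm_matching_quot_le hx)
          (congrArg pillow h.symm)).symm
      obtain ⟨θ, hθ, hθi⟩ := exists_direction_quot hd
      obtain ⟨φ, hφ, hφi, hφt⟩ :=
        (liftable_sect_of_mem hmem).comp (liftable_matching (quot x₀))
      refine ⟨fun x => φ (θ x), fun x hx h => ⟨hφ _ (hθ x hx (hquot x hx h)).1, ?_⟩, ?_⟩
      · exact (hφt _ (hθ x hx (hquot x hx h)).1).comp (hθ x hx (hquot x hx h)).2
      · intro x hx x' hx' h h' he
        exact hθi x hx x' hx' (hquot x hx h) (hquot x' hx' h')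
          (hφi (hθ x hx (hquot x hx h)).1 (hθ x' hx' (hquot x' hx' h')).1 he)
    · push Not at hex
      exact ⟨id, fun x hx h => absurd h (hex x hx), fun x hx _ _ h => absurd h (hex x hx)⟩
  · refine ⟨fun x => (-x.1, x.2), fun x hx h => ?_, fun x _ x' _ _ _ h => ?_⟩
    · have hn := norm_eq_one_of_chart hx (by rw [h, hζ])
      have hself : matching (quot x) = x := by
        rw [quot_of_norm_eq_one hn, nearId_matching.eq_self x hn.ge]
      have hζ' : ζ = backCenter := by
        rw [← h, chart, hself, sect_of_norm_eq_one hn]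
      refine ⟨by rw [norm_mirror, hn], ?_⟩
      rw [hζ']
      refine (tendsto_sect_boundary hn).comp (tendsto_nhdsWithin_iff.2 ⟨?_, ?_⟩)
      · have := ((nearId_matching.continuous (by norm_num)).comp continuous_quot).tendsto x
        simp only [Function.comp, hself] at this
        exact this.mono_left nhdsWithin_le_nhds
      · filter_upwards [self_mem_nhdsWithin] with x' hx'
        simpa using norm_matching_lt_one_iff.2 (norm_quot_lt_one_of_mem_carpetInt hx')
    · simp only [Prod.mk.injEq, neg_inj] at h
      exact Prod.ext h.1 h.2

lemma norm_sect_le {y : ℝ × ℝ} (hy : ‖y‖ ≤ 1) : ‖sect y‖ ≤ 1 := by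
  rw [sect]
  split_ifs with h
  · obtain ⟨⟨h1, h2⟩, h3, h4⟩ := front_mem h
    rw [norm_le_iff, abs_le, abs_le]
    refine ⟨⟨?_, ?_⟩, ?_, ?_⟩ <;> linarith
  · push Not at h
    obtain ⟨⟨h1, h2⟩, h3, h4⟩ :=
      back_mem (show ‖flip y‖ < 1 by rw [norm_flip h.le hy]; linarith)
    rw [norm_le_iff, abs_le, abs_le]
    refine ⟨⟨?_, ?_⟩, ?_, ?_⟩ <;> linarith

lemma tendsto_dirFilter_unique {α F : Type*} [NormedAddCommGroup F] [NormedSpace ℝ F]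
    {l : Filter α} [l.NeBot] {f : α → F} {p θ θ' : F} (h : Tendsto f l (dirFilter p θ))
    (h' : Tendsto f l (dirFilter p θ')) : θ = θ' :=
  tendsto_nhds_unique (tendsto_dirFilter.1 h).2.2 (tendsto_dirFilter.1 h').2.2

lemma liftable_linear (L : (ℝ × ℝ) ≃L[ℝ] (ℝ × ℝ)) (p : ℝ × ℝ) : Liftable L p := by
  simpa using liftable_affine L 0 p

section Extension

variable {L : (ℝ × ℝ) ≃L[ℝ] (ℝ × ℝ)}

lemma continuous_pillow_comp_chart (hL : Admissible L) :
    Continuous fun x : carpet => pillow (L (chart x)) := by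
  rw [continuous_iff_continuousAt]
  intro x₀
  rw [ContinuousAt, tendsto_iff_ultrafilter]
  intro U hU
  obtain ⟨w, -, hw⟩ := (isCompact_closedBall (0 : ℝ × ℝ) 1).ultrafilter_le_nhds
    (U.map fun x : carpet => chart x) (by
      refine tendsto_principal.2 (Eventually.of_forall fun x => ?_)
      simpa [chart] using norm_sect_le (norm_matching_quot_le x.2))
  have hw' : Tendsto (fun x : carpet => chart x) U (𝓝 w) := hw
  have h1 : Tendsto (fun x : carpet => proj x) U (𝓝 (pillow w)) :=
    (continuous_pillow.tendsto w).comp hw'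
  have h2 : Tendsto (fun x : carpet => proj x) U (𝓝 (proj x₀)) :=
    ((continuous_proj.comp continuous_subtype_val).tendsto x₀).mono_left hU
  have h3 : pillow (L w) = pillow (L (chart x₀)) := hL.pillow_eq (tendsto_nhds_unique h1 h2)
  have h4 : Tendsto (fun x : carpet => pillow (L (chart x))) U (𝓝 (pillow (L w))) :=
    ((continuous_pillow.comp L.continuous).tendsto w).comp hw'
  rwa [h3] at h4

/-- The interior points, as a subset of the carpet. -/
def interiorPts : Set carpet := {x | (x : ℝ × ℝ) ∈ carpetInt}

lemma dense_interiorPts : Dense interiorPts := by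
  intro x
  rw [closure_subtype]
  convert carpet_subset_closure_carpetInt x.2 using 2
  ext y
  constructor
  · rintro ⟨z, hz, rfl⟩
    exact hz
  · exact fun hy => ⟨⟨y, carpetInt_subset_carpet hy⟩, hy, rfl⟩

lemma tendsto_val_interiorPts (x : carpet) :
    Tendsto (Subtype.val : carpet → ℝ × ℝ) (𝓝[interiorPts] x) (𝓝[carpetInt] (x : ℝ × ℝ)) :=
  tendsto_nhdsWithin_iff.2 ⟨(continuous_subtype_val.tendsto x).mono_left nhdsWithin_le_nhds,
    self_mem_nhdsWithin⟩

/-- A lift of `L` to the carpet has the same limit along all approaches to a given point. -/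
lemma limit_unique (hL : Admissible L) (hL' : Admissible L.symm) {f : carpet → carpet}
    (hf : ∀ x, proj (f x) = pillow (L (chart x))) (hfi : ∀ x ∈ interiorPts, f x ∈ interiorPts)
    {x₀ y y' : carpet} {U V : Filter carpet} [U.NeBot] [V.NeBot]
    (hU : U ≤ 𝓝[interiorPts] x₀) (hV : V ≤ 𝓝[interiorPts] x₀)
    (hy : Tendsto f U (𝓝 y)) (hy' : Tendsto f V (𝓝 y')) : y = y' := by
  have hproj : ∀ {W : Filter carpet} [W.NeBot] {v : carpet}, W ≤ 𝓝[interiorPts] x₀ →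
      Tendsto f W (𝓝 v) → proj v = pillow (L (chart x₀)) := by
    intro W _ v hW hv
    have h1 : Tendsto (fun x => proj (f x)) W (𝓝 (proj v)) :=
      ((continuous_proj.comp continuous_subtype_val).tendsto v).comp hv
    have h2 : Tendsto (fun x : carpet => pillow (L (chart x))) W (𝓝 (pillow (L (chart x₀)))) :=
      ((continuous_pillow_comp_chart hL).tendsto x₀).mono_left (hW.trans nhdsWithin_le_nhds)
    simp only [hf] at h1
    exact tendsto_nhds_unique h1 h2
  have hpy := hproj hU hy
  have hpy' := hproj hV hy'
  have hchart := chart_eq_of_proj_eq y'.2 y.2 (hpy'.trans hpy.symm)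
  by_cases hs : chart y ∈ special
  swap
  · exact Subtype.ext (eq_of_proj_eq (mem_carpetInt_of_chart y.2 hs) y'.2 (hpy.trans hpy'.symm))
  have hs' : L (chart x₀) ∈ special := mem_special_of_pillow_eq hpy hs
  have hs0 : chart x₀ ∈ special := by simpa using hL'.mem_special hs'
  obtain ⟨c, w, hc, hcw, hγ⟩ : ∃ (c : ℝ) (w : ℝ × ℝ), c ≠ 0 ∧ L (chart x₀) = c • chart y + w ∧
      ∀ z, pillow (c • z + w) = pillow z := by
    obtain ⟨n, hn | hn⟩ := pillow_eq_iff.1 hpy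
    · exact ⟨1, intPt n, one_ne_zero, by rw [hn, one_smul],
        fun z => by rw [one_smul, pillow_add_intPt]⟩
    · exact ⟨-1, intPt n, by norm_num, by rw [hn, neg_one_smul],
        fun z => by rw [neg_one_smul, pillow_add_intPt, pillow_neg]⟩
  obtain ⟨θ₀, hθ₀, -⟩ := exists_direction_chart hs0
  obtain ⟨θ, hθ, hθi⟩ := exists_direction_chart hs
  obtain ⟨φL, -, -, hφL⟩ := liftable_linear L (chart x₀)
  obtain ⟨φ, -, hφi, hφ⟩ := liftable_smul_add hc w (chart y)
  have hdir : ∀ {W : Filter carpet} [W.NeBot] {v : carpet}, W ≤ 𝓝[interiorPts] x₀ →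
      Tendsto f W (𝓝 v) → chart v = chart y → φ (θ v) = φL (θ₀ x₀) := by
    intro W _ v hW hv hvy
    have h1 : Tendsto (fun x : carpet => L (chart x)) W
        (dirFilter (L (chart x₀)) (φL (θ₀ x₀))) :=
      (hφL _ (hθ₀ x₀ x₀.2 rfl).1).comp
        ((hθ₀ x₀ x₀.2 rfl).2.comp ((tendsto_val_interiorPts x₀).mono_left hW))
    have hv' : Tendsto f W (𝓝[interiorPts] v) := by
      refine tendsto_nhdsWithin_iff.2 ⟨hv, hW ?_⟩
      filter_upwards [self_mem_nhdsWithin] with x hx using hfi x hx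
    have h2 : Tendsto (fun x : carpet => c • chart (f x) + w) W
        (dirFilter (c • chart y + w) (φ (θ v))) :=
      (hφ _ (hθ v v.2 hvy).1).comp ((hθ v v.2 hvy).2.comp ((tendsto_val_interiorPts v).comp hv'))
    rw [← hcw] at h2
    have h3 := eventually_eq_of_pillow_eq (two_smul_notMem_of_mem_special hs')
    have h4 := ((tendsto_dirFilter.1 h1).1.prodMk (tendsto_dirFilter.1 h2).1).eventually h3
    refine tendsto_dirFilter_unique h2 (h1.congr' ?_)
    filter_upwards [h4] with x hx
    exact hx (by rw [hγ, ← hf x]; rfl)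
  refine Subtype.ext (hθi y y.2 y' y'.2 rfl hchart (hφi (hθ y y.2 rfl).1 (hθ y' y'.2 hchart).1 ?_))
  rw [hdir hU hy rfl, hdir hV hy' hchart]

/-- Every admissible linear automorphism lifts to a continuous self-map of the carpet. -/
theorem exists_lift (hL : Admissible L) (hL' : Admissible L.symm) :
    ∃ H : carpet → carpet, Continuous H ∧ ∀ x, proj (H x) = pillow (L (chart x)) := by
  have : CompactSpace carpet := isCompact_iff_compactSpace.1 isCompact_carpet
  have hex : ∀ x : carpet, ∃ x' : carpet, proj x' = pillow (L (chart x)) := fun x => by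
    obtain ⟨x', hx', h⟩ := exists_proj_eq (L (chart x))
    exact ⟨⟨x', hx'⟩, h⟩
  choose f hf using hex
  have hfi : ∀ x ∈ interiorPts, f x ∈ interiorPts := fun x hx => by
    refine mem_carpetInt_of_chart (f x).2 fun hs => chart_notMem_special hx ?_
    simpa using hL'.mem_special (mem_special_of_pillow_eq (hf x) hs)
  have hne : ∀ x, (𝓝[interiorPts] x).NeBot := fun x =>
    mem_closure_iff_nhdsWithin_neBot.1 (dense_interiorPts x)
  have hlim : ∀ x, ∃ y, Tendsto f (𝓝[interiorPts] x) (𝓝 y) := by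
    intro x
    have := hne x
    have hconv : ∀ U : Ultrafilter carpet, ∃ y, Tendsto f U (𝓝 y) := fun U => by
      obtain ⟨y, -, hy⟩ := isCompact_univ.ultrafilter_le_nhds (U.map f) (by simp)
      exact ⟨y, hy⟩
    obtain ⟨y, hy⟩ := hconv (Ultrafilter.of (𝓝[interiorPts] x))
    refine ⟨y, (tendsto_iff_ultrafilter _ _ _).2 fun V hV => ?_⟩
    obtain ⟨y', hy'⟩ := hconv V
    rw [limit_unique hL hL' hf hfi (Ultrafilter.of_le _) hV hy hy']
    exact hy'
  let H : carpet → carpet := extendFrom interiorPts f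
  refine ⟨H, continuous_extendFrom dense_interiorPts hlim, fun x => ?_⟩
  have := hne x
  have h1 : Tendsto f (𝓝[interiorPts] x) (𝓝 (H x)) := tendsto_extendFrom (hlim x)
  have h2 : Tendsto (fun x => proj (f x)) (𝓝[interiorPts] x)
      (𝓝 (proj (H x))) :=
    ((continuous_proj.comp continuous_subtype_val).tendsto _).comp h1
  simp only [hf] at h2
  exact tendsto_nhds_unique h2
    (((continuous_pillow_comp_chart hL).tendsto x).mono_left nhdsWithin_le_nhds)

/-- Every admissible linear automorphism lifts to a homeomorphism of the carpet. -/
theorem exists_homeomorph_lift (hL : Admissible L) (hL' : Admissible L.symm) :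
    ∃ H : carpet ≃ₜ carpet, ∀ (x : carpet) (z : ℝ × ℝ), proj x = pillow z →
      proj (H x) = pillow (L z) := by
  obtain ⟨H, hH, hHL⟩ := exists_lift hL hL'
  obtain ⟨G, hG, hGL⟩ := exists_lift hL' hL
  have key : ∀ {M : (ℝ × ℝ) ≃L[ℝ] (ℝ × ℝ)} {F F' : carpet → carpet}, Admissible M.symm →
      Continuous F → Continuous F' → (∀ x, proj (F x) = pillow (M (chart x))) →
      (∀ x, proj (F' x) = pillow (M.symm (chart x))) → Function.LeftInverse F' F := by
    intro M F F' hM' hF hF' h h'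
    refine fun x => congrFun (Continuous.ext_on dense_interiorPts (hF'.comp hF) continuous_id
      fun x hx => ?_) x
    refine Subtype.ext (eq_of_proj_eq hx (F' (F x)).2 ?_).symm
    rw [h' (F x), hM'.pillow_eq (h x), M.symm_apply_apply, proj]
  refine ⟨⟨⟨H, G, key hL' hH hG hHL hGL, key (M := L.symm) hL hG hH hGL hHL⟩, hH, hG⟩,
    fun x z hxz => ?_⟩
  change proj (H x) = _
  rw [hHL x]
  exact hL.pillow_eq hxz

end Extension

lemma irrational_eigSlope : Irrational eigSlope := by
  have h5 : Irrational (√5) := by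
    simpa using Nat.Prime.irrational_sqrt (p := 5) (by norm_num)
  simpa [eigSlope] using h5.ratCast_add 2

/-- Finitely many multiples of an irrational number are `ε`-dense modulo one. -/
lemma exists_bound_approx {α : ℝ} (hα : Irrational α) {ε : ℝ} (hε : 0 < ε) :
    ∃ K : ℝ, ∀ r : ℝ, ∃ k m : ℤ, |(k : ℝ)| ≤ K ∧ |k * α + m - r| < ε := by
  have hd : Dense (AddSubgroup.closure {α, 1} : Set ℝ) :=
    dense_addSubgroupClosure_pair_iff.2 (by simpa using hα)
  obtain ⟨η, hη, hη0, hηε⟩ := hd.exists_between hε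
  obtain ⟨k₀, m₀, h₀⟩ := AddSubgroup.mem_closure_pair.1 hη
  simp only [zsmul_eq_mul, mul_one] at h₀
  refine ⟨|(k₀ : ℝ)| / η, fun r => ⟨⌊Int.fract r / η⌋ * k₀, ⌊Int.fract r / η⌋ * m₀ + ⌊r⌋, ?_, ?_⟩⟩
  · have h1 : 0 ≤ Int.fract r / η := div_nonneg (Int.fract_nonneg r) hη0.le
    have h2 : (0 : ℝ) ≤ ⌊Int.fract r / η⌋ := by exact_mod_cast Int.floor_nonneg.2 h1
    have h3 : (⌊Int.fract r / η⌋ : ℝ) ≤ 1 / η :=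
      (Int.floor_le _).trans (by gcongr; exact (Int.fract_lt_one r).le)
    push_cast
    rw [abs_mul, abs_of_nonneg h2, show |(k₀ : ℝ)| / η = 1 / η * |(k₀ : ℝ)| by ring]
    exact mul_le_mul_of_nonneg_right h3 (abs_nonneg _)
  · have h1 := Int.floor_le (Int.fract r / η)
    have h2 := Int.lt_floor_add_one (Int.fract r / η)
    rw [le_div_iff₀ hη0] at h1
    rw [div_lt_iff₀ hη0] at h2
    have e : ((⌊Int.fract r / η⌋ * k₀ : ℤ) : ℝ) * α + ((⌊Int.fract r / η⌋ * m₀ + ⌊r⌋ : ℤ) : ℝ) - r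
        = ⌊Int.fract r / η⌋ * η - Int.fract r := by
      push_cast
      rw [← h₀, Int.fract]
      ring
    rw [e, abs_lt]
    constructor <;> linarith

/-- Long segments of irrational slope are uniformly dense modulo integer translations. -/
lemma exists_bound_line {ε : ℝ} (hε : 0 < ε) : ∃ T : ℝ, ∀ q : ℝ × ℝ, ∃ (s : ℝ) (m : ℤ × ℤ),
    |s| ≤ T ∧ ‖s • ((1, eigSlope) : ℝ × ℝ) + intPt m - q‖ < ε := by
  obtain ⟨K, hK⟩ := exists_bound_approx irrational_eigSlope hε
  refine ⟨1 + K, fun q => ?_⟩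
  obtain ⟨k, m, hk, hm⟩ := hK (q.2 - eigSlope * Int.fract q.1)
  refine ⟨Int.fract q.1 + k, (⌊q.1⌋ - k, m), ?_, ?_⟩
  · refine (abs_add_le _ _).trans (add_le_add ?_ hk)
    rw [abs_of_nonneg (Int.fract_nonneg _)]
    exact (Int.fract_lt_one _).le
  · have e : (Int.fract q.1 + k) • ((1, eigSlope) : ℝ × ℝ) + intPt (⌊q.1⌋ - k, m) - q =
        (0, k * eigSlope + m - (q.2 - eigSlope * Int.fract q.1)) := by
      ext
      · simp only [intPt, Prod.fst_sub, Prod.fst_add, Prod.smul_fst, smul_eq_mul, mul_one]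
        push_cast
        linarith [Int.fract_add_floor q.1]
      · simp only [intPt, Prod.snd_sub, Prod.snd_add, Prod.smul_snd, smul_eq_mul]
        ring
    rw [e, norm_lt_iff]
    exact ⟨by simpa using hε, hm⟩

lemma catMap_iterate_add (n : ℕ) (z : ℝ × ℝ) (t : ℝ) :
    catMap^[n] (z + t • (1, eigSlope)) = catMap^[n] z + (t * eigVal ^ n) • (1, eigSlope) := by
  induction n with
  | zero => simp
  | succ n ih =>
    rw [Function.iterate_succ_apply', Function.iterate_succ_apply', ih, map_add, map_smul,
      catMap_eigenvector, smul_smul, pow_succ, mul_assoc]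

/-- The automorphism `catMap` is topologically mixing modulo integer translations. -/
lemma catMap_mixing {O O' : Set (ℝ × ℝ)} (hO : IsOpen O) (hO' : IsOpen O') (hne : O.Nonempty)
    (hne' : O'.Nonempty) :
    ∃ N : ℕ, ∀ n, N ≤ n → ∃ z ∈ O, ∃ m : ℤ × ℤ, catMap^[n] z + intPt m ∈ O' := by
  obtain ⟨z, hz⟩ := hne
  obtain ⟨w, hw⟩ := hne'
  obtain ⟨ε, hε, hεw⟩ := Metric.isOpen_iff.1 hO' w hw
  have hc : Continuous fun t : ℝ => z + t • ((1, eigSlope) : ℝ × ℝ) := by fun_prop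
  obtain ⟨δ, hδ, hδz⟩ := Metric.isOpen_iff.1 (hO.preimage hc) 0 (by
    change z + (0 : ℝ) • _ ∈ O
    rwa [zero_smul, add_zero])
  obtain ⟨T, hT⟩ := exists_bound_line hε
  have hlim : Tendsto (fun n : ℕ => δ * eigVal ^ n) atTop atTop :=
    (tendsto_pow_atTop_atTop_of_one_lt eigVal_pos).const_mul_atTop hδ
  obtain ⟨N, hN⟩ := eventually_atTop.1 (hlim.eventually_gt_atTop T)
  refine ⟨N, fun n hn => ?_⟩
  obtain ⟨s, m, hs, hm⟩ := hT (w - catMap^[n] z)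
  have hpos : 0 < eigVal ^ n := pow_pos (by linarith [eigVal_pos]) n
  refine ⟨z + (s / eigVal ^ n) • (1, eigSlope), hδz ?_, m, hεw ?_⟩
  · rw [Metric.mem_ball, dist_zero_right, Real.norm_eq_abs, abs_div, abs_of_pos hpos,
      div_lt_iff₀ hpos]
    exact hs.trans_lt (hN n hn)
  · rw [catMap_iterate_add, div_mul_cancel₀ _ hpos.ne', mem_ball_iff_norm]
    rwa [← sub_add, sub_add_eq_add_sub, add_comm, ← add_assoc] at hm

/-- Rational points are periodic under `catMap`, up to the pillow identifications. -/
lemma exists_pillow_iterate_ratPt_eq (q : ℚ × ℚ) :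
    ∃ n : ℕ, 1 ≤ n ∧ pillow (catMap^[n] (ratPt q)) = pillow (ratPt q) := by
  set d : ℤ := q.1.den * q.2.den with hd
  have hd0 : 0 < d := by positivity
  have hdR : (0 : ℝ) < d := by exact_mod_cast hd0
  let Λ : Set (ℝ × ℝ) := {z | ∃ k : ℤ × ℤ, (d : ℝ) • z = intPt k}
  have hfin : (pillow '' Λ).Finite := by
    refine (((Set.finite_Ico (0 : ℤ) d).prod (Set.finite_Ico (0 : ℤ) d)).image
      fun k : ℤ × ℤ => pillow ((d : ℝ)⁻¹ • intPt k)).subset ?_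
    rintro - ⟨z, ⟨k, hk⟩, rfl⟩
    refine ⟨(k.1 % d, k.2 % d), ⟨⟨Int.emod_nonneg _ hd0.ne', Int.emod_lt_of_pos _ hd0⟩,
      Int.emod_nonneg _ hd0.ne', Int.emod_lt_of_pos _ hd0⟩, ?_⟩
    refine pillow_eq_iff.2 ⟨(k.1 / d, k.2 / d), Or.inl ?_⟩
    have hz : z = (d : ℝ)⁻¹ • intPt k := by rw [← hk, inv_smul_smul₀ hdR.ne']
    have key : ∀ j : ℤ, (d : ℝ)⁻¹ * j = (d : ℝ)⁻¹ * (j % d : ℤ) + (j / d : ℤ) := by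
      intro j
      have h : (j : ℝ) = (j % d : ℤ) + d * (j / d : ℤ) := by
        exact_mod_cast (Int.emod_add_mul_ediv j d).symm
      rw [h]
      field_simp
    rw [hz]
    ext
    · exact key k.1
    · exact key k.2
  have hmem : ∀ i, catMap^[i] (ratPt q) ∈ Λ := by
    intro i
    induction i with
    | zero =>
      refine ⟨(q.1.num * q.2.den, q.2.num * q.1.den), ?_⟩
      have h1 : (q.1 : ℝ) = q.1.num / q.1.den := Rat.cast_def _
      have h2 : (q.2 : ℝ) = q.2.num / q.2.den := Rat.cast_def _
      have h1' : (q.1.den : ℝ) ≠ 0 := by exact_mod_cast q.1.den_nz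
      have h2' : (q.2.den : ℝ) ≠ 0 := by exact_mod_cast q.2.den_nz
      ext
      · simp only [Function.iterate_zero, id, ratPt, intPt, Prod.smul_fst, smul_eq_mul, hd]
        push_cast
        rw [h1]; field_simp
      · simp only [Function.iterate_zero, id, ratPt, intPt, Prod.smul_snd, smul_eq_mul, hd]
        push_cast
        rw [h2]; field_simp
    | succ i ih =>
      obtain ⟨k, hk⟩ := ih
      obtain ⟨m, hm⟩ := admissible_catMap.map_intPt k
      exact ⟨m, by rw [Function.iterate_succ_apply', ← map_smul, hk, hm]⟩
  obtain ⟨i, j, hij, h⟩ := Set.Finite.exists_lt_map_eq_of_forall_mem (t := pillow '' Λ)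
    (f := fun i : ℕ => pillow (catMap^[i] (ratPt q)))
    (fun i => Set.mem_image_of_mem _ (hmem i)) hfin
  have hback : ∀ (i : ℕ) (z w : ℝ × ℝ), pillow (catMap^[i] z) = pillow (catMap^[i] w) →
      pillow z = pillow w := by
    intro i
    induction i with
    | zero => exact fun z w h => h
    | succ i ih =>
      intro z w h
      rw [Function.iterate_succ_apply', Function.iterate_succ_apply'] at h
      exact ih z w (by simpa using admissible_catMap_symm.pillow_eq h)
  refine ⟨j - i, by omega, (hback i _ _ ?_).symm⟩
  rw [← Function.iterate_add_apply, Nat.add_sub_cancel' hij.le]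
  exact h

/-- The carpet carries a mixing homeomorphism with dense periodic points. -/
theorem exists_mixing_homeomorph : ∃ H : carpet ≃ₜ carpet, TopologicallyMixing H ∧
    Dense {x | ∃ n : ℕ, 1 ≤ n ∧ H^[n] x = x} := by
  have : CompactSpace carpet := isCompact_iff_compactSpace.1 isCompact_carpet
  obtain ⟨H, hH⟩ := exists_homeomorph_lift admissible_catMap admissible_catMap_symm
  have hiter : ∀ (n : ℕ) (x : carpet) (z : ℝ × ℝ), proj x = pillow z →
      proj (H^[n] x) = pillow (catMap^[n] z) := by
    intro n
    induction n with
    | zero => exact fun x z h => h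
    | succ n ih =>
      intro x z h
      rw [Function.iterate_succ_apply', Function.iterate_succ_apply']
      exact hH _ _ (ih x z h)
  let O : Set carpet → Set (ℝ × ℝ) := fun U => {z | ∀ x : carpet, proj x = pillow z → x ∈ U}
  have hO : ∀ U, IsOpen U → IsOpen (O U) := fun U hU => by
    simpa [O] using isOpen_setOf_fiber_subset isCompact_univ
      (continuous_proj.comp continuous_subtype_val).continuousOn hU
  have hOne : ∀ U : Set carpet, IsOpen U → U.Nonempty → ∃ z ∈ O U, z ∉ special := by
    intro U hU hne
    obtain ⟨x, hx, hxU⟩ := dense_interiorPts.exists_mem_open hU hne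
    refine ⟨chart x, fun x' hx' => ?_, chart_notMem_special hx⟩
    rwa [← Subtype.ext (eq_of_proj_eq hx x'.2 hx'.symm)]
  have hfib : ∀ z, ∃ x : carpet, proj x = pillow z := fun z => by
    obtain ⟨x, hx, h⟩ := exists_proj_eq z
    exact ⟨⟨x, hx⟩, h⟩
  refine ⟨H, fun U V hU hV hUne hVne => ?_, dense_iff_inter_open.2 fun U hU hUne => ?_⟩
  · obtain ⟨z, hz, -⟩ := hOne U hU hUne
    obtain ⟨w, hw, -⟩ := hOne V hV hVne
    obtain ⟨N, hN⟩ := catMap_mixing (hO U hU) (hO V hV) ⟨z, hz⟩ ⟨w, hw⟩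
    refine ⟨N, fun n hn => ?_⟩
    obtain ⟨z, hz, m, hm⟩ := hN n hn
    obtain ⟨x, hx⟩ := hfib z
    exact ⟨H^[n] x, ⟨x, hz x hx, rfl⟩, hm _ (by rw [hiter n x z hx, pillow_add_intPt])⟩
  · obtain ⟨z, hz, hzs⟩ := hOne U hU hUne
    have hopen : IsOpen (O U ∩ pillow ⁻¹' {pillow backCenter}ᶜ) :=
      (hO U hU).inter (isOpen_compl_singleton.preimage continuous_pillow)
    obtain ⟨-, ⟨q, rfl⟩, hqU, hqc⟩ := Dense.exists_mem_open denseRange_ratPt hopen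
      ⟨z, hz, fun h => hzs (Or.inr h)⟩
    obtain ⟨x, hx⟩ := hfib (ratPt q)
    obtain ⟨n, hn, hper⟩ := exists_pillow_iterate_ratPt_eq q
    refine ⟨x, hqU x hx, n, hn, ?_⟩
    have hxi : (x : ℝ × ℝ) ∈ carpetInt := by
      refine mem_carpetInt_of_chart x.2 fun hs => ?_
      rcases mem_special_of_pillow_eq hx hs with h | h
      · exact ratPt_notMem_blowUp q h
      · exact hqc h
    refine Subtype.ext (eq_of_proj_eq hxi (H^[n] x).2 ?_).symm
    rw [hiter n x _ hx, hper, hx]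

end SierpinskiCarpet

open SierpinskiCarpet in
/-- The Sierpiński carpet admits a topologically mixing homeomorphism with a dense set of
periodic points. -/
theorem sierpinskiCarpet_mixing_homeo_dense_periodic :
    ∃ H : ↥sierpinskiCarpet ≃ₜ ↥sierpinskiCarpet,
      TopologicallyMixing (⇑H) ∧
      Dense {x : ↥sierpinskiCarpet | ∃ n : ℕ, 1 ≤ n ∧ (⇑H)^[n] x = x} := by
  obtain ⟨H, hmix, hper⟩ := exists_mixing_homeomorph
  have hconj : ∀ (n : ℕ) (x : sierpinskiCarpet),
      (rescale.trans (H.trans rescale.symm))^[n] x = rescale.symm (H^[n] (rescale x)) := by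
    intro n x
    induction n with
    | zero => simp
    | succ n ih => rw [Function.iterate_succ_apply', Function.iterate_succ_apply', ih]; simp
  refine ⟨rescale.trans (H.trans rescale.symm), fun U V hU hV hUne hVne => ?_, ?_⟩
  · obtain ⟨N, hN⟩ := hmix (rescale '' U) (rescale '' V) (rescale.isOpenMap U hU)
      (rescale.isOpenMap V hV) (hUne.image _) (hVne.image _)
    refine ⟨N, fun n hn => ?_⟩
    obtain ⟨-, ⟨-, ⟨x, hx, rfl⟩, rfl⟩, y, hy, hxy⟩ := hN n hn
    exact ⟨_, ⟨x, hx, rfl⟩, by rw [hconj, ← hxy]; simpa using hy⟩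
  · refine (hper.preimage rescale.isOpenMap).mono ?_
    rintro x ⟨n, hn, hx⟩
    exact ⟨n, hn, by rw [hconj, hx]; simp⟩
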